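/- arXiv:1307.8025 — 2 statements merged into one kernel-verified Lean document; each statement's English description precedes it below -/
import Mathlib

section
/- Let n ≥ 2, let B ⊂ ℝⁿ be an open ball, and let Ω ⊂ ℝⁿ be a nonempty open set with the same Lebesgue measure as B. For a nonempty open set D ⊂ ℝⁿ define λ₁^D(D) as the infimum of ∫_D |∇u|² dx / ∫_D u² dx over all nonzero smooth compactly supported u : ℝⁿ → ℝ with support in D. Then λ₁^D(Ω) ≥ λ₁^D(B). -/
open Real MeasureTheory Set

/-- The fundamental Dirichlet eigenvalue of `D ⊆ ℝⁿ`, defined variationally as the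
infimum of the Rayleigh quotient `∫_D |∇u|² / ∫_D u²` over nonzero smooth functions
compactly supported in `D`. -/
noncomputable def lambda1D (n : ℕ) (D : Set (EuclideanSpace ℝ (Fin n))) : ℝ :=
  sInf {r : ℝ | ∃ u : EuclideanSpace ℝ (Fin n) → ℝ, ContDiff ℝ (⊤ : ℕ∞) u ∧
    HasCompactSupport u ∧ tsupport u ⊆ D ∧ u ≠ 0 ∧
    r = (∫ x in D, ‖fderiv ℝ u x‖ ^ 2) / ∫ x in D, u x ^ 2}

namespace FaberKrahn

open Filter Topology Metric
open scoped ENNReal NNReal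

variable {E : Type*} [NormedAddCommGroup E] [InnerProductSpace ℝ E]

/-- Reflection across the perpendicular bisector of the segment from `a` to `b`. -/
noncomputable def bisectorReflection (a b x : E) : E :=
  (ℝ ∙ (a - b))ᗮ.reflection (x - midpoint ℝ a b) + midpoint ℝ a b

/-- A function which is nonnegative exactly at the points at least as close to `a` as to `b`. -/
def bisectorSide (a b x : E) : ℝ := ‖x - b‖ ^ 2 - ‖x - a‖ ^ 2

section Reflection

variable (a b x y : E)

lemma bisectorReflection_involutive : Function.Involutive (bisectorReflection a b) := by
  intro x
  simp [bisectorReflection]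

lemma dist_bisectorReflection :
    dist (bisectorReflection a b x) (bisectorReflection a b y) = dist x y := by
  simp [bisectorReflection]

lemma dist_bisectorReflection_left :
    dist (bisectorReflection a b x) y = dist x (bisectorReflection a b y) := by
  rw [← dist_bisectorReflection a b, bisectorReflection_involutive]

lemma continuous_bisectorReflection : Continuous (bisectorReflection a b) := by
  unfold bisectorReflection
  fun_prop

lemma bisectorReflection_left : bisectorReflection a b a = b := by
  have h : a - midpoint ℝ a b = (1 / 2 : ℝ) • (a - b) := by
    rw [midpoint_eq_smul_add, invOf_eq_inv]
    module
  rw [bisectorReflection, h, map_smul, Submodule.reflection_orthogonalComplement_singleton_eq_neg,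
    midpoint_eq_smul_add, invOf_eq_inv]
  module

lemma bisectorReflection_right : bisectorReflection a b b = a := by
  simpa only [bisectorReflection_left] using bisectorReflection_involutive a b a

lemma bisectorSide_bisectorReflection :
    bisectorSide a b (bisectorReflection a b x) = -bisectorSide a b x := by
  simp only [bisectorSide, ← dist_eq_norm, dist_bisectorReflection_left, bisectorReflection_left,
    bisectorReflection_right]
  ring

variable {a b x y}

lemma bisectorSide_eq_inner :
    bisectorSide a b x = 2 * inner ℝ (a - b) (x - midpoint ℝ a b) := by
  have h1 : x - b = (x - midpoint ℝ a b) + (1 / 2 : ℝ) • (a - b) := by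
    rw [midpoint_eq_smul_add, invOf_eq_inv]
    module
  have h2 : x - a = (x - midpoint ℝ a b) - (1 / 2 : ℝ) • (a - b) := by
    rw [midpoint_eq_smul_add, invOf_eq_inv]
    module
  rw [bisectorSide, h1, h2]
  generalize x - midpoint ℝ a b = w
  rw [norm_add_sq_real, norm_sub_sq_real, inner_smul_right, real_inner_comm]
  ring

lemma bisectorReflection_eq :
    bisectorReflection a b x = x - (bisectorSide a b x / ‖a - b‖ ^ 2) • (a - b) := by
  rw [bisectorReflection, Submodule.reflection_orthogonal_apply, Submodule.reflection_singleton_apply,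
    bisectorSide_eq_inner]
  simp only [RCLike.ofReal_real_eq_id, id_eq]
  module

lemma dist_le_dist_bisectorReflection (hx : 0 ≤ bisectorSide a b x) (hy : 0 ≤ bisectorSide a b y) :
    dist x y ≤ dist x (bisectorReflection a b y) := by
  rcases eq_or_ne a b with rfl | hab
  · simp [bisectorReflection_eq]
  have hpos : 0 < ‖a - b‖ ^ 2 := by
    have := norm_pos_iff.2 (sub_ne_zero.2 hab)
    positivity
  rw [dist_eq_norm, dist_eq_norm]
  refine le_of_sq_le_sq ?_ (norm_nonneg _)
  set s := bisectorSide a b y / ‖a - b‖ ^ 2 with hs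
  have hs0 : 0 ≤ s := by positivity
  have hys : s * ‖a - b‖ ^ 2 = bisectorSide a b y := div_mul_cancel₀ _ hpos.ne'
  have h1 : x - bisectorReflection a b y = (x - y) + s • (a - b) := by
    rw [bisectorReflection_eq]
    module
  rw [h1, norm_add_sq_real, inner_smul_right, norm_smul, mul_pow, Real.norm_eq_abs, sq_abs,
    real_inner_comm]
  have h2 : inner ℝ (a - b) (x - y) = (bisectorSide a b x - bisectorSide a b y) / 2 := by
    rw [bisectorSide_eq_inner, bisectorSide_eq_inner, ← mul_sub, ← inner_sub_right]
    simp
  rw [h2]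
  nlinarith [mul_nonneg hs0 hx]

lemma bisectorSide_nonneg_iff {F : Type*} [NormedAddCommGroup F] {a b x : F} :
    0 ≤ bisectorSide a b x ↔ dist x a ≤ dist x b := by
  rw [bisectorSide, sub_nonneg, ← dist_eq_norm, ← dist_eq_norm]
  exact pow_le_pow_iff_left₀ dist_nonneg dist_nonneg two_ne_zero

end Reflection

/-- The polarization of `f` across the perpendicular bisector of `a` and `b`, with the larger
values moved to the side of `a`. -/
noncomputable def polarize (a b : E) (f : E → ℝ) (x : E) : ℝ :=
  if 0 ≤ bisectorSide a b x then max (f x) (f (bisectorReflection a b x))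
  else min (f x) (f (bisectorReflection a b x))

section Polarize

variable {a b : E} {f : E → ℝ}

lemma polarize_of_nonneg {x : E} (hx : 0 ≤ bisectorSide a b x) :
    polarize a b f x = max (f x) (f (bisectorReflection a b x)) := if_pos hx

lemma bisectorReflection_of_side_eq_zero {x : E} (hx : bisectorSide a b x = 0) :
    bisectorReflection a b x = x := by
  simp [bisectorReflection_eq, hx]

lemma polarize_of_nonpos {x : E} (hx : bisectorSide a b x ≤ 0) :
    polarize a b f x = min (f x) (f (bisectorReflection a b x)) := by
  rcases hx.lt_or_eq with h | h
  · exact if_neg h.not_ge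
  · rw [polarize_of_nonneg h.ge, bisectorReflection_of_side_eq_zero h, max_self, min_self]

lemma polarize_reflection_of_nonneg {x : E} (hx : 0 ≤ bisectorSide a b x) :
    polarize a b f (bisectorReflection a b x) = min (f x) (f (bisectorReflection a b x)) := by
  rw [polarize_of_nonpos (by rw [bisectorSide_bisectorReflection]; linarith),
    bisectorReflection_involutive a b x, min_comm]

lemma forall_of_forall_side_nonneg {p : E → Prop} (a b : E)
    (h : ∀ x, 0 ≤ bisectorSide a b x → p x ∧ p (bisectorReflection a b x)) (x : E) : p x := by
  rcases le_total 0 (bisectorSide a b x) with hx | hx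
  · exact (h x hx).1
  · have := (h (bisectorReflection a b x) (by rw [bisectorSide_bisectorReflection]; linarith)).2
    rwa [bisectorReflection_involutive a b x] at this

lemma polarize_add_polarize_reflection (x : E) :
    polarize a b f x + polarize a b f (bisectorReflection a b x)
      = f x + f (bisectorReflection a b x) := by
  induction x using forall_of_forall_side_nonneg a b with
  | h x hx =>
  rw [polarize_reflection_of_nonneg hx, polarize_of_nonneg hx, bisectorReflection_involutive a b x,
    polarize_of_nonneg hx]
  exact ⟨max_add_min _ _, by rw [add_comm, max_add_min, add_comm]⟩

/-- Polarization permutes the values at `x` and its reflection. -/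
lemma polarize_eq_or (x : E) :
    (polarize a b f x = f x ∧
      polarize a b f (bisectorReflection a b x) = f (bisectorReflection a b x)) ∨
    (polarize a b f x = f (bisectorReflection a b x) ∧
      polarize a b f (bisectorReflection a b x) = f x) := by
  have h := polarize_add_polarize_reflection (a := a) (b := b) (f := f) x
  have h' : polarize a b f x = f x ∨ polarize a b f x = f (bisectorReflection a b x) := by
    rw [polarize]
    split_ifs
    exacts [max_choice _ _, min_choice _ _]
  rcases h' with h' | h'
  · left; exact ⟨h', by linarith⟩
  · right; exact ⟨h', by linarith⟩

lemma lipschitzWith_polarize {L : ℝ≥0} (hf : LipschitzWith L f) :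
    LipschitzWith L (polarize a b f) := by
  have key : ∀ x y, |f x - f y| ≤ L * dist x y := fun x y => hf.dist_le_mul x y
  have same : ∀ x y, 0 ≤ bisectorSide a b x → 0 ≤ bisectorSide a b y →
      |polarize a b f x - polarize a b f y| ≤ L * dist x y := by
    intro x y hx hy
    rw [polarize_of_nonneg hx, polarize_of_nonneg hy]
    refine (abs_max_sub_max_le_max _ _ _ _).trans (max_le (key x y) ?_)
    simpa [dist_bisectorReflection] using key (bisectorReflection a b x) (bisectorReflection a b y)
  have same' : ∀ x y, 0 ≤ bisectorSide a b x → 0 ≤ bisectorSide a b y →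
      |polarize a b f (bisectorReflection a b x) - polarize a b f (bisectorReflection a b y)|
        ≤ L * dist x y := by
    intro x y hx hy
    rw [polarize_reflection_of_nonneg hx, polarize_reflection_of_nonneg hy]
    refine (abs_min_sub_min_le_max _ _ _ _).trans (max_le (key x y) ?_)
    simpa [dist_bisectorReflection] using key (bisectorReflection a b x) (bisectorReflection a b y)
  have opposite : ∀ x y, 0 ≤ bisectorSide a b x → 0 ≤ bisectorSide a b y →
      |polarize a b f x - polarize a b f (bisectorReflection a b y)|
        ≤ L * dist x (bisectorReflection a b y) := by
    intro x y hx hy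
    have hd := mul_le_mul_of_nonneg_left (dist_le_dist_bisectorReflection hx hy) L.coe_nonneg
    rw [polarize_of_nonneg hx, polarize_reflection_of_nonneg hy]
    have h1 := (key x y).trans hd
    have h2 := key x (bisectorReflection a b y)
    have h3 := key (bisectorReflection a b x) y
    have h4 := key (bisectorReflection a b x) (bisectorReflection a b y)
    rw [dist_bisectorReflection_left] at h3
    rw [dist_bisectorReflection] at h4
    have h4 := h4.trans hd
    rcases max_choice (f x) (f (bisectorReflection a b x)) with h | h <;>
    rcases min_choice (f y) (f (bisectorReflection a b y)) with h' | h' <;>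
    rw [h, h'] <;> assumption
  refine LipschitzWith.of_dist_le_mul fun x y => ?_
  rw [Real.dist_eq]
  induction x using forall_of_forall_side_nonneg a b with
  | h x hx =>
  induction y using forall_of_forall_side_nonneg a b with
  | h y hy =>
  refine ⟨⟨same x y hx hy, ?_⟩, opposite x y hx hy, ?_⟩
  · rw [abs_sub_comm, dist_comm]
    exact opposite y x hy hx
  · rw [dist_bisectorReflection]
    exact same' x y hx hy

lemma polarize_nonneg (hf : ∀ x, 0 ≤ f x) (x : E) : 0 ≤ polarize a b f x := by
  rcases polarize_eq_or (a := a) (b := b) (f := f) x with h | h <;> rw [h.1] <;> apply hf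

lemma polarize_eq_zero_of_dist_gt {c : E} {R : ℝ} (hc : dist c a ≤ dist c b)
    (hf : ∀ x, 0 ≤ f x) (hfR : ∀ x, R < dist x c → f x = 0) (x : E) (hx : R < dist x c) :
    polarize a b f x = 0 := by
  rw [← bisectorSide_nonneg_iff] at hc
  rcases le_total 0 (bisectorSide a b x) with h | h
  · rw [polarize_of_nonneg h, hfR x hx, hfR, max_self]
    rw [dist_bisectorReflection_left, dist_comm]
    have := dist_le_dist_bisectorReflection h hc
    rw [dist_comm _ x]
    linarith
  · rw [polarize_of_nonpos h, hfR x hx, min_eq_left (hf _)]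

end Polarize

variable [FiniteDimensional ℝ E] [MeasurableSpace E] [BorelSpace E]

lemma measurePreserving_bisectorReflection (a b : E) :
    MeasurePreserving (bisectorReflection a b) :=
  (measurePreserving_add_right volume _).comp
    ((LinearIsometryEquiv.measurePreserving (ℝ ∙ (a - b))ᗮ.reflection).comp
      (measurePreserving_sub_right volume _))

/-- The bisector reflection as a measurable equivalence. -/
noncomputable def bisectorReflectionEquiv (a b : E) : E ≃ᵐ E where
  toEquiv := (bisectorReflection_involutive a b).toPerm
  measurable_toFun := (continuous_bisectorReflection a b).measurable
  measurable_invFun := (continuous_bisectorReflection a b).measurable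

lemma lintegral_comp_bisectorReflection (a b : E) (g : E → ℝ≥0∞) :
    ∫⁻ x, g (bisectorReflection a b x) = ∫⁻ x, g x :=
  (measurePreserving_bisectorReflection a b).lintegral_comp_emb
    (bisectorReflectionEquiv a b).measurableEmbedding g

lemma integral_comp_bisectorReflection (a b : E) (g : E → ℝ) :
    ∫ x, g (bisectorReflection a b x) = ∫ x, g x :=
  (measurePreserving_bisectorReflection a b).integral_comp
    (bisectorReflectionEquiv a b).measurableEmbedding g

/-- Polarization preserves every integral of a function of the values. -/
lemma lintegral_comp_polarize {a b : E} {f : E → ℝ} {L : ℝ≥0} (hf : LipschitzWith L f)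
    {g : ℝ → ℝ≥0∞} (hg : Measurable g) : ∫⁻ x, g (polarize a b f x) = ∫⁻ x, g (f x) := by
  have double : ∀ u : E → ℝ, Continuous u →
      ∫⁻ x, (g (u x) + g (u (bisectorReflection a b x))) = 2 * ∫⁻ x, g (u x) := by
    intro u hu
    rw [lintegral_add_left (f := fun x => g (u x)) (hg.comp hu.measurable),
      lintegral_comp_bisectorReflection a b (fun x => g (u x)), two_mul]
  have h : 2 * ∫⁻ x, g (polarize a b f x) = 2 * ∫⁻ x, g (f x) := by
    rw [← double _ hf.continuous, ← double _ (lipschitzWith_polarize hf).continuous]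
    refine lintegral_congr fun x => ?_
    rcases polarize_eq_or (a := a) (b := b) (f := f) x with h | h <;> rw [h.1, h.2]
    rw [add_comm]
  exact (ENNReal.mul_right_inj two_ne_zero ENNReal.ofNat_ne_top).1 h

/-- The integral of `(f x - f y) ^ 2` over the pairs of points at distance less than `t`. -/
noncomputable def nonlocalEnergy (t : ℝ) (f : E → ℝ) : ℝ≥0∞ :=
  ∫⁻ p in {p : E × E | dist p.1 p.2 < t}, ENNReal.ofReal ((f p.1 - f p.2) ^ 2)

lemma measurableSet_dist_lt (t : ℝ) : MeasurableSet {p : E × E | dist p.1 p.2 < t} :=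
  (isOpen_lt (by fun_prop) (by fun_prop)).measurableSet

lemma nonlocalEnergy_eq (t : ℝ) (f : E → ℝ) : nonlocalEnergy t f =
    ∫⁻ p : E × E, ENNReal.ofReal ((if dist p.1 p.2 < t then 1 else 0) * (f p.1 - f p.2) ^ 2) := by
  rw [nonlocalEnergy, ← lintegral_indicator (measurableSet_dist_lt t)]
  refine lintegral_congr fun p => ?_
  by_cases h : dist p.1 p.2 < t <;> simp [h]

lemma two_point_inequality {k₁ k₂ : ℝ} (hk : k₂ ≤ k₁) (a b c d : ℝ) :
    k₁ * (max a b - max c d) ^ 2 + k₂ * (min a b - max c d) ^ 2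
      + k₂ * (max a b - min c d) ^ 2 + k₁ * (min a b - min c d) ^ 2
    ≤ k₁ * (a - c) ^ 2 + k₂ * (b - c) ^ 2 + k₂ * (a - d) ^ 2 + k₁ * (b - d) ^ 2 := by
  rcases le_total a b with h | h <;> rcases le_total c d with h' | h' <;> simp only [h, h',
    max_eq_left, max_eq_right, min_eq_left, min_eq_right] <;>
  nlinarith [mul_nonneg (sub_nonneg.2 hk) (mul_nonneg (sub_nonneg.2 h) (sub_nonneg.2 h'))]

lemma nonlocalEnergy_polarize_le {a b : E} {f : E → ℝ} {L : ℝ≥0} (hf : LipschitzWith L f)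
    (t : ℝ) : nonlocalEnergy t (polarize a b f) ≤ nonlocalEnergy t f := by
  set σ := bisectorReflection a b with hσ
  have hσσ : ∀ x, σ (σ x) = x := bisectorReflection_involutive a b
  have hσm := measurePreserving_bisectorReflection a b
  set k : E → E → ℝ := fun x y => if dist x y < t then 1 else 0 with hk
  have k0 : ∀ x y, 0 ≤ k x y := fun x y => by simp only [hk]; positivity
  set F : (E → ℝ) → E → E → ℝ := fun u x y => k x y * (u x - u y) ^ 2 with hF
  have F0 : ∀ u x y, 0 ≤ F u x y := fun u x y => mul_nonneg (k0 x y) (sq_nonneg _)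
  have quadruple : ∀ u : E → ℝ, Continuous u → 4 * nonlocalEnergy t u =
      ∫⁻ p : E × E, ENNReal.ofReal (F u p.1 p.2 + F u (σ p.1) p.2 + F u p.1 (σ p.2)
        + F u (σ p.1) (σ p.2)) := by
    intro u hu
    have hm : Measurable fun p : E × E => ENNReal.ofReal (F u p.1 p.2) := by
      refine ENNReal.measurable_ofReal.comp (Measurable.mul ?_ ?_)
      · exact Measurable.ite (measurableSet_dist_lt t) measurable_const measurable_const
      · exact Continuous.measurable (by fun_prop)
    have hmap : ∀ e₁ e₂ : E ≃ᵐ E, MeasurePreserving e₁ → MeasurePreserving e₂ →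
        Measurable (fun p : E × E => ENNReal.ofReal (F u (e₁ p.1) (e₂ p.2))) ∧
        ∫⁻ p : E × E, ENNReal.ofReal (F u (e₁ p.1) (e₂ p.2)) = nonlocalEnergy t u := by
      intro e₁ e₂ h₁ h₂
      refine ⟨hm.comp (e₁.prodCongr e₂).measurable, ?_⟩
      rw [nonlocalEnergy_eq]
      exact (h₁.prod h₂).lintegral_comp_emb (e₁.prodCongr e₂).measurableEmbedding
        (fun p : E × E => ENNReal.ofReal (F u p.1 p.2))
    have hid := MeasurePreserving.id (volume : Measure E)
    have h2 := hmap (bisectorReflectionEquiv a b) (.refl E) hσm hid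
    have h3 := hmap (.refl E) (bisectorReflectionEquiv a b) hid hσm
    have h4 := hmap (bisectorReflectionEquiv a b) (bisectorReflectionEquiv a b) hσm hσm
    have h1 := hmap (.refl E) (.refl E) hid hid
    change _ ∧ ∫⁻ p : E × E, ENNReal.ofReal (F u p.1 p.2) = _ at h1
    change Measurable (fun p : E × E => ENNReal.ofReal (F u (σ p.1) p.2)) ∧
      ∫⁻ p : E × E, ENNReal.ofReal (F u (σ p.1) p.2) = _ at h2
    change Measurable (fun p : E × E => ENNReal.ofReal (F u p.1 (σ p.2))) ∧
      ∫⁻ p : E × E, ENNReal.ofReal (F u p.1 (σ p.2)) = _ at h3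
    change Measurable (fun p : E × E => ENNReal.ofReal (F u (σ p.1) (σ p.2))) ∧
      ∫⁻ p : E × E, ENNReal.ofReal (F u (σ p.1) (σ p.2)) = _ at h4
    have split : ∀ p : E × E, ENNReal.ofReal (F u p.1 p.2 + F u (σ p.1) p.2 + F u p.1 (σ p.2)
        + F u (σ p.1) (σ p.2)) = ENNReal.ofReal (F u p.1 p.2) + ENNReal.ofReal (F u (σ p.1) p.2)
        + ENNReal.ofReal (F u p.1 (σ p.2)) + ENNReal.ofReal (F u (σ p.1) (σ p.2)) := by
      intro p
      rw [ENNReal.ofReal_add (add_nonneg (add_nonneg (F0 ..) (F0 ..)) (F0 ..)) (F0 ..),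
        ENNReal.ofReal_add (add_nonneg (F0 ..) (F0 ..)) (F0 ..), ENNReal.ofReal_add (F0 ..) (F0 ..)]
    simp_rw [split]
    rw [lintegral_add_right _ h4.1, lintegral_add_right _ h3.1, lintegral_add_right _ h2.1,
      h1.2, h2.2, h3.2, h4.2]
    ring
  have h : 4 * nonlocalEnergy t (polarize a b f) ≤ 4 * nonlocalEnergy t f := by
    rw [quadruple _ hf.continuous, quadruple _ (lipschitzWith_polarize hf).continuous]
    refine lintegral_mono fun p => ENNReal.ofReal_le_ofReal ?_
    obtain ⟨x, y⟩ := p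
    simp only
    have kσσ : ∀ x y, k (σ x) (σ y) = k x y := fun x y => by
      simp only [hk, hσ, dist_bisectorReflection]
    have kσ : ∀ x y, k (σ x) y = k x (σ y) := fun x y => by
      simp only [hk, hσ, dist_bisectorReflection_left]
    have base : ∀ x y, 0 ≤ bisectorSide a b x → 0 ≤ bisectorSide a b y →
        F (polarize a b f) x y + F (polarize a b f) (σ x) y + F (polarize a b f) x (σ y)
          + F (polarize a b f) (σ x) (σ y)
        ≤ F f x y + F f (σ x) y + F f x (σ y) + F f (σ x) (σ y) := by
      intro x y hx hy
      have hle : k x (σ y) ≤ k x y := by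
        have := dist_le_dist_bisectorReflection hx hy
        simp only [hk]
        split_ifs <;> linarith
      simp only [hF, kσσ, kσ x y]
      simp only [hσ, polarize_of_nonneg hx, polarize_of_nonneg hy, polarize_reflection_of_nonneg hx,
        polarize_reflection_of_nonneg hy]
      exact two_point_inequality hle _ _ _ _
    induction x using forall_of_forall_side_nonneg a b with
    | h x hx =>
    induction y using forall_of_forall_side_nonneg a b with
    | h y hy =>
    have := base x y hx hy
    simp only [← hσ, hσσ]
    refine ⟨⟨this, ?_⟩, ?_, ?_⟩ <;> linarith
  exact (ENNReal.mul_le_mul_iff_right (by norm_num) (by norm_num)).1 h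

/-- If polarization does not decrease the second moment about a point `c` lying on the side of
`a`, then `f b ≤ f a`. -/
lemma le_of_moment_le_moment_polarize {a b c : E} {f : E → ℝ} {L : ℝ≥0} (hf : LipschitzWith L f)
    (hfc : HasCompactSupport f) (hpc : HasCompactSupport (polarize a b f))
    (hc : dist a c < dist b c)
    (hle : ∫ x, f x * dist x c ^ 2 ≤ ∫ x, polarize a b f x * dist x c ^ 2) : f b ≤ f a := by
  set σ := bisectorReflection a b with hσ
  have hσσ : ∀ x, σ (σ x) = x := bisectorReflection_involutive a b
  have hσcont : Continuous σ := continuous_bisectorReflection a b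
  have hfcont := hf.continuous
  have hpcont : Continuous (polarize a b f) := (lipschitzWith_polarize hf).continuous
  set g : E → ℝ := fun x => f x - polarize a b f x with hg
  have hgcont : Continuous g := hfcont.sub hpcont
  have hgc : HasCompactSupport g := hfc.sub hpc
  have hgσ : ∀ x, g (σ x) = -g x := fun x => by
    have := polarize_add_polarize_reflection (a := a) (b := b) (f := f) x
    simp only [hg, hσ]
    linarith
  set D : E → ℝ := fun x => g x * (dist x c ^ 2 - dist (σ x) c ^ 2) with hD
  have hDcont : Continuous D := by fun_prop
  have hDc : HasCompactSupport D := hgc.mul_right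
  have hcH : 0 ≤ bisectorSide a b c := by
    rw [bisectorSide_nonneg_iff, dist_comm c a, dist_comm c b]
    exact hc.le
  have hD0 : ∀ x, 0 ≤ D x := by
    intro x
    induction x using forall_of_forall_side_nonneg a b with
    | h x hx =>
    have h : 0 ≤ D x := by
      refine mul_nonneg_of_nonpos_of_nonpos ?_ ?_
      · simp [hg, polarize_of_nonneg hx]
      · have h1 := dist_le_dist_bisectorReflection hcH hx
        rw [dist_comm c x, dist_comm c] at h1
        have := pow_le_pow_left₀ dist_nonneg h1 2
        linarith
    refine ⟨h, ?_⟩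
    rw [← hσ]
    have : D (σ x) = D x := by
      simp only [hD, hgσ, hσσ]
      ring
    rwa [this]
  have hcs : ∀ u : E → ℝ, Continuous u → HasCompactSupport u →
      Integrable fun x => u x * dist x c ^ 2 := fun u hu huc =>
    Continuous.integrable_of_hasCompactSupport (by fun_prop) huc.mul_right
  have hgσi : Integrable fun x => g x * dist (σ x) c ^ 2 :=
    Continuous.integrable_of_hasCompactSupport (by fun_prop) hgc.mul_right
  have hint : ∫ x, D x ≤ 0 := by
    have h1 : ∫ x, g x * dist (σ x) c ^ 2 = -∫ x, g x * dist x c ^ 2 := by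
      rw [← integral_comp_bisectorReflection a b, ← integral_neg]
      refine integral_congr_ae (.of_forall fun x => ?_)
      simp only [← hσ, hgσ, hσσ]
      ring
    have h2 : ∫ x, g x * dist x c ^ 2
        = (∫ x, f x * dist x c ^ 2) - ∫ x, polarize a b f x * dist x c ^ 2 := by
      rw [← integral_sub (hcs _ hfcont hfc) (hcs _ hpcont hpc)]
      exact integral_congr_ae (.of_forall fun x => by simp only [hg]; ring)
    simp only [hD, mul_sub]
    rw [integral_sub (hcs _ hgcont hgc) hgσi, h1]
    linarith
  by_contra! hlt
  have hDa : D a ≠ 0 := by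
    have h0 : bisectorSide a b a ≥ 0 := by rw [bisectorSide]; simp
    have h1 : g a = f a - f b := by
      simp only [hg, polarize_of_nonneg h0, bisectorReflection_left, max_eq_right hlt.le]
    have h2 : dist a c ^ 2 < dist b c ^ 2 := pow_lt_pow_left₀ hc dist_nonneg two_ne_zero
    simp only [hD, h1, hσ, bisectorReflection_left]
    exact (mul_pos_of_neg_of_neg (by linarith) (by linarith)).ne'
  exact (hDcont.integral_pos_of_hasCompactSupport_nonneg_nonzero hDc hD0 hDa).not_ge hint

lemma lintegral_le_of_le_liminf {α : Type*} [MeasurableSpace α] {μ : Measure α}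
    {F : ℕ → α → ℝ≥0∞} {G : α → ℝ≥0∞} {C : ℝ≥0∞} (hF : ∀ k, Measurable (F k))
    (hG : ∀ x, G x ≤ liminf (fun k => F k x) atTop) (hC : ∀ k, ∫⁻ x, F k x ∂μ ≤ C) :
    ∫⁻ x, G x ∂μ ≤ C :=
  calc ∫⁻ x, G x ∂μ ≤ ∫⁻ x, liminf (fun k => F k x) atTop ∂μ := lintegral_mono hG
    _ ≤ liminf (fun k => ∫⁻ x, F k x ∂μ) atTop := lintegral_liminf_le hF
    _ ≤ C := liminf_le_of_frequently_le' (Frequently.of_forall hC)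

/-- Functions obtained from `u` by rearrangements that do not increase the nonlocal energies,
supported in a fixed ball, with fixed Lipschitz constant and upper bound. -/
structure IsRearrangementCandidate (c : E) (R M : ℝ) (L : ℝ≥0) (u f : E → ℝ) : Prop where
  lipschitz : LipschitzWith L f
  nonneg : ∀ x, 0 ≤ f x
  le_bound : ∀ x, f x ≤ M
  eq_zero : ∀ x, R < dist x c → f x = 0
  measure_pos_le : volume {x | 0 < f x} ≤ volume {x | 0 < u x}
  lintegral_sq : ∫⁻ x, ENNReal.ofReal (f x ^ 2) = ∫⁻ x, ENNReal.ofReal (u x ^ 2)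
  energy_le : ∀ t, nonlocalEnergy t f ≤ nonlocalEnergy t u

lemma measure_pos_eq_lintegral {f : E → ℝ} (hf : Measurable f) :
    volume {x | 0 < f x} = ∫⁻ x, (Ioi (0 : ℝ)).indicator 1 (f x) := by
  rw [← lintegral_indicator_one (measurableSet_lt measurable_const hf)]
  rfl

namespace IsRearrangementCandidate

variable {c : E} {R M : ℝ} {L : ℝ≥0} {u f : E → ℝ}

lemma continuous (hf : IsRearrangementCandidate c R M L u f) : Continuous f :=
  hf.lipschitz.continuous

lemma hasCompactSupport (hf : IsRearrangementCandidate c R M L u f) : HasCompactSupport f :=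
  HasCompactSupport.intro (isCompact_closedBall c R) fun x hx => hf.eq_zero x (by simpa using hx)

lemma polarize (hf : IsRearrangementCandidate c R M L u f) {a b : E} (hc : dist c a ≤ dist c b) :
    IsRearrangementCandidate c R M L u (polarize a b f) where
  lipschitz := lipschitzWith_polarize hf.lipschitz
  nonneg := polarize_nonneg hf.nonneg
  le_bound x := by
    rcases polarize_eq_or (a := a) (b := b) (f := f) x with h | h <;> rw [h.1] <;>
      apply hf.le_bound
  eq_zero := polarize_eq_zero_of_dist_gt hc hf.nonneg hf.eq_zero
  measure_pos_le := by
    refine le_of_eq_of_le ?_ hf.measure_pos_le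
    rw [measure_pos_eq_lintegral hf.continuous.measurable,
      measure_pos_eq_lintegral (lipschitzWith_polarize hf.lipschitz).continuous.measurable]
    exact lintegral_comp_polarize hf.lipschitz (measurable_one.indicator measurableSet_Ioi)
  lintegral_sq := by
    rw [← hf.lintegral_sq]
    exact lintegral_comp_polarize (g := fun s => ENNReal.ofReal (s ^ 2)) hf.lipschitz
      (by fun_prop)
  energy_le t := (nonlocalEnergy_polarize_le hf.lipschitz t).trans (hf.energy_le t)

lemma of_tendsto {F : ℕ → E → ℝ} (hF : ∀ k, IsRearrangementCandidate c R M L u (F k))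
    (hlim : ∀ x, Tendsto (fun k => F k x) atTop (𝓝 (f x))) :
    IsRearrangementCandidate c R M L u f := by
  have hlip : LipschitzWith L f := LipschitzWith.of_dist_le_mul fun x y =>
    le_of_tendsto ((hlim x).dist (hlim y)) (.of_forall fun k => (hF k).lipschitz.dist_le_mul x y)
  have hnonneg : ∀ x, 0 ≤ f x := fun x => ge_of_tendsto' (hlim x) fun k => (hF k).nonneg x
  have hsq : Tendsto (fun k => ∫⁻ x, ENNReal.ofReal (F k x ^ 2)) atTop
      (𝓝 (∫⁻ x, ENNReal.ofReal (f x ^ 2))) := by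
    refine tendsto_lintegral_of_dominated_convergence
      ((closedBall c R).indicator fun _ => ENNReal.ofReal (M ^ 2)) (fun k => ?_)
      (fun k => .of_forall fun x => ?_) ?_ (.of_forall fun x => ?_)
    · have := (hF k).continuous.measurable
      fun_prop
    · by_cases hx : x ∈ closedBall c R
      · rw [indicator_of_mem hx]
        exact ENNReal.ofReal_le_ofReal
          (pow_le_pow_left₀ ((hF k).nonneg x) ((hF k).le_bound x) 2)
      · simp [(hF k).eq_zero x (by simpa using hx)]
    · rw [lintegral_indicator measurableSet_closedBall, setLIntegral_const]
      exact ENNReal.mul_ne_top ENNReal.ofReal_ne_top measure_closedBall_lt_top.ne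
    · exact ENNReal.tendsto_ofReal ((hlim x).pow 2)
  refine ⟨hlip, hnonneg, fun x => le_of_tendsto' (hlim x) fun k => (hF k).le_bound x,
    fun x hx => ?_, ?_, ?_, fun t => ?_⟩
  · refine tendsto_nhds_unique (hlim x) ?_
    simp [(hF _).eq_zero x hx]
  · rw [measure_pos_eq_lintegral hlip.continuous.measurable]
    refine lintegral_le_of_le_liminf (F := fun k x => (Ioi (0 : ℝ)).indicator 1 (F k x))
      (fun k => (measurable_one.indicator measurableSet_Ioi).comp (hF k).continuous.measurable)
      (fun x => ?_) fun k => ?_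
    · by_cases hx : 0 < f x
      · refine le_liminf_of_le (by isBoundedDefault) ?_
        filter_upwards [(hlim x).eventually (lt_mem_nhds hx)] with k hk
        simp [indicator, hk, hx]
      · simp [indicator, hx]
    · rw [← measure_pos_eq_lintegral (hF k).continuous.measurable]
      exact (hF k).measure_pos_le
  · refine tendsto_nhds_unique hsq ?_
    simp [(hF _).lintegral_sq]
  · refine lintegral_le_of_le_liminf (F := fun k (p : E × E) => ENNReal.ofReal ((F k p.1 - F k p.2) ^ 2))
      (fun k => ?_) (fun p => ?_) fun k => (hF k).energy_le t
    · have := (hF k).continuous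
      exact ENNReal.measurable_ofReal.comp (Continuous.measurable (by fun_prop))
    · exact (ENNReal.tendsto_ofReal (((hlim p.1).sub (hlim p.2)).pow 2)).liminf_eq.ge

lemma tendsto_moment {F : ℕ → E → ℝ} (hF : ∀ k, IsRearrangementCandidate c R M L u (F k))
    (hlim : ∀ x, Tendsto (fun k => F k x) atTop (𝓝 (f x))) :
    Tendsto (fun k => ∫ x, F k x * dist x c ^ 2) atTop (𝓝 (∫ x, f x * dist x c ^ 2)) := by
  refine tendsto_integral_of_dominated_convergence
    ((closedBall c R).indicator fun _ => M * R ^ 2) (fun k => ?_) ?_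
    (fun k => .of_forall fun x => ?_) (.of_forall fun x => (hlim x).mul_const _)
  · have := (hF k).continuous
    exact Continuous.aestronglyMeasurable (by fun_prop)
  · exact (integrable_indicator_iff measurableSet_closedBall).2
      (integrableOn_const measure_closedBall_lt_top.ne)
  · have h0 := (hF k).nonneg x
    rw [Real.norm_of_nonneg (by positivity)]
    by_cases hx : x ∈ closedBall c R
    · rw [indicator_of_mem hx]
      exact mul_le_mul ((hF k).le_bound x) (pow_le_pow_left₀ dist_nonneg hx 2) (by positivity)
        (h0.trans ((hF k).le_bound x))
    · simp [hx, (hF k).eq_zero x (by simpa using hx)]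

end IsRearrangementCandidate

lemma isCompact_setOf_lipschitzWith_Icc {X : Type*} [PseudoMetricSpace X] (L : ℝ≥0) (M : ℝ) :
    IsCompact {f : C(X, ℝ) | LipschitzWith L f ∧ ∀ x, f x ∈ Icc 0 M} := by
  refine ArzelaAscoli.isCompact_of_equicontinuous _ ?_ ?_
  · have himage : ContinuousMap.toFun '' {f : C(X, ℝ) | LipschitzWith L f ∧ ∀ x, f x ∈ Icc 0 M}
        = {f : X → ℝ | LipschitzWith L f} ∩ Set.pi univ fun _ => Icc 0 M := by
      ext f
      constructor
      · rintro ⟨g, ⟨h1, h2⟩, rfl⟩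
        exact ⟨h1, fun x _ => h2 x⟩
      · rintro ⟨h1, h2⟩
        exact ⟨⟨f, h1.continuous⟩, ⟨h1, fun x => h2 x trivial⟩, rfl⟩
    rw [himage]
    refine (isCompact_univ_pi fun _ => isCompact_Icc).inter_left ?_
    simp only [lipschitzWith_iff_dist_le_mul, ofPred_forall]
    exact isClosed_iInter fun x => isClosed_iInter fun y =>
      isClosed_le (by fun_prop) continuous_const
  · exact (LipschitzWith.uniformEquicontinuous _ L fun f => f.2.1).equicontinuous

/-- There is a radially nonincreasing rearrangement with no larger nonlocal energies. -/
theorem exists_radial_rearrangement {c : E} {R M : ℝ} {L : ℝ≥0} {u : E → ℝ}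
    (hu : IsRearrangementCandidate c R M L u u) :
    ∃ f, IsRearrangementCandidate c R M L u f ∧ ∀ a b, dist a c < dist b c → f b ≤ f a := by
  set J : (E → ℝ) → ℝ := fun f => ∫ x, f x * dist x c ^ 2 with hJ
  set S : Set ℝ := J '' {f | IsRearrangementCandidate c R M L u f} with hS
  have hSne : S.Nonempty := ⟨J u, u, hu, rfl⟩
  have hSb : BddBelow S := by
    refine ⟨0, ?_⟩
    rintro _ ⟨f, hf, rfl⟩
    exact integral_nonneg fun x => mul_nonneg (hf.nonneg x) (sq_nonneg _)
  obtain ⟨s, -, hs, hsS⟩ := exists_seq_tendsto_sInf hSne hSb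
  choose F hF hFs using hsS
  obtain ⟨g, -, φ, hφ, hg⟩ := (isCompact_setOf_lipschitzWith_Icc L M).tendsto_subseq
    (x := fun k => (⟨F k, (hF k).continuous⟩ : C(E, ℝ)))
    fun k => ⟨(hF k).lipschitz, fun x => ⟨(hF k).nonneg x, (hF k).le_bound x⟩⟩
  have hlim : ∀ x, Tendsto (fun k => F (φ k) x) atTop (𝓝 (g x)) := fun x =>
    ((continuous_eval_const x).tendsto g).comp hg
  have hgc : IsRearrangementCandidate c R M L u g := .of_tendsto (fun k => hF (φ k)) hlim
  have hJg : J g = sInf S := by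
    refine tendsto_nhds_unique
      (IsRearrangementCandidate.tendsto_moment (fun k => hF (φ k)) hlim) ?_
    refine (hs.comp hφ.tendsto_atTop).congr fun k => ?_
    exact (hFs (φ k)).symm
  refine ⟨g, hgc, fun a b hab => ?_⟩
  have hp := hgc.polarize (a := a) (b := b) (by rw [dist_comm c, dist_comm c]; exact hab.le)
  refine le_of_moment_le_moment_polarize hgc.lipschitz hgc.hasCompactSupport hp.hasCompactSupport
    hab ?_
  exact hJg.trans_le (csInf_le hSb ⟨_, hp, rfl⟩)

/-- A radially nonincreasing function vanishes outside any open ball at least as large as its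
positivity set. -/
lemma eq_zero_of_radial_of_measure_pos_le {c : E} {r : ℝ} (hr : 0 < r) {f : E → ℝ}
    (hf : Continuous f) (h0 : ∀ x, 0 ≤ f x) (hmono : ∀ a b, dist a c < dist b c → f b ≤ f a)
    (hvol : volume {x | 0 < f x} ≤ volume (ball c r)) (x : E) (hx : r ≤ dist x c) : f x = 0 := by
  by_contra hne
  have hpos : 0 < f x := lt_of_le_of_ne (h0 x) (Ne.symm hne)
  set W : Set E := {y | 0 < f y} ∩ {y | r < dist y c} with hW
  have hWo : IsOpen W :=
    (isOpen_lt continuous_const hf).inter (isOpen_lt continuous_const (by fun_prop))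
  have hWne : W.Nonempty := by
    have hcont : Tendsto (fun s : ℝ => f (c + s • (x - c))) (𝓝[>] 1) (𝓝 (f x)) := by
      have : Continuous fun s : ℝ => f (c + s • (x - c)) := by fun_prop
      simpa using (this.tendsto 1).mono_left nhdsWithin_le_nhds
    obtain ⟨s, hs, hs1⟩ :=
      ((hcont.eventually (lt_mem_nhds hpos)).and self_mem_nhdsWithin).exists
    refine ⟨_, hs, ?_⟩
    have hs1 : (1 : ℝ) < s := hs1
    rw [mem_ofPred_eq, dist_eq_norm, add_sub_cancel_left, norm_smul, ← dist_eq_norm,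
      Real.norm_of_nonneg (by linarith)]
    nlinarith
  obtain ⟨w, hw⟩ := hWne
  have hball : ball c r ⊆ {y | 0 < f y} := fun y hy =>
    lt_of_lt_of_le hw.1 (hmono y w (lt_trans (mem_ball.1 hy) hw.2))
  have hdisj : Disjoint (ball c r) W :=
    Set.disjoint_left.2 fun y hy hyW => lt_asymm (mem_ball.1 hy) hyW.2
  have hle : volume (ball c r) + volume W ≤ volume (ball c r) := by
    rw [← measure_union hdisj hWo.measurableSet]
    exact (measure_mono (union_subset hball inter_subset_left)).trans hvol
  have hWpos : 0 < volume W := hWo.measure_pos volume ⟨w, hw⟩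
  exact (ENNReal.lt_add_right measure_ball_lt_top.ne hWpos.ne').not_ge hle

lemma nonlocalEnergy_le_of_abs_sub_le {f g : E → ℝ} (h : ∀ x y, |g x - g y| ≤ |f x - f y|)
    (t : ℝ) : nonlocalEnergy t g ≤ nonlocalEnergy t f :=
  lintegral_mono fun _ => ENNReal.ofReal_le_ofReal (sq_le_sq.2 (h _ _))

lemma nonlocalEnergy_comp_sub_right (f : E → ℝ) (z : E) (t : ℝ) :
    nonlocalEnergy t (fun x => f (x - z)) = nonlocalEnergy t f := by
  simp only [nonlocalEnergy_eq]
  have h := lintegral_sub_right_eq_self (μ := (volume : Measure E).prod volume)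
    (fun p : E × E => ENNReal.ofReal ((if dist p.1 p.2 < t then 1 else 0) * (f p.1 - f p.2) ^ 2))
    (z, z)
  simpa [dist_sub_right, Measure.volume_eq_prod] using h

lemma sq_integral_mul_le {ψ h : E → ℝ} (hψ : Continuous ψ) (hψc : HasCompactSupport ψ)
    (hψ0 : ∀ x, 0 ≤ ψ x) (hψ1 : ∫ x, ψ x = 1) (hh : Continuous h) :
    (∫ x, ψ x * h x) ^ 2 ≤ ∫ x, ψ x * h x ^ 2 := by
  have hi : ∀ k : E → ℝ, Continuous k → Integrable fun x => ψ x * k x := fun k hk =>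
    (hψ.mul hk).integrable_of_hasCompactSupport hψc.mul_right
  set m := ∫ x, ψ x * h x with hm
  have h0 : 0 ≤ ∫ x, ψ x * (h x - m) ^ 2 :=
    integral_nonneg fun x => mul_nonneg (hψ0 x) (sq_nonneg _)
  have h1 : ∫ x, ψ x * (h x - m) ^ 2
      = ∫ x, (ψ x * h x ^ 2 - (2 * m) * (ψ x * h x) + m ^ 2 * ψ x) :=
    integral_congr_ae (.of_forall fun x => by ring)
  rw [h1, integral_add, integral_sub, integral_const_mul, integral_const_mul, hψ1, ← hm] at h0
  · nlinarith
  · exact hi _ (hh.pow 2)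
  · exact (hi _ hh).const_mul _
  · exact (hi _ (hh.pow 2)).sub ((hi _ hh).const_mul _)
  · exact (hψ.integrable_of_hasCompactSupport hψc).const_mul _

/-- Averaging translates does not increase the nonlocal energies. -/
lemma nonlocalEnergy_convolution_le {ψ g : E → ℝ} (hψ : Continuous ψ)
    (hψc : HasCompactSupport ψ) (hψ0 : ∀ x, 0 ≤ ψ x) (hψ1 : ∫ x, ψ x = 1) (hg : Continuous g)
    (t : ℝ) :
    nonlocalEnergy t (fun x => ∫ z, ψ z * g (x - z)) ≤ nonlocalEnergy t g := by
  have hi : ∀ k : E → ℝ, Continuous k → Integrable fun x => ψ x * k x := fun k hk =>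
    (hψ.mul hk).integrable_of_hasCompactSupport hψc.mul_right
  have hψm : Measurable ψ := hψ.measurable
  have hgm : Measurable g := hg.measurable
  have hpt : ∀ p : E × E, ENNReal.ofReal
      (((∫ z, ψ z * g (p.1 - z)) - ∫ z, ψ z * g (p.2 - z)) ^ 2)
      ≤ ∫⁻ z, ENNReal.ofReal (ψ z) * ENNReal.ofReal ((g (p.1 - z) - g (p.2 - z)) ^ 2) := by
    intro p
    rw [← integral_sub (hi _ (by fun_prop)) (hi _ (by fun_prop))]
    simp only [← mul_sub, ← ENNReal.ofReal_mul (hψ0 _)]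
    rw [← ofReal_integral_eq_lintegral_ofReal (hi _ (by fun_prop))
      (.of_forall fun z => mul_nonneg (hψ0 z) (sq_nonneg _))]
    exact ENNReal.ofReal_le_ofReal (sq_integral_mul_le hψ hψc hψ0 hψ1 (by fun_prop))
  calc nonlocalEnergy t (fun x => ∫ z, ψ z * g (x - z))
      ≤ ∫⁻ p in {p : E × E | dist p.1 p.2 < t}, ∫⁻ z,
          ENNReal.ofReal (ψ z) * ENNReal.ofReal ((g (p.1 - z) - g (p.2 - z)) ^ 2) :=
        lintegral_mono hpt
    _ = ∫⁻ z, ∫⁻ p in {p : E × E | dist p.1 p.2 < t},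
          ENNReal.ofReal (ψ z) * ENNReal.ofReal ((g (p.1 - z) - g (p.2 - z)) ^ 2) :=
        lintegral_lintegral_swap (Measurable.aemeasurable (by fun_prop))
    _ = ∫⁻ z, ENNReal.ofReal (ψ z) * nonlocalEnergy t g := by
        refine lintegral_congr fun z => ?_
        rw [lintegral_const_mul _ (by fun_prop), ← nonlocalEnergy_comp_sub_right g z]
        rfl
    _ = nonlocalEnergy t g := by
        rw [lintegral_mul_const _ (by fun_prop), ← ofReal_integral_eq_lintegral_ofReal
          (hψ.integrable_of_hasCompactSupport hψc) (.of_forall hψ0), hψ1]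
        simp

/-- A nonnegative Lipschitz function vanishing outside a ball is a uniform limit of smooth
functions compactly supported in the ball, with no larger nonlocal energies. -/
lemma exists_smooth_approx {f : E → ℝ} {L : ℝ≥0} (hf : LipschitzWith L f)
    {c : E} {r : ℝ} (h0 : ∀ x, 0 ≤ f x) (hfr : ∀ x, r ≤ dist x c → f x = 0)
    {ε : ℝ} (hε : 0 < ε) :
    ∃ v : E → ℝ, ContDiff ℝ (⊤ : ℕ∞) v ∧ HasCompactSupport v ∧ tsupport v ⊆ ball c r ∧
      (∀ x, |v x - f x| ≤ ε) ∧ ∀ t, nonlocalEnergy t v ≤ nonlocalEnergy t f := by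
  set g : E → ℝ := fun x => max (f x - ε / 2) 0 with hg
  have hgf : ∀ x y, |g x - g y| ≤ |f x - f y| := fun x y => by
    simpa using abs_max_sub_max_le_abs (f x - ε / 2) (f y - ε / 2) 0
  have hglip : LipschitzWith L g := LipschitzWith.of_dist_le_mul fun x y =>
    (hgf x y).trans (hf.dist_le_mul x y)
  set K : Set E := {x | ε / 2 ≤ f x} with hK
  have hKr : K ⊆ ball c r := by
    intro x hx
    by_contra h
    have : ε / 2 ≤ f x := hx
    rw [hfr x (by simpa using h)] at this
    linarith
  have hKc : IsCompact K := isCompact_of_isClosed_isBounded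
    (isClosed_le continuous_const hf.continuous) (isBounded_ball.subset hKr)
  have hgK : Function.support g ⊆ K := by
    intro x hx
    by_contra h
    have h : f x < ε / 2 := not_le.1 h
    exact hx (max_eq_right (by linarith))
  have hgc : HasCompactSupport g :=
    HasCompactSupport.intro hKc fun x hx => by_contra fun h => hx (hgK h)
  obtain ⟨δ, hδ, hδK⟩ := hKc.exists_cthickening_subset_open isOpen_ball hKr
  set ρ : ℝ := min δ (ε / (2 * (L + 1))) with hρ
  have hρ0 : 0 < ρ := by positivity
  have hρL : L * ρ ≤ ε / 2 := by
    have h1 : ρ ≤ ε / (2 * (L + 1)) := min_le_right _ _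
    have h2 : (L + 1) * (ε / (2 * (L + 1))) = ε / 2 := by field_simp
    have h3 : (0 : ℝ) ≤ L := L.coe_nonneg
    nlinarith
  let φ : ContDiffBump (0 : E) := ⟨ρ / 2, ρ, by positivity, by linarith⟩
  set v : E → ℝ := fun x => ∫ z, φ.normed volume z * g (x - z) with hv
  have hvconv : v = convolution (φ.normed volume) g (ContinuousLinearMap.lsmul ℝ ℝ) volume := rfl
  have hvsupp : tsupport v ⊆ cthickening δ K := by
    refine closure_minimal ?_ isClosed_cthickening
    rw [hvconv]
    refine (support_convolution_subset _).trans ?_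
    rw [φ.support_normed_eq]
    rintro _ ⟨z, hz, x, hx, rfl⟩
    refine mem_cthickening_of_dist_le _ x _ _ (hgK hx) ?_
    have : ‖z‖ < ρ := by simpa using hz
    simp only [dist_eq_norm, add_sub_cancel_right]
    exact this.le.trans (min_le_left _ _)
  refine ⟨v, ?_, ?_, hvsupp.trans hδK, fun x => ?_, fun t => ?_⟩
  · rw [hvconv]
    exact φ.hasCompactSupport_normed.contDiff_convolution_left _ φ.contDiff_normed
      hglip.continuous.locallyIntegrable
  · exact isCompact_of_isClosed_isBounded (isClosed_tsupport v)
      (isBounded_ball.subset (hvsupp.trans hδK))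
  · have h1 : dist (v x) (g x) ≤ ε / 2 := by
      rw [hvconv]
      refine φ.dist_normed_convolution_le hglip.continuous.aestronglyMeasurable fun y hy => ?_
      refine (hglip.dist_le_mul y x).trans (le_trans ?_ hρL)
      exact mul_le_mul_of_nonneg_left (mem_ball.1 hy).le L.coe_nonneg
    have h2 : |g x - f x| ≤ ε / 2 := by
      have h3 := h0 x
      rw [abs_le]
      rcases max_cases (f x - ε / 2) 0 with h | h <;> simp only [hg, h.1] <;>
        constructor <;> linarith
    have h3 := abs_sub_le (v x) (g x) (f x)
    rw [Real.dist_eq] at h1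
    linarith
  · exact (nonlocalEnergy_convolution_le φ.continuous_normed φ.hasCompactSupport_normed
      φ.nonneg_normed φ.integral_normed hglip.continuous t).trans
      (nonlocalEnergy_le_of_abs_sub_le hgf t)

/-- The nonlocal energy in rescaled coordinates. -/
lemma lintegral_sq_difference_quotient {t : ℝ} (ht : 0 < t) {f : E → ℝ} (hf : Continuous f) :
    ∫⁻ p in univ ×ˢ ball (0 : E) 1, ENNReal.ofReal (((f (p.1 + t • p.2) - f p.1) / t) ^ 2)
      = ENNReal.ofReal (|(t ^ Module.finrank ℝ E)⁻¹| / t ^ 2) * nonlocalEnergy t f := by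
  have hmeas : Measurable fun p : E × E =>
      ENNReal.ofReal ((if dist p.1 p.2 < t then 1 else 0) * (f p.1 - f p.2) ^ 2) := by
    refine ENNReal.measurable_ofReal.comp (Measurable.mul ?_ ?_)
    · exact Measurable.ite (measurableSet_dist_lt t) measurable_const measurable_const
    · exact Continuous.measurable (by fun_prop)
  rw [nonlocalEnergy_eq, Measure.volume_eq_prod, ← Measure.prod_restrict, Measure.restrict_univ,
    lintegral_prod _ (Measurable.aemeasurable <| Measurable.ennreal_ofReal
      (Continuous.measurable (by fun_prop))), lintegral_prod _ hmeas.aemeasurable,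
    ← lintegral_const_mul _ hmeas.lintegral_prod_right']
  refine lintegral_congr fun x => ?_
  have hscale : ∀ G : E → ℝ≥0∞, ∫⁻ w, G (x + t • w)
      = ENNReal.ofReal |(t ^ Module.finrank ℝ E)⁻¹| * ∫⁻ y, G y := by
    intro G
    have h := (Homeomorph.smulOfNeZero t ht.ne').measurableEmbedding.lintegral_map
      (μ := (volume : Measure E)) (fun y => G (x + y))
    change ∫⁻ y, G (x + y) ∂(Measure.map (t • ·) volume) = ∫⁻ w, G (x + t • w) at h
    rw [← lintegral_add_left_eq_self G x, ← h,
      Measure.map_addHaar_smul volume ht.ne', lintegral_smul_measure, smul_eq_mul]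
  rw [div_eq_mul_inv, ENNReal.ofReal_mul (abs_nonneg _), mul_comm (ENNReal.ofReal _), mul_assoc,
    ← hscale, ← lintegral_const_mul' _ _ ENNReal.ofReal_ne_top,
    ← lintegral_indicator measurableSet_ball]
  refine lintegral_congr fun w => ?_
  rw [← ENNReal.ofReal_mul (by positivity)]
  have hd : dist x (x + t • w) < t ↔ w ∈ ball (0 : E) 1 := by
    rw [dist_self_add_right, norm_smul, Real.norm_of_nonneg ht.le, mem_ball_zero_iff]
    exact mul_lt_iff_lt_one_right ht
  by_cases hw : w ∈ ball (0 : E) 1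
  · rw [indicator_of_mem hw, if_pos (hd.2 hw)]
    congr 1
    field_simp
    ring
  · rw [indicator_of_notMem hw, if_neg (mt hd.1 hw)]
    simp

/-- As the interaction range shrinks, the rescaled nonlocal energy tends to the integral of the
squared directional derivatives. -/
lemma tendsto_lintegral_sq_difference_quotient {f : E → ℝ} (hf : ContDiff ℝ 1 f)
    (hfc : HasCompactSupport f) :
    Tendsto (fun k : ℕ => ∫⁻ p in univ ×ˢ ball (0 : E) 1,
        ENNReal.ofReal (((f (p.1 + (1 / (k + 1) : ℝ) • p.2) - f p.1) / (1 / (k + 1) : ℝ)) ^ 2))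
      atTop (𝓝 (∫⁻ p in univ ×ˢ ball (0 : E) 1, ENNReal.ofReal (fderiv ℝ f p.1 p.2 ^ 2))) := by
  obtain ⟨L, hL⟩ := hf.lipschitzWith_of_hasCompactSupport hfc one_ne_zero
  obtain ⟨R, hR⟩ := hfc.isCompact.isBounded.subset_closedBall 0
  have hcont := hf.continuous
  have hfR : ∀ x, R < ‖x‖ → f x = 0 := fun x hx => by
    by_contra h
    have := hR (subset_tsupport f h)
    rw [mem_closedBall_zero_iff] at this
    linarith
  have hball : MeasurableSet ((univ : Set E) ×ˢ ball (0 : E) 1) := .prod .univ measurableSet_ball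
  have hball' : MeasurableSet (closedBall (0 : E) (R + 1) ×ˢ (univ : Set E)) :=
    .prod measurableSet_closedBall .univ
  refine tendsto_lintegral_of_dominated_convergence
    ((closedBall 0 (R + 1) ×ˢ univ).indicator fun _ => ENNReal.ofReal ((L : ℝ) ^ 2))
    (fun k => ?_) (fun k => ?_) ?_ (.of_forall fun p => ?_)
  · exact ENNReal.measurable_ofReal.comp (Continuous.measurable (by fun_prop))
  · refine ae_restrict_of_forall_mem hball fun p hp => ?_
    set t : ℝ := 1 / (k + 1) with ht
    have ht0 : 0 < t := by positivity
    have ht1 : t ≤ 1 := by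
      rw [ht, div_le_one (by positivity)]
      linarith [(Nat.cast_nonneg k : (0 : ℝ) ≤ k)]
    have hw : ‖p.2‖ < 1 := by simpa using hp.2
    have htw : ‖t • p.2‖ ≤ t := by
      rw [norm_smul, Real.norm_of_nonneg ht0.le]
      nlinarith
    by_cases hx : p ∈ closedBall (0 : E) (R + 1) ×ˢ (univ : Set E)
    · rw [indicator_of_mem hx]
      refine ENNReal.ofReal_le_ofReal (sq_le_sq.2 ?_)
      rw [abs_div, abs_of_pos ht0, abs_of_nonneg L.coe_nonneg, div_le_iff₀ ht0]
      have := hL.dist_le_mul (p.1 + t • p.2) p.1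
      rw [Real.dist_eq, dist_self_add_left] at this
      exact this.trans (mul_le_mul_of_nonneg_left htw L.coe_nonneg)
    · have hx : R + 1 < ‖p.1‖ := by simpa using hx
      have h1 : R < ‖p.1 + t • p.2‖ := by
        have := norm_sub_norm_le p.1 (-(t • p.2))
        rw [sub_neg_eq_add, norm_neg] at this
        linarith
      simp [hfR _ h1, hfR p.1 (by linarith)]
  · rw [lintegral_indicator hball', setLIntegral_const, Measure.restrict_apply hball',
      prod_inter_prod, inter_univ, univ_inter, Measure.volume_eq_prod, Measure.prod_prod]
    exact ENNReal.mul_ne_top ENNReal.ofReal_ne_top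
      (ENNReal.mul_ne_top measure_closedBall_lt_top.ne measure_ball_lt_top.ne)
  · refine ENNReal.tendsto_ofReal (Tendsto.pow ?_ 2)
    have hd : HasLineDerivAt ℝ f (fderiv ℝ f p.1 p.2) p.1 p.2 :=
      ((hf.differentiable one_ne_zero) p.1).hasFDerivAt.hasLineDerivAt p.2
    have hs := hd.tendsto_slope_zero
    have ht : Tendsto (fun k : ℕ => (1 / (k + 1) : ℝ)) atTop (𝓝[≠] 0) :=
      tendsto_nhdsWithin_iff.2 ⟨tendsto_one_div_add_atTop_nhds_zero_nat,
        .of_forall fun k => (Nat.one_div_pos_of_nat (n := k)).ne'⟩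
    refine (hs.comp ht).congr fun k => ?_
    simp only [Function.comp_apply, smul_eq_mul, div_eq_inv_mul]

/-- The integral over the unit ball of the square of a linear form is proportional to the square
of its norm. -/
lemma exists_lintegral_ball_sq_eq [Nontrivial E] : ∃ κ : ℝ≥0∞, κ ≠ 0 ∧ κ ≠ ⊤ ∧
    ∀ ℓ : E →L[ℝ] ℝ, ∫⁻ w in ball (0 : E) 1, ENNReal.ofReal (ℓ w ^ 2)
      = ENNReal.ofReal (‖ℓ‖ ^ 2) * κ := by
  obtain ⟨e, he⟩ := exists_norm_eq E zero_le_one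
  refine ⟨∫⁻ w in ball (0 : E) 1, ENNReal.ofReal (inner ℝ e w ^ 2), ?_, ?_, fun ℓ => ?_⟩
  · have hopen : IsOpen ({w : E | inner ℝ e w ≠ 0} ∩ ball 0 1) :=
      (isOpen_ne_fun (by fun_prop) continuous_const).inter isOpen_ball
    refine (setLIntegral_pos_iff (by fun_prop) |>.2 ?_).ne'
    refine lt_of_lt_of_le (hopen.measure_pos volume ⟨(1 / 2 : ℝ) • e, ?_, ?_⟩) (measure_mono ?_)
    · simp [inner_smul_right, he]
    · simp only [mem_ball_zero_iff, norm_smul, he]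
      norm_num
    · refine inter_subset_inter_left _ fun w hw => ?_
      have hw : inner ℝ e w ≠ 0 := hw
      simp only [Function.mem_support, ne_eq, ENNReal.ofReal_eq_zero, not_le]
      positivity
  · refine ne_top_of_le_ne_top (measure_ball_lt_top (μ := volume) (x := (0 : E)) (r := 1)).ne ?_
    rw [← setLIntegral_one]
    refine setLIntegral_mono' measurableSet_ball fun w hw => ?_
    rw [ENNReal.ofReal_le_one, sq_le_one_iff_abs_le_one]
    have := abs_real_inner_le_norm e w
    rw [mem_ball_zero_iff] at hw
    rw [he] at this
    linarith
  · set v : E := (InnerProductSpace.toDual ℝ E).symm ℓ with hv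
    have hℓ : ∀ w, ℓ w = inner ℝ v w := fun w => by simp [hv]
    have hnorm : ‖ℓ‖ = ‖v‖ := by simp [hv]
    set A := (ℝ ∙ (‖v‖ • e - v))ᗮ.reflection with hA
    have hAe : A (‖v‖ • e) = v := Submodule.reflection_sub (by simp [norm_smul, he])
    rw [← (LinearIsometryEquiv.measurePreserving A).setLIntegral_comp_preimage_emb
      A.toHomeomorph.measurableEmbedding, hnorm, ← lintegral_const_mul _ (by fun_prop)]
    have hpre : A ⁻¹' ball 0 1 = ball 0 1 := by
      ext w
      simp
    rw [hpre]
    refine lintegral_congr fun w => ?_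
    rw [hℓ, ← hAe, A.inner_map_map, hAe, inner_smul_left, ← ENNReal.ofReal_mul (sq_nonneg _)]
    simp [mul_pow]

/-- Comparison of all nonlocal energies implies comparison of the Dirichlet energies. -/
theorem integral_sq_norm_fderiv_le [Nontrivial E] {u v : E → ℝ}
    (hu : ContDiff ℝ 1 u) (huc : HasCompactSupport u) (hv : ContDiff ℝ 1 v)
    (hvc : HasCompactSupport v) (h : ∀ t, nonlocalEnergy t v ≤ nonlocalEnergy t u) :
    ∫ x, ‖fderiv ℝ v x‖ ^ 2 ≤ ∫ x, ‖fderiv ℝ u x‖ ^ 2 := by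
  obtain ⟨κ, hκ0, hκ, hκℓ⟩ := exists_lintegral_ball_sq_eq (E := E)
  have hlim : ∀ f : E → ℝ, ContDiff ℝ 1 f → HasCompactSupport f →
      ∫⁻ p in univ ×ˢ ball (0 : E) 1, ENNReal.ofReal (fderiv ℝ f p.1 p.2 ^ 2)
        = ENNReal.ofReal (∫ x, ‖fderiv ℝ f x‖ ^ 2) * κ := by
    intro f hf hfc
    have hd : Continuous (fderiv ℝ f) := hf.continuous_fderiv one_ne_zero
    have hint : Integrable fun x => ‖fderiv ℝ f x‖ ^ 2 := by
      refine Continuous.integrable_of_hasCompactSupport (by fun_prop) ?_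
      exact (hfc.fderiv ℝ).comp_left (g := fun ℓ => ‖ℓ‖ ^ 2) (by simp)
    rw [Measure.volume_eq_prod, ← Measure.prod_restrict, Measure.restrict_univ,
      lintegral_prod _ (Measurable.aemeasurable <| Measurable.ennreal_ofReal
        (Continuous.measurable (by fun_prop))),
      ofReal_integral_eq_lintegral_ofReal hint (.of_forall fun x => sq_nonneg _),
      ← lintegral_mul_const _ (by fun_prop)]
    exact lintegral_congr fun x => hκℓ (fderiv ℝ f x)
  have hle := le_of_tendsto_of_tendsto' (tendsto_lintegral_sq_difference_quotient hv hvc)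
    (tendsto_lintegral_sq_difference_quotient hu huc) fun k => by
      rw [lintegral_sq_difference_quotient Nat.one_div_pos_of_nat hv.continuous,
        lintegral_sq_difference_quotient Nat.one_div_pos_of_nat hu.continuous]
      exact mul_le_mul_right (h _) _
  rw [hlim u hu huc, hlim v hv hvc, ENNReal.mul_le_mul_iff_left hκ0 hκ,
    ENNReal.ofReal_le_ofReal_iff (integral_nonneg fun x => sq_nonneg _)] at hle
  exact hle

lemma setIntegral_sq_of_tsupport_subset {u : E → ℝ} {D : Set E} (h : tsupport u ⊆ D) :
    ∫ x in D, u x ^ 2 = ∫ x, u x ^ 2 :=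
  setIntegral_eq_integral_of_forall_compl_eq_zero fun x hx => by
    rw [image_eq_zero_of_notMem_tsupport fun h' => hx (h h')]
    simp

lemma setIntegral_sq_norm_fderiv_of_tsupport_subset {u : E → ℝ} {D : Set E}
    (h : tsupport u ⊆ D) : ∫ x in D, ‖fderiv ℝ u x‖ ^ 2 = ∫ x, ‖fderiv ℝ u x‖ ^ 2 :=
  setIntegral_eq_integral_of_forall_compl_eq_zero fun x hx => by
    rw [fderiv_of_notMem_tsupport ℝ fun h' => hx (h h')]
    simp

/-- Every test function on a set no larger than a ball can be rearranged and approximated by test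
functions on the ball with no larger Dirichlet energy and asymptotically the same `L²` norm. -/
theorem exists_test_functions_ball [Nontrivial E] {c : E} {r : ℝ} (hr : 0 < r) {Ω : Set E}
    (hvol : volume Ω ≤ volume (ball c r)) {u : E → ℝ} (hu : ContDiff ℝ (⊤ : ℕ∞) u)
    (huc : HasCompactSupport u) (huΩ : tsupport u ⊆ Ω) :
    ∃ v : ℕ → E → ℝ, (∀ k, ContDiff ℝ (⊤ : ℕ∞) (v k) ∧ HasCompactSupport (v k) ∧
      tsupport (v k) ⊆ ball c r ∧ ∫ x, ‖fderiv ℝ (v k) x‖ ^ 2 ≤ ∫ x, ‖fderiv ℝ u x‖ ^ 2) ∧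
      Tendsto (fun k => ∫ x, v k x ^ 2) atTop (𝓝 (∫ x, u x ^ 2)) := by
  have hu1 : ContDiff ℝ 1 u := hu.of_le (by exact_mod_cast le_top)
  obtain ⟨L, hL⟩ := hu1.lipschitzWith_of_hasCompactSupport huc one_ne_zero
  obtain ⟨R, hR⟩ := huc.isCompact.isBounded.subset_closedBall c
  obtain ⟨M, hM⟩ := huc.exists_bound_of_continuous hu.continuous
  have habs : IsRearrangementCandidate c R M L (fun x => |u x|) (fun x => |u x|) := by
    refine ⟨?_, fun x => abs_nonneg _, hM, fun x hx => ?_, le_rfl, rfl, fun t => le_rfl⟩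
    · exact LipschitzWith.of_dist_le_mul fun x y =>
        (abs_abs_sub_abs_le (u x) (u y)).trans (hL.dist_le_mul x y)
    · have : x ∉ tsupport u := fun h => (mem_closedBall.1 (hR h)).not_gt hx
      simp [image_eq_zero_of_notMem_tsupport this]
  obtain ⟨f, hf, hmono⟩ := exists_radial_rearrangement habs
  have hpos : volume {x | 0 < f x} ≤ volume (ball c r) := by
    refine (hf.measure_pos_le.trans (measure_mono fun x hx => ?_)).trans hvol
    have hx : 0 < |u x| := hx
    exact huΩ (subset_tsupport u (abs_pos.1 hx))
  have hfr := eq_zero_of_radial_of_measure_pos_le hr hf.continuous hf.nonneg hmono hpos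
  have hfsq : ∫ x, f x ^ 2 = ∫ x, u x ^ 2 := by
    have h := hf.lintegral_sq
    simp only [sq_abs] at h
    have hu' := hu.continuous
    have hf' := hf.continuous
    rw [integral_eq_lintegral_of_nonneg_ae (.of_forall fun x => sq_nonneg _)
      (Continuous.aestronglyMeasurable (by fun_prop)), h, ← integral_eq_lintegral_of_nonneg_ae
      (.of_forall fun x => sq_nonneg _) (Continuous.aestronglyMeasurable (by fun_prop))]
  choose v hvs hvc hvr hvf hvE using fun k : ℕ =>
    exists_smooth_approx hf.lipschitz hf.nonneg hfr (Nat.one_div_pos_of_nat (α := ℝ) (n := k))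
  refine ⟨v, fun k => ⟨hvs k, hvc k, hvr k, ?_⟩, ?_⟩
  · refine integral_sq_norm_fderiv_le hu1 huc ((hvs k).of_le (by exact_mod_cast le_top)) (hvc k)
      fun t => ?_
    exact (hvE k t).trans ((hf.energy_le t).trans
      (nonlocalEnergy_le_of_abs_sub_le (fun x y => abs_abs_sub_abs_le (u x) (u y)) t))
  · have hfball : ∫ x in ball c r, f x ^ 2 = ∫ x, f x ^ 2 :=
      setIntegral_eq_integral_of_forall_compl_eq_zero fun x hx => by
        rw [hfr x (by simpa using hx)]
        simp
    rw [← hfsq, ← hfball]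
    simp only [← setIntegral_sq_of_tsupport_subset (hvr _)]
    have : IsFiniteMeasure (volume.restrict (ball c r)) :=
      isFiniteMeasure_restrict.2 measure_ball_lt_top.ne
    refine tendsto_integral_of_dominated_convergence (fun _ => (M + 1) ^ 2) (fun k => ?_)
      (integrable_const _) (fun k => .of_forall fun x => ?_) (.of_forall fun x => ?_)
    · exact ((hvs k).continuous.pow 2).aestronglyMeasurable
    · have h1 := hf.nonneg x
      have h2 := hf.le_bound x
      have h3 := abs_le.1 (hvf k x)
      have h4 : (1 / (k + 1) : ℝ) ≤ 1 := by
        rw [div_le_one (by positivity)]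
        linarith [(Nat.cast_nonneg k : (0 : ℝ) ≤ k)]
      rw [Real.norm_of_nonneg (sq_nonneg _)]
      exact sq_le_sq' (by linarith) (by linarith)
    · refine Tendsto.pow (tendsto_iff_dist_tendsto_zero.2 ?_) 2
      exact squeeze_zero (fun _ => dist_nonneg) (fun k => hvf k x)
        tendsto_one_div_add_atTop_nhds_zero_nat

lemma integral_sq_pos {u : E → ℝ} (hu : Continuous u) (huc : HasCompactSupport u)
    (h0 : u ≠ 0) : 0 < ∫ x, u x ^ 2 := by
  obtain ⟨x, hx⟩ := Function.ne_iff.1 h0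
  have hc : Continuous fun x => u x ^ 2 := hu.pow 2
  have hcs : HasCompactSupport fun x => u x ^ 2 :=
    huc.comp_left (g := fun s : ℝ => s ^ 2) (by simp)
  have hx2 : u x ^ 2 ≠ 0 := pow_ne_zero 2 hx
  exact hc.integral_pos_of_hasCompactSupport_nonneg_nonzero hcs (fun x => sq_nonneg (u x)) hx2

end FaberKrahn

/-- **The Faber–Krahn inequality:** among all nonempty open sets of given volume in
`ℝⁿ` (`n ≥ 2`), the ball minimizes the fundamental Dirichlet eigenvalue. -/
theorem faber_krahn (n : ℕ) (hn : 2 ≤ n)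
    (c : EuclideanSpace ℝ (Fin n)) (r : ℝ) (hr : 0 < r)
    (Ω : Set (EuclideanSpace ℝ (Fin n))) (hne : Ω.Nonempty) (ho : IsOpen Ω)
    (hvol : volume Ω = volume (Metric.ball c r)) :
    lambda1D n (Metric.ball c r) ≤ lambda1D n Ω := by
  have : Nonempty (Fin n) := ⟨⟨0, by lia⟩⟩
  refine le_csInf ?_ ?_
  · obtain ⟨x, hx⟩ := hne
    obtain ⟨u, hu, huc, hu', -, hux⟩ :=
      exists_contDiff_tsupport_subset (n := ⊤) (ho.mem_nhds hx)
    refine ⟨_, u, hu', huc, hu, fun h => ?_, rfl⟩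
    simp [h] at hux
  · rintro _ ⟨u, hu, huc, huΩ, hu0, rfl⟩
    rw [FaberKrahn.setIntegral_sq_of_tsupport_subset huΩ,
      FaberKrahn.setIntegral_sq_norm_fderiv_of_tsupport_subset huΩ]
    have hpos := FaberKrahn.integral_sq_pos hu.continuous huc hu0
    obtain ⟨v, hv, hlim⟩ := FaberKrahn.exists_test_functions_ball hr hvol.le hu huc huΩ
    refine ge_of_tendsto (tendsto_const_nhds.div hlim hpos.ne') ?_
    filter_upwards [hlim.eventually (lt_mem_nhds hpos)] with k hk
    obtain ⟨hvs, hvc, hvr, hvE⟩ := hv k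
    have hv0 : v k ≠ 0 := fun h => by simp [h] at hk
    refine le_trans (csInf_le ⟨0, ?_⟩ ⟨v k, hvs, hvc, hvr, hv0, rfl⟩) ?_
    · rintro _ ⟨w, -, -, -, -, rfl⟩
      positivity
    · rw [FaberKrahn.setIntegral_sq_of_tsupport_subset hvr,
        FaberKrahn.setIntegral_sq_norm_fderiv_of_tsupport_subset hvr]
      exact div_le_div_of_nonneg_right hvE hk.le
end

section
/- Let n ≥ 2, let B ⊂ ℝⁿ be an open ball, and let Ω ⊂ ℝⁿ be a bounded nonempty open set with the same Lebesgue measure as B. For a bounded nonempty open set D ⊂ ℝⁿ define λ₁^N(D) as the infimum of ∫_D |∇u|² dx / ∫_D u² dx over all Lipschitz functions u : ℝⁿ → ℝ with ∫_D u dx = 0 that are not almost everywhere zero on D. Then λ₁^N(Ω) ≤ λ₁^N(B). -/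
open Real MeasureTheory Set

/-- The first positive Neumann eigenvalue of a bounded `D ⊆ ℝⁿ`, defined variationally
as the infimum of the Rayleigh quotient `∫_D |∇u|² / ∫_D u²` over Lipschitz functions
`u : ℝⁿ → ℝ` with zero mean over `D` that are not almost everywhere zero on `D`. -/
noncomputable def lambda1N (n : ℕ) (D : Set (EuclideanSpace ℝ (Fin n))) : ℝ :=
  sInf {r : ℝ | ∃ u : EuclideanSpace ℝ (Fin n) → ℝ, (∃ K, LipschitzWith K u) ∧
    (∫ x in D, u x) = 0 ∧ ¬(u =ᵐ[volume.restrict D] 0) ∧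
    r = (∫ x in D, ‖fderiv ℝ u x‖ ^ 2) / ∫ x in D, u x ^ 2}

section Rotations

variable {n : ℕ}

/-- The orthogonal group of `ℝⁿ`, as unitary operators. -/
abbrev OrthGroup (n : ℕ) : Type :=
  unitary (EuclideanSpace ℝ (Fin n) →L[ℝ] EuclideanSpace ℝ (Fin n))

instance : ContinuousStar (EuclideanSpace ℝ (Fin n) →L[ℝ] EuclideanSpace ℝ (Fin n)) where
  continuous_star := (ContinuousLinearMap.adjoint (𝕜 := ℝ) (E := EuclideanSpace ℝ (Fin n))
    (F := EuclideanSpace ℝ (Fin n))).continuous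

instance : BorelSpace (OrthGroup n) := Subtype.borelSpace _

instance : CompactSpace (OrthGroup n) := by
  refine isCompact_iff_compactSpace.mp (Metric.isCompact_of_isClosed_isBounded isClosed_unitary ?_)
  refine (Metric.isBounded_closedBall (x := 0) (r := 1)).subset fun A hA ↦ ?_
  rw [mem_closedBall_zero_iff]
  refine ContinuousLinearMap.opNorm_le_bound _ zero_le_one fun x ↦ ?_
  rw [one_mul]
  exact (Unitary.norm_map ⟨A, hA⟩ x).le

/-- The Haar probability measure on the orthogonal group. -/
noncomputable def orthHaar (n : ℕ) : Measure (OrthGroup n) :=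
  Measure.haarMeasure ⊤

instance : (orthHaar n).IsHaarMeasure := by unfold orthHaar; infer_instance

instance : IsProbabilityMeasure (orthHaar n) := by
  constructor
  rw [orthHaar, ← Measure.haarMeasure_self (K₀ := (⊤ : TopologicalSpace.PositiveCompacts (OrthGroup n)))]
  simp

instance : (orthHaar n).IsMulRightInvariant := by
  constructor
  intro g
  have h1 : IsProbabilityMeasure ((orthHaar n).map (· * g)) :=
    Measure.isProbabilityMeasure_map (by fun_prop)
  exact Measure.isHaarMeasure_eq_of_isProbabilityMeasure _ _

lemma exists_orth_map_pair {e u e' u' : EuclideanSpace ℝ (Fin n)} (he : ‖e‖ = ‖e'‖)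
    (hu : ‖u‖ = ‖u'‖) (heu : inner ℝ e u = inner ℝ e' u') :
    ∃ B : OrthGroup n, B.1 e = e' ∧ B.1 u = u' := by
  set R₁ := (ℝ ∙ (e - e'))ᗮ.reflection with hR₁
  have h1 : R₁ e = e' := Submodule.reflection_sub he
  have h2 : ‖R₁ u‖ = ‖u'‖ := by rw [LinearIsometryEquiv.norm_map, hu]
  set R₂ := (ℝ ∙ (R₁ u - u'))ᗮ.reflection with hR₂
  have h3 : R₂ (R₁ u) = u' := Submodule.reflection_sub h2
  have h4 : R₂ e' = e' := by
    apply Submodule.reflection_mem_subspace_eq_self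
    rw [Submodule.mem_orthogonal_singleton_iff_inner_left, inner_sub_right]
    nth_rewrite 1 [← h1]
    rw [LinearIsometryEquiv.inner_map_map, heu, sub_self]
  refine ⟨Unitary.linearIsometryEquiv.symm (R₁.trans R₂), ?_, ?_⟩
  · simp [h1, h4]
  · simp [h3]

lemma exists_orth_map {e e' : EuclideanSpace ℝ (Fin n)} (he : ‖e‖ = ‖e'‖) :
    ∃ B : OrthGroup n, B.1 e = e' := by
  obtain ⟨B, hB, -⟩ := exists_orth_map_pair (u := 0) (u' := 0) he rfl (by simp)
  exact ⟨B, hB⟩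

lemma continuous_orth_apply :
    Continuous fun p : OrthGroup n × EuclideanSpace ℝ (Fin n) ↦ p.1.1 p.2 := by
  fun_prop

lemma integrable_orth {f : OrthGroup n → ℝ} (hf : Continuous f) : Integrable f (orthHaar n) :=
  hf.integrable_of_hasCompactSupport (HasCompactSupport.of_compactSpace f)

lemma integral_orth_mul_right (f : OrthGroup n → ℝ) (B : OrthGroup n) :
    ∫ A, f (A * B) ∂orthHaar n = ∫ A, f A ∂orthHaar n :=
  integral_mul_right_eq_self f B

lemma integral_orth_mul_left (f : OrthGroup n → ℝ) (B : OrthGroup n) :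
    ∫ A, f (B * A) ∂orthHaar n = ∫ A, f A ∂orthHaar n :=
  integral_mul_left_eq_self f B

end Rotations

section Circle

variable {F F' : ℝ → ℝ}

lemma mul_integral_sq_le_integral_deriv_sq_of_lt (hF : ∀ t, HasDerivAt F (F' t) t)
    (hF' : Continuous F') {a L κ : ℝ} (hL : 0 ≤ L) (hκ : 0 < κ) (hκL : κ * L < π)
    (ha : F a = 0) (hb : F (a + L) = 0) :
    κ ^ 2 * ∫ t in a..a + L, F t ^ 2 ≤ ∫ t in a..a + L, F' t ^ 2 := by
  have hFc : Continuous F := continuous_iff_continuousAt.2 fun t ↦ (hF t).continuousAt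
  set c : ℝ → ℝ := fun t ↦ -κ * tan (κ * (t - (a + L / 2))) with hc
  have hcd : ∀ t ∈ Icc a (a + L), HasDerivAt c (-κ ^ 2 - c t ^ 2) t := by
    intro t ht
    have hcos : cos (κ * (t - (a + L / 2))) ≠ 0 := by
      refine (cos_pos_of_mem_Ioo ⟨?_, ?_⟩).ne'
      · nlinarith [ht.1]
      · nlinarith [ht.2]
    have h := ((hasDerivAt_tan hcos).comp t
      (((hasDerivAt_id t).sub_const (a + L / 2)).const_mul κ)).const_mul (-κ)
    refine h.congr_deriv ?_
    simp only [hc, mul_one, tan_eq_sin_div_cos]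
    have htrig := Real.sin_sq_add_cos_sq (κ * (t - (a + L / 2)))
    generalize cos (κ * (t - (a + L / 2))) = y at *
    generalize sin (κ * (t - (a + L / 2))) = x at *
    field_simp
    linear_combination htrig
  have hΨ : ∀ t ∈ Icc a (a + L), HasDerivAt (fun t ↦ c t * F t ^ 2)
      ((-κ ^ 2 - c t ^ 2) * F t ^ 2 + c t * (2 * F t * F' t)) t := by
    intro t ht
    refine ((hcd t ht).mul ((hF t).pow 2)).congr_deriv ?_
    simp
  have key := intervalIntegral.sub_le_integral_of_hasDeriv_right_of_le
    (g := fun t ↦ c t * F t ^ 2) (φ := fun t ↦ F' t ^ 2 - κ ^ 2 * F t ^ 2)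
    (by linarith : a ≤ a + L) (fun t ht ↦ (hΨ t ht).continuousAt.continuousWithinAt)
    (fun t ht ↦ (hΨ t (Ioo_subset_Icc_self ht)).hasDerivWithinAt)
    (Continuous.integrableOn_Icc (by fun_prop))
    (fun t _ ↦ by nlinarith [sq_nonneg (F' t - c t * F t)])
  rw [intervalIntegral.integral_sub (Continuous.intervalIntegrable (by fun_prop) _ _)
    (Continuous.intervalIntegrable (by fun_prop) _ _),
    intervalIntegral.integral_const_mul, ha, hb] at key
  simp only [ne_eq, OfNat.ofNat_ne_zero, not_false_eq_true, zero_pow, mul_zero, sub_self] at key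
  linarith

/-- Wirtinger's inequality with Dirichlet boundary conditions. -/
lemma mul_integral_sq_le_integral_deriv_sq (hF : ∀ t, HasDerivAt F (F' t) t)
    (hF' : Continuous F') {a L κ : ℝ} (hL : 0 < L) (hκ : 0 < κ) (hκL : κ * L ≤ π)
    (ha : F a = 0) (hb : F (a + L) = 0) :
    κ ^ 2 * ∫ t in a..a + L, F t ^ 2 ≤ ∫ t in a..a + L, F' t ^ 2 := by
  have hlim : Filter.Tendsto (fun x : ℝ ↦ x ^ 2 * ∫ t in a..a + L, F t ^ 2) (nhdsWithin κ (Iio κ))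
      (nhds (κ ^ 2 * ∫ t in a..a + L, F t ^ 2)) :=
    ((Continuous.tendsto (by fun_prop) κ).mono_left nhdsWithin_le_nhds)
  refine le_of_tendsto hlim ?_
  filter_upwards [Ioo_mem_nhdsLT hκ] with x hx
  exact mul_integral_sq_le_integral_deriv_sq_of_lt hF hF' hL.le hx.1
    (by nlinarith [hx.2]) ha hb

lemma Function.Antiperiodic.exists_eq_zero {f : ℝ → ℝ} {T : ℝ} (h : Function.Antiperiodic f T)
    (hf : Continuous f) : ∃ s, f s = 0 := by
  have h0 := h 0
  rw [zero_add] at h0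
  rcases le_total (f 0) 0 with h1 | h1
  · exact mem_range_of_exists_le_of_exists_ge hf ⟨0, h1⟩ ⟨T, by linarith⟩
  · exact mem_range_of_exists_le_of_exists_ge hf ⟨T, by linarith⟩ ⟨0, h1⟩

lemma Function.Antiperiodic.integral_sq_le_integral_deriv_sq
    (h : Function.Antiperiodic F π) (hF : ∀ t, HasDerivAt F (F' t) t) (hF' : Continuous F') :
    ∫ t in 0..π, F t ^ 2 ≤ ∫ t in 0..π, F' t ^ 2 := by
  have hFc : Continuous F := continuous_iff_continuousAt.2 fun t ↦ (hF t).continuousAt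
  obtain ⟨s, hs⟩ := h.exists_eq_zero hFc
  have h' : Function.Antiperiodic F' π := fun t ↦ by
    have h1 := ((hF (t + π)).comp_add_const t π)
    have h2 : (fun x ↦ F (x + π)) = fun x ↦ - F x := funext h
    rw [h2] at h1
    exact h1.unique (hF t).neg
  have hp : Function.Periodic (fun t ↦ F t ^ 2) π := fun t ↦ by simp [h t]
  have hp' : Function.Periodic (fun t ↦ F' t ^ 2) π := fun t ↦ by simp [h' t]
  have e1 := hp.intervalIntegral_add_eq 0 s
  have e2 := hp'.intervalIntegral_add_eq 0 s
  rw [zero_add] at e1 e2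
  rw [e1, e2]
  simpa using mul_integral_sq_le_integral_deriv_sq hF hF' pi_pos one_pos (by simp) hs
    (by rw [h s, hs, neg_zero])

lemma Function.Periodic.exists_integral_sub_sq_le
    (h : Function.Periodic F π) (hF : ∀ t, HasDerivAt F (F' t) t) (hF' : Continuous F') :
    ∃ c, 4 * ∫ t in 0..π, (F t - c) ^ 2 ≤ ∫ t in 0..π, F' t ^ 2 := by
  have hFc : Continuous F := continuous_iff_continuousAt.2 fun t ↦ (hF t).continuousAt
  have hanti : Function.Antiperiodic (fun s ↦ F (s + π / 2) - F s) (π / 2) := fun s ↦ by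
    have := h s
    simp only [show s + π / 2 + π / 2 = s + π by ring, this]
    ring
  obtain ⟨s, hs⟩ := hanti.exists_eq_zero (by fun_prop)
  have h' : Function.Periodic F' π := fun t ↦ by
    have h1 := ((hF (t + π)).comp_add_const t π)
    have h2 : (fun x ↦ F (x + π)) = fun x ↦ F x := funext h
    rw [h2] at h1
    exact h1.unique (hF t)
  have hs2 := h s
  have hG : ∀ t, HasDerivAt (fun t ↦ F t - F s) (F' t) t := fun t ↦ (hF t).sub_const _
  refine ⟨F s, ?_⟩
  have hp : Function.Periodic (fun t ↦ (F t - F s) ^ 2) π := fun t ↦ by simp [h t]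
  have hp' : Function.Periodic (fun t ↦ F' t ^ 2) π := fun t ↦ by simp [h' t]
  have e1 := hp.intervalIntegral_add_eq 0 s
  have e2 := hp'.intervalIntegral_add_eq 0 s
  rw [zero_add] at e1 e2
  have i1 := mul_integral_sq_le_integral_deriv_sq (κ := 2) (a := s) (L := π / 2) hG hF'
    (by positivity) two_pos (by linarith) (by simp) (by linarith)
  have i2 := mul_integral_sq_le_integral_deriv_sq (κ := 2) (a := s + π / 2) (L := π / 2) hG hF'
    (by positivity) two_pos (by linarith) (by linarith)
    (by rw [show s + π / 2 + π / 2 = s + π by ring, hs2]; ring)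
  rw [e1, e2, ← intervalIntegral.integral_add_adjacent_intervals (b := s + π / 2) (c := s + π)
    (f := fun t ↦ (F t - F s) ^ 2)
    (Continuous.intervalIntegrable (by fun_prop) _ _)
    (Continuous.intervalIntegrable (by fun_prop) _ _),
    ← intervalIntegral.integral_add_adjacent_intervals (b := s + π / 2) (c := s + π)
    (f := fun t ↦ F' t ^ 2)
    (Continuous.intervalIntegrable (by fun_prop) _ _)
    (Continuous.intervalIntegrable (by fun_prop) _ _)]
  rw [show s + π / 2 + π / 2 = s + π by ring] at i2
  linarith

/-- On a circle, the mean square increments over the shifts `φ` and `φ + π` are controlled by the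
Dirichlet energy, with the sharp constant. -/
lemma Function.Periodic.integral_increment_sq_le
    (h : Function.Periodic F (2 * π)) (hF : ∀ t, HasDerivAt F (F' t) t) (hF' : Continuous F')
    (φ : ℝ) :
    ∫ s in 0..2 * π, ((F (s + φ) - F s) ^ 2 + (F (s + φ + π) - F s) ^ 2) ≤
      4 * ∫ s in 0..2 * π, F' s ^ 2 := by
  have hFc : Continuous F := continuous_iff_continuousAt.2 fun t ↦ (hF t).continuousAt
  have h2 : ∀ t, F (t + π + π) = F t := fun t ↦ by rw [← h t]; congr 1; ring
  have split : ∀ f : ℝ → ℝ, Continuous f →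
      ∫ s in 0..2 * π, f s = ∫ s in 0..π, (f s + f (s + π)) := by
    intro f hf
    rw [intervalIntegral.integral_add (hf.intervalIntegrable _ _)
      (Continuous.intervalIntegrable (by fun_prop) _ _),
      intervalIntegral.integral_comp_add_right, zero_add, ← two_mul,
      intervalIntegral.integral_add_adjacent_intervals (hf.intervalIntegrable _ _)
      (hf.intervalIntegrable _ _)]
  set P : ℝ → ℝ := fun s ↦ (F s + F (s + π)) / 2 with hP
  set O : ℝ → ℝ := fun s ↦ (F s - F (s + π)) / 2 with hO
  set P' : ℝ → ℝ := fun s ↦ (F' s + F' (s + π)) / 2 with hP'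
  set O' : ℝ → ℝ := fun s ↦ (F' s - F' (s + π)) / 2 with hO'
  have hPc : Continuous P := by fun_prop
  have hOc : Continuous O := by fun_prop
  have hPc' : Continuous P' := by fun_prop
  have hOc' : Continuous O' := by fun_prop
  have hPd : ∀ t, HasDerivAt P (P' t) t := fun t ↦
    ((hF t).add ((hF (t + π)).comp_add_const t π)).div_const 2
  have hOd : ∀ t, HasDerivAt O (O' t) t := fun t ↦
    ((hF t).sub ((hF (t + π)).comp_add_const t π)).div_const 2
  have hPp : Function.Periodic P π := fun t ↦ by simp only [hP, h2]; ring
  have hOa : Function.Antiperiodic O π := fun t ↦ by simp only [hO, h2]; ring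
  obtain ⟨c, hc⟩ := hPp.exists_integral_sub_sq_le hPd hPc'
  have hOi := hOa.integral_sq_le_integral_deriv_sq hOd hOc'
  have shift : ∀ f : ℝ → ℝ, Function.Periodic f π →
      ∫ s in 0..π, f (s + φ) = ∫ s in 0..π, f s := by
    intro f hf
    rw [intervalIntegral.integral_comp_add_right, zero_add, add_comm π φ,
      hf.intervalIntegral_add_eq φ 0, zero_add]
  have sP := shift (fun s ↦ (P s - c) ^ 2) (fun t ↦ by simp [hPp t])
  have sO := shift (fun s ↦ O s ^ 2) (fun t ↦ by simp [hOa t])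
  rw [split _ (by fun_prop), split _ (by fun_prop)]
  have lhs : ∫ s in 0..π, ((F (s + φ) - F s) ^ 2 + (F (s + φ + π) - F s) ^ 2 +
      ((F (s + π + φ) - F (s + π)) ^ 2 + (F (s + π + φ + π) - F (s + π)) ^ 2)) ≤
      ∫ s in 0..π, (8 * (P s - c) ^ 2 + 8 * (P (s + φ) - c) ^ 2 + 4 * O s ^ 2 +
        4 * O (s + φ) ^ 2) := by
    refine intervalIntegral.integral_mono_on pi_pos.le
      (Continuous.intervalIntegrable (by fun_prop) _ _)
      (Continuous.intervalIntegrable (by fun_prop) _ _) fun s _ ↦ ?_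
    have e1 : s + π + φ = s + φ + π := by ring
    rw [e1, h2 (s + φ)]
    simp only [hP, hO]
    nlinarith [sq_nonneg ((F s + F (s + π)) / 2 - c + ((F (s + φ) + F (s + φ + π)) / 2 - c))]
  have rhs : ∫ s in 0..π, (F' s ^ 2 + F' (s + π) ^ 2) =
      2 * (∫ s in 0..π, P' s ^ 2) + 2 * ∫ s in 0..π, O' s ^ 2 := by
    rw [← intervalIntegral.integral_const_mul, ← intervalIntegral.integral_const_mul,
      ← intervalIntegral.integral_add (Continuous.intervalIntegrable (by fun_prop) _ _)
        (Continuous.intervalIntegrable (by fun_prop) _ _)]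
    congr 1
    ext s
    simp only [hP', hO']
    ring
  rw [rhs]
  refine lhs.trans ?_
  rw [intervalIntegral.integral_add, intervalIntegral.integral_add, intervalIntegral.integral_add]
  · simp only [intervalIntegral.integral_const_mul]
    rw [sP, sO]
    have : 0 ≤ ∫ s in 0..π, P' s ^ 2 :=
      intervalIntegral.integral_nonneg pi_pos.le fun s _ ↦ sq_nonneg _
    linarith
  all_goals exact Continuous.intervalIntegrable (by fun_prop) _ _

end Circle

section Sphere

variable {n : ℕ}

lemma OrthonormalBasis.norm_dual_sq {ι H : Type*} [Fintype ι] [NormedAddCommGroup H]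
    [InnerProductSpace ℝ H] [CompleteSpace H] (b : OrthonormalBasis ι ℝ H) (f : H →L[ℝ] ℝ) :
    ‖f‖ ^ 2 = ∑ i, f (b i) ^ 2 := by
  have h := b.sum_sq_norm_inner_right ((InnerProductSpace.toDual ℝ H).symm f)
  rw [LinearIsometryEquiv.norm_map] at h
  rw [← h]
  refine Finset.sum_congr rfl fun i _ ↦ ?_
  rw [real_inner_comm, InnerProductSpace.toDual_symm_apply, Real.norm_eq_abs, sq_abs]

lemma integral_orth_congr {f : EuclideanSpace ℝ (Fin n) → ℝ} {x y : EuclideanSpace ℝ (Fin n)}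
    (h : ‖x‖ = ‖y‖) : ∫ A, f (A.1 x) ∂orthHaar n = ∫ A, f (A.1 y) ∂orthHaar n := by
  obtain ⟨B, hB⟩ := exists_orth_map h
  rw [← integral_orth_mul_right (fun A ↦ f (A.1 x)) B]
  simp [hB]

lemma integral_orth_congr_pair {f : EuclideanSpace ℝ (Fin n) → EuclideanSpace ℝ (Fin n) → ℝ}
    {e u e' u' : EuclideanSpace ℝ (Fin n)} (he : ‖e‖ = ‖e'‖)
    (hu : ‖u‖ = ‖u'‖) (heu : inner ℝ e u = inner ℝ e' u') :
    ∫ A, f (A.1 e) (A.1 u) ∂orthHaar n = ∫ A, f (A.1 e') (A.1 u') ∂orthHaar n := by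
  obtain ⟨B, hB, hB'⟩ := exists_orth_map_pair he hu heu
  rw [← integral_orth_mul_right (fun A ↦ f (A.1 e) (A.1 u)) B]
  simp [hB, hB']

variable {v : EuclideanSpace ℝ (Fin n) → ℝ} {e u : EuclideanSpace ℝ (Fin n)}

lemma norm_cos_smul_add_sin_smul (he : ‖e‖ = 1) (hu : ‖u‖ = 1) (heu : inner ℝ e u = 0) (t : ℝ) :
    ‖cos t • e + sin t • u‖ = 1 := by
  have : ‖cos t • e + sin t • u‖ ^ 2 = 1 := by
    rw [norm_add_sq_real, norm_smul, norm_smul, inner_smul_left, inner_smul_right, heu, he, hu]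
    simp
  nlinarith [norm_nonneg (cos t • e + sin t • u)]

/-- The mean square increment of `v` along great circles, for a shift and its opposite. -/
lemma integral_orth_increment_sq_le (hv : ContDiff ℝ 1 v) (he : ‖e‖ = 1) (hu : ‖u‖ = 1)
    (heu : inner ℝ e u = 0) (r φ : ℝ) :
    ∫ A, ((v (r • A.1 (cos φ • e + sin φ • u)) - v (r • A.1 e)) ^ 2 +
      (v (-(r • A.1 (cos φ • e + sin φ • u))) - v (r • A.1 e)) ^ 2) ∂orthHaar n ≤
      4 * (r ^ 2 * ∫ A, (fderiv ℝ v (r • A.1 e) (A.1 u)) ^ 2 ∂orthHaar n) := by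
  have hvc := hv.continuous
  have hdc : Continuous (fderiv ℝ v) := hv.continuous_fderiv one_ne_zero
  set c : ℝ → EuclideanSpace ℝ (Fin n) := fun t ↦ cos t • e + sin t • u with hc
  set c' : ℝ → EuclideanSpace ℝ (Fin n) := fun t ↦ (-sin t) • e + cos t • u with hc'
  have hcd : ∀ t, HasDerivAt c (c' t) t := fun t ↦
    ((hasDerivAt_cos t).smul_const e).add ((hasDerivAt_sin t).smul_const u)
  have hcc : Continuous c := by fun_prop
  have hcc' : Continuous c' := by fun_prop
  have hc'_eq : ∀ t, c' t = c (t + π / 2) := fun t ↦ by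
    simp [hc, hc', cos_add_pi_div_two, sin_add_pi_div_two]
  have hcn : ∀ t, ‖c t‖ = 1 := norm_cos_smul_add_sin_smul he hu heu
  have hci : ∀ s t, inner ℝ (c s) (c t) = cos (s - t) := fun s t ↦ by
    have heu' : inner ℝ u e = 0 := by rw [real_inner_comm, heu]
    simp only [hc, inner_add_left, inner_add_right, inner_smul_left, inner_smul_right, heu, heu',
      real_inner_self_eq_norm_sq, he, hu, cos_sub]
    simp
    ring
  have key : ∀ A : OrthGroup n,
      ∫ s in 0..2 * π, ((v (r • A.1 (c (s + φ))) - v (r • A.1 (c s))) ^ 2 +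
        (v (r • A.1 (c (s + φ + π))) - v (r • A.1 (c s))) ^ 2) ≤
      4 * ∫ s in 0..2 * π, (fderiv ℝ v (r • A.1 (c s)) (r • A.1 (c' s))) ^ 2 := by
    intro A
    refine Function.Periodic.integral_increment_sq_le (F := fun s ↦ v (r • A.1 (c s)))
      (F' := fun s ↦ fderiv ℝ v (r • A.1 (c s)) (r • A.1 (c' s))) (fun t ↦ ?_) (fun t ↦ ?_)
      (by fun_prop) φ
    · simp [hc]
    · exact ((hv.differentiable one_ne_zero).differentiableAt.hasFDerivAt).comp_hasDerivAt t
        ((A.1.hasFDerivAt.comp_hasDerivAt t (hcd t)).const_smul r)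
  have hx : ∀ f : ℝ → ℝ, Continuous f →
      Continuous fun p : OrthGroup n × ℝ ↦ r • p.1.1 (c (f p.2)) := fun f hf ↦
    (continuous_orth_apply.comp (continuous_fst.prodMk (hcc.comp (hf.comp continuous_snd)))).const_smul r
  have hx' : Continuous fun p : OrthGroup n × ℝ ↦ r • p.1.1 (c' p.2) :=
    (continuous_orth_apply.comp (continuous_fst.prodMk (hcc'.comp continuous_snd))).const_smul r
  have hf₁ : Continuous (Function.uncurry fun (A : OrthGroup n) (s : ℝ) ↦
      (v (r • A.1 (c (s + φ))) - v (r • A.1 (c s))) ^ 2 +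
        (v (r • A.1 (c (s + φ + π))) - v (r • A.1 (c s))) ^ 2) :=
    (((hvc.comp (hx (· + φ) (by fun_prop))).sub (hvc.comp (hx id (by fun_prop)))).pow 2).add
      (((hvc.comp (hx (· + φ + π) (by fun_prop))).sub (hvc.comp (hx id (by fun_prop)))).pow 2)
  have hf₂ : Continuous (Function.uncurry fun (A : OrthGroup n) (s : ℝ) ↦
      (fderiv ℝ v (r • A.1 (c s)) (r • A.1 (c' s))) ^ 2) :=
    ((hdc.comp (hx id continuous_id)).clm_apply hx').pow 2
  have hIntegral := integral_mono (μ := orthHaar n)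
    (integrable_orth (intervalIntegral.continuous_parametric_intervalIntegral_of_continuous'
      hf₁ 0 (2 * π)))
    ((integrable_orth (intervalIntegral.continuous_parametric_intervalIntegral_of_continuous'
      hf₂ 0 (2 * π))).const_mul 4) key
  have swap : ∀ f : OrthGroup n → ℝ → ℝ, Continuous (Function.uncurry f) →
      ∫ A, (∫ s in 0..2 * π, f A s) ∂orthHaar n = ∫ s in 0..2 * π, ∫ A, f A s ∂orthHaar n := by
    intro f hf
    have : Integrable (Function.uncurry f)
        ((orthHaar n).prod (volume.restrict (Ioc 0 (2 * π)))) := by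
      rw [← Measure.restrict_univ (μ := orthHaar n), Measure.prod_restrict]
      exact (hf.continuousOn.integrableOn_compact (isCompact_univ.prod isCompact_Icc)).mono_set
        (prod_mono_right Ioc_subset_Icc_self)
    simp only [intervalIntegral.integral_of_le (by positivity : (0 : ℝ) ≤ 2 * π)]
    exact integral_integral_swap this
  rw [integral_const_mul, swap _ hf₁, swap _ hf₂] at hIntegral
  have e1 : ∀ s, ∫ A, ((v (r • A.1 (c (s + φ))) - v (r • A.1 (c s))) ^ 2 +
        (v (r • A.1 (c (s + φ + π))) - v (r • A.1 (c s))) ^ 2) ∂orthHaar n =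
      ∫ A, ((v (r • A.1 (c φ)) - v (r • A.1 e)) ^ 2 +
      (v (-(r • A.1 (c φ))) - v (r • A.1 e)) ^ 2) ∂orthHaar n := by
    intro s
    have h1 : ∀ t, c (t + π) = - c t := fun t ↦ by
      simp only [hc, cos_add_pi, sin_add_pi, neg_smul, neg_add]
    simp only [h1, map_neg, smul_neg]
    refine integral_orth_congr_pair (f := fun x y ↦ (v (r • x) - v (r • y)) ^ 2 +
      (v (-(r • x)) - v (r • y)) ^ 2) (by rw [hcn, hcn]) (by rw [hcn, he]) ?_
    have h0 : e = c 0 := by simp [hc]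
    rw [hci, h0, hci]
    congr 1
    ring
  have e2 : ∀ s, ∫ A, (fderiv ℝ v (r • A.1 (c s)) (r • A.1 (c' s))) ^ 2 ∂orthHaar n =
      r ^ 2 * ∫ A, (fderiv ℝ v (r • A.1 e) (A.1 u)) ^ 2 ∂orthHaar n := by
    intro s
    simp only [map_smul, smul_eq_mul, mul_pow]
    rw [integral_const_mul]
    congr 1
    refine integral_orth_congr_pair (f := fun x y ↦ (fderiv ℝ v (r • x) y) ^ 2)
      (by rw [hcn, he]) (by rw [hc'_eq, hcn, hu]) ?_
    rw [hc'_eq, hci, heu]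
    simp
  simp only [e1, e2, intervalIntegral.integral_const, sub_zero, smul_eq_mul] at hIntegral
  have hpi : 0 < 2 * π := by positivity
  refine le_of_mul_le_mul_left ?_ hpi
  linarith

lemma exists_cos_smul_add_sin_smul_eq {e w : EuclideanSpace ℝ (Fin n)} (hn : 2 ≤ n)
    (he : ‖e‖ = 1) (hw : ‖w‖ = 1) :
    ∃ (u : EuclideanSpace ℝ (Fin n)) (φ : ℝ), ‖u‖ = 1 ∧ inner ℝ e u = 0 ∧
      w = cos φ • e + sin φ • u := by
  set d := w - inner ℝ e w • e with hd
  have hed : inner ℝ e d = 0 := by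
    rw [hd, inner_sub_right, inner_smul_right, real_inner_self_eq_norm_sq, he]; ring
  have hle := abs_le.mp (abs_real_inner_le_norm e w)
  rw [he, hw, one_mul] at hle
  have hdn : ‖d‖ ^ 2 = 1 - inner ℝ e w ^ 2 := by
    rw [hd, norm_sub_sq_real, hw, norm_smul, he, inner_smul_right, real_inner_comm e w]
    simp only [Real.norm_eq_abs, mul_one, sq_abs]
    ring
  have hsin : sin (arccos (inner ℝ e w)) = ‖d‖ := by
    rw [sin_arccos, ← hdn, sqrt_sq (norm_nonneg _)]
  have hcos : cos (arccos (inner ℝ e w)) = inner ℝ e w := cos_arccos hle.1 hle.2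
  by_cases h0 : d = 0
  · have hfr : 1 < Module.finrank ℝ (EuclideanSpace ℝ (Fin n)) := by simp; omega
    obtain ⟨x, hx, hx0⟩ : ∃ x ∈ (ℝ ∙ e)ᗮ, x ≠ 0 := by
      apply Submodule.exists_mem_ne_zero_of_ne_bot
      intro hbot
      rw [Submodule.orthogonal_eq_bot_iff] at hbot
      have := finrank_span_singleton (K := ℝ) (v := e) (by rintro rfl; simp at he)
      rw [hbot, finrank_top] at this
      omega
    rw [Submodule.mem_orthogonal_singleton_iff_inner_right] at hx
    refine ⟨‖x‖⁻¹ • x, arccos (inner ℝ e w), by simp [norm_smul, hx0], by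
      rw [inner_smul_right, hx, mul_zero], ?_⟩
    rw [hsin, hcos, h0, norm_zero, zero_smul, add_zero]
    exact sub_eq_zero.mp (hd.symm.trans h0)
  · refine ⟨‖d‖⁻¹ • d, arccos (inner ℝ e w), by simp [norm_smul, h0], by
      rw [inner_smul_right, hed, mul_zero], ?_⟩
    rw [hsin, hcos, smul_smul, mul_inv_cancel₀ (by simpa using h0), one_smul, hd]
    abel

/-- The variance of `v` over a sphere is controlled by a tangential derivative. -/
lemma variance_sphere_le (hn : 2 ≤ n) (hv : ContDiff ℝ 1 v) (he : ‖e‖ = 1) (hu : ‖u‖ = 1)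
    (heu : inner ℝ e u = 0) (r : ℝ) :
    ∫ A, v (r • A.1 e) ^ 2 ∂orthHaar n - (∫ A, v (r • A.1 e) ∂orthHaar n) ^ 2 ≤
      r ^ 2 * ∫ A, (fderiv ℝ v (r • A.1 e) (A.1 u)) ^ 2 ∂orthHaar n := by
  have hvc := hv.continuous
  set m := ∫ A, v (r • A.1 e) ∂orthHaar n with hm
  set V := ∫ A, v (r • A.1 e) ^ 2 ∂orthHaar n with hV
  set τ := ∫ A, (fderiv ℝ v (r • A.1 e) (A.1 u)) ^ 2 ∂orthHaar n with hτ
  have hcx : ∀ x : EuclideanSpace ℝ (Fin n), Continuous fun A : OrthGroup n ↦ r • A.1 x :=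
    fun x ↦ (continuous_orth_apply.comp (continuous_id.prodMk continuous_const)).const_smul r
  have key : ∀ B : OrthGroup n, 4 * V - 2 * ∫ A, v (r • A.1 e) *
      (v (r • A.1 (B.1 e)) + v (r • A.1 (B.1 (-e)))) ∂orthHaar n ≤ 4 * (r ^ 2 * τ) := by
    intro B
    have hBe : ‖B.1 e‖ = 1 := by rw [Unitary.norm_map, he]
    obtain ⟨u', φ, hu', heu', hw⟩ := exists_cos_smul_add_sin_smul_eq hn he hBe
    have h := integral_orth_increment_sq_le hv he hu' heu' r φ
    have e1 : ∫ A, (fderiv ℝ v (r • A.1 e) (A.1 u')) ^ 2 ∂orthHaar n = τ :=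
      integral_orth_congr_pair (f := fun x y ↦ (fderiv ℝ v (r • x) y) ^ 2) rfl
        (by rw [hu, hu']) (by rw [heu, heu'])
    rw [← hw, e1] at h
    refine le_trans (le_of_eq ?_) h
    have hneg : ∀ A : OrthGroup n, -(r • A.1 (B.1 e)) = r • A.1 (B.1 (-e)) := fun A ↦ by simp
    simp only [hneg]
    have e2 : ∀ x, ‖x‖ = 1 → ∫ A, v (r • A.1 x) ^ 2 ∂orthHaar n = V := fun x hx ↦
      integral_orth_congr (f := fun x ↦ v (r • x) ^ 2) (by rw [hx, he])
    have e3 := e2 (B.1 e) hBe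
    have e4 := e2 (B.1 (-e)) (by rw [map_neg, norm_neg, hBe])
    have i1 : Integrable (fun A : OrthGroup n ↦ v (r • A.1 e) ^ 2) (orthHaar n) :=
      integrable_orth ((hvc.comp (hcx e)).pow 2)
    have i2 : Integrable (fun A : OrthGroup n ↦ v (r • A.1 (B.1 e)) ^ 2) (orthHaar n) :=
      integrable_orth ((hvc.comp (hcx (B.1 e))).pow 2)
    have i3 : Integrable (fun A : OrthGroup n ↦ v (r • A.1 (B.1 (-e))) ^ 2) (orthHaar n) :=
      integrable_orth ((hvc.comp (hcx (B.1 (-e)))).pow 2)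
    have i4 : Integrable (fun A : OrthGroup n ↦ v (r • A.1 e) *
        (v (r • A.1 (B.1 e)) + v (r • A.1 (B.1 (-e))))) (orthHaar n) :=
      integrable_orth ((hvc.comp (hcx e)).mul
        ((hvc.comp (hcx (B.1 e))).add (hvc.comp (hcx (B.1 (-e))))))
    have expand : ∀ A : OrthGroup n, (v (r • A.1 (B.1 e)) - v (r • A.1 e)) ^ 2 +
        (v (r • A.1 (B.1 (-e))) - v (r • A.1 e)) ^ 2 =
        2 * v (r • A.1 e) ^ 2 + v (r • A.1 (B.1 e)) ^ 2 + v (r • A.1 (B.1 (-e))) ^ 2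
        - 2 * (v (r • A.1 e) * (v (r • A.1 (B.1 e)) + v (r • A.1 (B.1 (-e))))) := fun A ↦ by ring
    simp only [expand]
    have i12 : Integrable (fun A : OrthGroup n ↦ 2 * v (r • A.1 e) ^ 2 +
        v (r • A.1 (B.1 e)) ^ 2) (orthHaar n) := (i1.const_mul 2).add i2
    have i123 : Integrable (fun A : OrthGroup n ↦ 2 * v (r • A.1 e) ^ 2 +
        v (r • A.1 (B.1 e)) ^ 2 + v (r • A.1 (B.1 (-e))) ^ 2) (orthHaar n) := i12.add i3
    rw [integral_sub i123 (i4.const_mul 2), integral_add i12 i3, integral_add (i1.const_mul 2) i2,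
      integral_const_mul, integral_const_mul, e3, e4]
    ring
  have hf : Continuous (Function.uncurry fun (B A : OrthGroup n) ↦ v (r • A.1 e) *
      (v (r • A.1 (B.1 e)) + v (r • A.1 (B.1 (-e))))) := by
    have h1 : ∀ x : EuclideanSpace ℝ (Fin n),
        Continuous fun p : OrthGroup n × OrthGroup n ↦ v (r • p.2.1 (p.1.1 x)) := fun x ↦
      hvc.comp ((continuous_orth_apply.comp (continuous_snd.prodMk
        (continuous_orth_apply.comp (continuous_fst.prodMk continuous_const)))).const_smul r)
    exact ((hvc.comp (hcx e)).comp continuous_snd).mul ((h1 e).add (h1 (-e)))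
  have hfi : Integrable (Function.uncurry fun (B A : OrthGroup n) ↦ v (r • A.1 e) *
      (v (r • A.1 (B.1 e)) + v (r • A.1 (B.1 (-e))))) ((orthHaar n).prod (orthHaar n)) :=
    hf.integrable_of_hasCompactSupport (HasCompactSupport.of_compactSpace _)
  have hmean : ∫ B, (∫ A, v (r • A.1 e) *
      (v (r • A.1 (B.1 e)) + v (r • A.1 (B.1 (-e)))) ∂orthHaar n) ∂orthHaar n = 2 * m ^ 2 := by
    rw [integral_integral_swap hfi]
    have hin : ∀ A : OrthGroup n, ∀ x, ‖x‖ = 1 →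
        ∫ B : OrthGroup n, v (r • A.1 (B.1 x)) ∂orthHaar n = m := by
      intro A x hx
      have := integral_orth_mul_left (fun C : OrthGroup n ↦ v (r • C.1 x)) A
      simp only [Submonoid.coe_mul] at this
      exact this.trans (integral_orth_congr (f := fun x ↦ v (r • x)) (by rw [hx, he]))
    have hci : ∀ (A : OrthGroup n) x,
        Integrable (fun B : OrthGroup n ↦ v (r • A.1 (B.1 x))) (orthHaar n) := fun A x ↦
      integrable_orth (hvc.comp ((A.1.continuous.comp (continuous_orth_apply.comp
        (continuous_id.prodMk continuous_const))).const_smul r))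
    have : ∀ A : OrthGroup n, ∫ B : OrthGroup n, v (r • A.1 e) *
      (v (r • A.1 (B.1 e)) + v (r • A.1 (B.1 (-e)))) ∂orthHaar n = v (r • A.1 e) * (2 * m) := by
      intro A
      rw [integral_const_mul, integral_add (hci A e) (hci A (-e)), hin A e he,
        hin A (-e) (by rw [norm_neg, he])]
      ring
    simp only [this]
    rw [integral_mul_const]
    ring
  have hIntegral := integral_mono (μ := orthHaar n)
    ((integrable_const (4 * V)).sub (hfi.integral_prod_left.const_mul 2))
    (integrable_const (4 * (r ^ 2 * τ))) key
  have hsub := integral_sub (integrable_const (4 * V))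
    (hfi.integral_prod_left.const_mul 2)
  simp only [Function.uncurry_apply_pair] at hsub
  simp only [Pi.sub_apply, Function.uncurry_apply_pair] at hIntegral
  rw [hsub, integral_const_mul (2 : ℝ) (fun B : OrthGroup n ↦ ∫ A : OrthGroup n, v (r • A.1 e) *
      (v (r • A.1 (B.1 e)) + v (r • A.1 (B.1 (-e)))) ∂orthHaar n), hmean] at hIntegral
  simp only [integral_const, probReal_univ, smul_eq_mul, one_mul] at hIntegral
  linarith

/-- The sharp Poincaré inequality on spheres, averaged over the orthogonal group. -/
lemma poincare_sphere (hn : 2 ≤ n) (hv : ContDiff ℝ 1 v) (he : ‖e‖ = 1) (r : ℝ) :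
    (n - 1) * (∫ A, v (r • A.1 e) ^ 2 ∂orthHaar n - (∫ A, v (r • A.1 e) ∂orthHaar n) ^ 2) ≤
      r ^ 2 * (∫ A, ‖fderiv ℝ v (r • A.1 e)‖ ^ 2 ∂orthHaar n -
        ∫ A, (fderiv ℝ v (r • A.1 e) (A.1 e)) ^ 2 ∂orthHaar n) := by
  have hdc : Continuous (fderiv ℝ v) := hv.continuous_fderiv one_ne_zero
  have hcx : ∀ x : EuclideanSpace ℝ (Fin n), Continuous fun A : OrthGroup n ↦ A.1 x :=
    fun x ↦ continuous_orth_apply.comp (continuous_id.prodMk continuous_const)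
  let b := EuclideanSpace.basisFun (Fin n) ℝ
  let i₀ : Fin n := ⟨0, by omega⟩
  have hb : ∀ i, ‖b i‖ = 1 := b.orthonormal.1
  rw [integral_orth_congr (f := fun x ↦ v (r • x) ^ 2) (he.trans (hb i₀).symm),
    integral_orth_congr (f := fun x ↦ v (r • x)) (he.trans (hb i₀).symm),
    integral_orth_congr (f := fun x ↦ ‖fderiv ℝ v (r • x)‖ ^ 2) (he.trans (hb i₀).symm),
    integral_orth_congr (f := fun x ↦ (fderiv ℝ v (r • x) x) ^ 2) (he.trans (hb i₀).symm)]
  have hsum : ∫ A, ‖fderiv ℝ v (r • A.1 (b i₀))‖ ^ 2 ∂orthHaar n =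
      ∑ i, ∫ A, (fderiv ℝ v (r • A.1 (b i₀)) (A.1 (b i))) ^ 2 ∂orthHaar n := by
    rw [← integral_finsetSum]
    · refine integral_congr_ae (Filter.Eventually.of_forall fun A ↦ ?_)
      exact (b.map (Unitary.linearIsometryEquiv A)).norm_dual_sq _
    · intro i _
      exact integrable_orth (((hdc.comp ((hcx (b i₀)).const_smul r)).clm_apply (hcx (b i))).pow 2)
  rw [hsum, ← Finset.add_sum_erase _ _ (Finset.mem_univ i₀), add_sub_cancel_left, Finset.mul_sum]
  have hcard : ((Finset.univ.erase i₀).card : ℝ) = n - 1 := by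
    rw [Finset.card_erase_of_mem (Finset.mem_univ _), Finset.card_univ, Fintype.card_fin,
      Nat.cast_sub (by omega)]
    simp
  rw [← hcard, ← nsmul_eq_mul]
  refine Finset.card_nsmul_le_sum _ _ _ fun i hi ↦ ?_
  exact variance_sphere_le hn hv (hb i₀) (hb i)
    (b.orthonormal.2 (Finset.ne_of_mem_erase hi).symm) r

end Sphere

section Bessel

lemma hasDerivAt_integral_mul_cos {a : ℝ → ℝ} (ha : Continuous a) (r : ℝ) :
    HasDerivAt (fun r ↦ ∫ θ in 0..π, a θ * cos (r * cos θ))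
      (∫ θ in 0..π, a θ * (-cos θ * sin (r * cos θ))) r := by
  refine (intervalIntegral.hasDerivAt_integral_of_dominated_loc_of_deriv_le
    (F := fun r θ ↦ a θ * cos (r * cos θ)) (F' := fun r θ ↦ a θ * (-cos θ * sin (r * cos θ)))
    (bound := fun θ ↦ |a θ|) Filter.univ_mem
    (Filter.Eventually.of_forall fun x ↦ (by fun_prop : Continuous _).aestronglyMeasurable)
    ((by fun_prop : Continuous _).intervalIntegrable _ _)
    (by fun_prop : Continuous _).aestronglyMeasurable
    (Filter.Eventually.of_forall fun θ _ x _ ↦ ?_)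
    (ha.abs.intervalIntegrable _ _)
    (Filter.Eventually.of_forall fun θ _ x _ ↦ ?_)).2
  · rw [norm_mul, norm_mul, norm_neg]
    refine mul_le_of_le_one_right (norm_nonneg _) (mul_le_one₀ ?_ (norm_nonneg _) ?_)
    · exact abs_cos_le_one θ
    · exact abs_sin_le_one _
  · have := (((hasDerivAt_id x).mul_const (cos θ)).cos).const_mul (a θ)
    refine this.congr_deriv ?_
    simp only [id]
    ring

lemma hasDerivAt_integral_mul_sin {a : ℝ → ℝ} (ha : Continuous a) (r : ℝ) :
    HasDerivAt (fun r ↦ ∫ θ in 0..π, a θ * sin (r * cos θ))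
      (∫ θ in 0..π, a θ * (cos θ * cos (r * cos θ))) r := by
  refine (intervalIntegral.hasDerivAt_integral_of_dominated_loc_of_deriv_le
    (F := fun r θ ↦ a θ * sin (r * cos θ)) (F' := fun r θ ↦ a θ * (cos θ * cos (r * cos θ)))
    (bound := fun θ ↦ |a θ|) Filter.univ_mem
    (Filter.Eventually.of_forall fun x ↦ (by fun_prop : Continuous _).aestronglyMeasurable)
    ((by fun_prop : Continuous _).intervalIntegrable _ _)
    (by fun_prop : Continuous _).aestronglyMeasurable
    (Filter.Eventually.of_forall fun θ _ x _ ↦ ?_)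
    (ha.abs.intervalIntegrable _ _)
    (Filter.Eventually.of_forall fun θ _ x _ ↦ ?_)).2
  · rw [norm_mul, norm_mul]
    refine mul_le_of_le_one_right (norm_nonneg _) (mul_le_one₀ ?_ (norm_nonneg _) ?_)
    · exact abs_cos_le_one θ
    · exact abs_cos_le_one _
  · have := (((hasDerivAt_id x).mul_const (cos θ)).sin).const_mul (a θ)
    refine this.congr_deriv ?_
    simp only [id]
    ring

/-- Up to normalization `r * poissonIntegral n r` is `r ^ (1 - n / 2) * J_{n/2} r`, where `J` is the
Bessel function. -/
noncomputable def poissonIntegral (n : ℕ) (r : ℝ) : ℝ :=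
  ∫ θ in 0..π, sin θ ^ n * cos (r * cos θ)

noncomputable def poissonIntegralDeriv (n : ℕ) (r : ℝ) : ℝ :=
  ∫ θ in 0..π, sin θ ^ n * (-cos θ * sin (r * cos θ))

noncomputable def poissonIntegralDerivTwo (n : ℕ) (r : ℝ) : ℝ :=
  ∫ θ in 0..π, -sin θ ^ n * cos θ * (cos θ * cos (r * cos θ))

lemma hasDerivAt_poissonIntegral (n : ℕ) (r : ℝ) :
    HasDerivAt (poissonIntegral n) (poissonIntegralDeriv n r) r :=
  hasDerivAt_integral_mul_cos (by fun_prop) r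

lemma hasDerivAt_poissonIntegralDeriv (n : ℕ) (r : ℝ) :
    HasDerivAt (poissonIntegralDeriv n) (poissonIntegralDerivTwo n r) r := by
  have : poissonIntegralDeriv n = fun r ↦ ∫ θ in 0..π, (-sin θ ^ n * cos θ) * sin (r * cos θ) := by
    funext r
    simp only [poissonIntegralDeriv]
    congr 1
    funext θ
    ring
  rw [this]
  exact hasDerivAt_integral_mul_sin (by fun_prop) r

lemma poissonIntegral_ode (n : ℕ) (r : ℝ) :
    (n + 1) * poissonIntegralDeriv n r +
      r * (poissonIntegralDerivTwo n r + poissonIntegral n r) = 0 := by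
  have h := intervalIntegral.integral_eq_sub_of_hasDerivAt (a := 0) (b := π)
    (f := fun θ ↦ sin θ ^ (n + 1) * sin (r * cos θ))
    (f' := fun θ ↦ (n + 1) * sin θ ^ n * cos θ * sin (r * cos θ) +
      sin θ ^ (n + 1) * (cos (r * cos θ) * (r * -sin θ)))
    (fun θ _ ↦ by
      have := ((hasDerivAt_sin θ).pow (n + 1)).mul (((hasDerivAt_cos θ).const_mul r).sin)
      refine this.congr_deriv ?_
      simp)
    ((by fun_prop : Continuous _).intervalIntegrable _ _)
  simp only [sin_pi, sin_zero, ne_eq, Nat.add_eq_zero_iff, one_ne_zero, and_false,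
    not_false_eq_true, zero_pow, zero_mul, sub_zero] at h
  rw [poissonIntegral, poissonIntegralDeriv, poissonIntegralDerivTwo,
    ← intervalIntegral.integral_add ((by fun_prop : Continuous _).intervalIntegrable _ _)
      ((by fun_prop : Continuous _).intervalIntegrable _ _),
    ← intervalIntegral.integral_const_mul, ← intervalIntegral.integral_const_mul,
    ← intervalIntegral.integral_add ((by fun_prop : Continuous _).intervalIntegrable _ _)
      ((by fun_prop : Continuous _).intervalIntegrable _ _), ← neg_eq_zero, ← h,
    ← intervalIntegral.integral_neg]
  congr 1
  funext θ
  have := sin_sq_add_cos_sq θ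
  have e : sin θ ^ (n + 1) * (cos (r * cos θ) * (r * -sin θ)) =
    - r * sin θ ^ n * (cos (r * cos θ)) * (1 - cos θ ^ 2) := by
    rw [← this]; ring
  rw [e]
  ring

lemma poissonIntegral_zero_pos (n : ℕ) : 0 < poissonIntegral n 0 := by
  simp only [poissonIntegral, zero_mul, cos_zero, mul_one]
  exact integral_sin_pow_pos n

/-- The radial profile `g` of the first Neumann eigenfunctions of a ball of radius `R` in
`ℝⁿ`, together with its derivative and the quotient `h = g / r`. -/
structure IsNeumannProfile (n : ℕ) (R μ : ℝ) (g g' h : ℝ → ℝ) : Prop where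
  eq_mul : ∀ r, g r = r * h r
  continuous_quot : Continuous h
  quot_pos : ∀ r ∈ Icc 0 R, 0 < h r
  hasDerivAt : ∀ r, HasDerivAt g (g' r) r
  continuous_deriv : Continuous g'
  hasDerivAt_deriv : ∀ r, 0 < r →
    HasDerivAt g' (-(n - 1) / r * g' r + ((n - 1) / r ^ 2 - μ) * g r) r
  deriv_nonneg : ∀ r ∈ Icc 0 R, 0 ≤ g' r
  deriv_right : g' R = 0
  pos : 0 < μ

lemma exists_first_zero_of_profile {n : ℕ} (hn : 2 ≤ n) {j j' : ℝ → ℝ}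
    (hj : ∀ r, HasDerivAt j (j' r) r) (hj'c : Continuous j') (h0 : j 0 = 0) (h0' : 0 < j' 0)
    (hj' : ∀ r, 0 < r →
      HasDerivAt j' (-(n - 1) / r * j' r + ((n - 1) / r ^ 2 - 1) * j r) r) :
    ∃ p, 0 < p ∧ j' p = 0 ∧ ∀ r ∈ Ico 0 p, 0 < j' r := by
  have hpos : ∀ p, (∀ r, 0 ≤ r → r < p → j' r ≠ 0) → ∀ r ∈ Ico 0 p, 0 < j' r := by
    intro p hp r hr
    by_contra! hle
    obtain ⟨s, hs, hs0⟩ := intermediate_value_Icc' hr.1 hj'c.continuousOn ⟨hle, h0'.le⟩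
    exact hp s hs.1 (hs.2.trans_lt hr.2) hs0
  have hex : ∃ r, 0 ≤ r ∧ j' r = 0 := by
    by_contra! hne
    have hj'pos : ∀ r, 0 ≤ r → 0 < j' r := fun r hr ↦
      hpos (r + 1) (fun s hs _ ↦ hne s hs) r ⟨hr, by linarith⟩
    have hmono : StrictMonoOn j (Ici 0) := by
      refine strictMonoOn_of_deriv_pos (convex_Ici 0)
        (fun x _ ↦ (hj x).continuousAt.continuousWithinAt) fun x hx ↦ ?_
      rw [interior_Ici] at hx
      rw [(hj x).deriv]
      exact hj'pos x (le_of_lt hx)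
    set δ := j 1 with hδ
    have hδ0 : 0 < δ := by
      have := hmono (self_mem_Ici (a := (0 : ℝ))) (by simp : (1 : ℝ) ∈ Ici 0) one_pos
      rwa [h0] at this
    have hn' : (2 : ℝ) ≤ n := by exact_mod_cast hn
    set P : ℝ → ℝ := fun r ↦ r ^ (n - 1) * j' r + δ / 2 * r with hP
    have hPd : ∀ r, 0 < r →
        HasDerivAt P (r ^ (n - 1) * (((n - 1) / r ^ 2 - 1) * j r) + δ / 2) r := by
      intro r hr
      have := ((hasDerivAt_pow (n - 1) r).mul (hj' r hr)).add ((hasDerivAt_id r).const_mul (δ / 2))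
      refine this.congr_deriv ?_
      obtain ⟨m, rfl⟩ : ∃ m, n = m + 2 := ⟨n - 2, by omega⟩
      simp only [Nat.add_succ_sub_one, Nat.cast_add, Nat.cast_ofNat, Nat.cast_one]
      field_simp
      ring
    have hanti : AntitoneOn P (Ici (n : ℝ)) := by
      refine antitoneOn_of_deriv_nonpos (convex_Ici _)
        (fun x hx ↦ (hPd x (by have : (n : ℝ) ≤ x := hx; linarith)).continuousAt.continuousWithinAt)
        (fun x hx ↦ ?_) fun x hx ↦ ?_
      all_goals
        rw [interior_Ici] at hx
        have hx' : (n : ℝ) < x := hx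
        have hx0 : 0 < x := by linarith
      · exact (hPd x hx0).differentiableAt.differentiableWithinAt
      · rw [(hPd x hx0).deriv]
        have h1 : ((n : ℝ) - 1) / x ^ 2 ≤ 1 / 2 := by
          rw [div_le_div_iff₀ (by positivity) two_pos]
          nlinarith
        have h2 : δ ≤ j x :=
          hmono.monotoneOn (by simp : (1 : ℝ) ∈ Ici 0) (le_of_lt hx0 : (0 : ℝ) ≤ x) (by linarith)
        have h3 : 1 ≤ x ^ (n - 1) := one_le_pow₀ (by linarith)
        have h4 : ((n - 1) / x ^ 2 - 1) * j x ≤ - (δ / 2) := by nlinarith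
        nlinarith
    have hM : (n : ℝ) ≤ n + P n / (δ / 2) + 1 := by
      have : 0 ≤ P n / (δ / 2) := by
        have := hj'pos n (by positivity)
        simp only [hP]
        positivity
      linarith
    have h5 := hanti self_mem_Ici (mem_Ici.2 hM) hM
    have h6 : δ / 2 * (n + P n / (δ / 2) + 1) ≤ P (n + P n / (δ / 2) + 1) := by
      have h7 := hj'pos (n + P n / (δ / 2) + 1) (by linarith)
      have h8 : 0 ≤ (n + P n / (δ / 2) + 1) ^ (n - 1) := pow_nonneg (by linarith) _
      simp only [hP] at h7 h8 ⊢
      nlinarith [mul_nonneg h8 h7.le]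
    have h9 : δ / 2 * (n + P n / (δ / 2) + 1) = P n + δ / 2 * (n + 1) := by field_simp; ring
    nlinarith
  have hcl : IsClosed {r | 0 ≤ r ∧ j' r = 0} :=
    isClosed_Ici.inter (isClosed_singleton.preimage hj'c)
  have hbb : BddBelow {r | 0 ≤ r ∧ j' r = 0} := ⟨0, fun r hr ↦ hr.1⟩
  have hmem := hcl.csInf_mem hex hbb
  set p := sInf {r | 0 ≤ r ∧ j' r = 0}
  refine ⟨p, lt_of_le_of_ne hmem.1 fun h ↦ h0'.ne ?_, hmem.2, hpos p fun r hr hrp h ↦ ?_⟩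
  · nth_rewrite 2 [h]
    exact hmem.2.symm
  · exact (csInf_le hbb ⟨hr, h⟩).not_gt hrp

lemma exists_isNeumannProfile {n : ℕ} (hn : 2 ≤ n) {R : ℝ} (hR : 0 < R) :
    ∃ μ g g' h, IsNeumannProfile n R μ g g' h := by
  set j : ℝ → ℝ := fun r ↦ r * poissonIntegral n r with hj
  set j' : ℝ → ℝ := fun r ↦ poissonIntegral n r + r * poissonIntegralDeriv n r with hj'
  have hjd : ∀ r, HasDerivAt j (j' r) r := fun r ↦
    ((hasDerivAt_id r).mul (hasDerivAt_poissonIntegral n r)).congr_deriv (by simp [hj'])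
  have hj'd0 : ∀ r, HasDerivAt j' (2 * poissonIntegralDeriv n r + r * poissonIntegralDerivTwo n r) r :=
    fun r ↦ ((hasDerivAt_poissonIntegral n r).add
      ((hasDerivAt_id r).mul (hasDerivAt_poissonIntegralDeriv n r))).congr_deriv (by simp; ring)
  have hj'c : Continuous j' := continuous_iff_continuousAt.2 fun r ↦ (hj'd0 r).continuousAt
  have hj'd : ∀ r, 0 < r →
      HasDerivAt j' (-(n - 1) / r * j' r + ((n - 1) / r ^ 2 - 1) * j r) r := by
    intro r hr
    refine (hj'd0 r).congr_deriv ?_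
    have := poissonIntegral_ode n r
    simp only [hj, hj']
    field_simp
    linear_combination r * this
  obtain ⟨p, hp, hp0, hpos⟩ := exists_first_zero_of_profile hn hjd hj'c (by simp [hj])
    (by simpa [hj'] using poissonIntegral_zero_pos n) hj'd
  set k := p / R with hk
  have hk0 : 0 < k := div_pos hp hR
  have hkR : k * R = p := by rw [hk]; field_simp
  have hmono : StrictMonoOn j (Icc 0 p) := by
    refine strictMonoOn_of_deriv_pos (convex_Icc 0 p)
      (fun x _ ↦ (hjd x).continuousAt.continuousWithinAt) fun x hx ↦ ?_
    rw [interior_Icc] at hx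
    rw [(hjd x).deriv]
    exact hpos x ⟨hx.1.le, hx.2⟩
  have hlin : ∀ r : ℝ, HasDerivAt (fun r ↦ k * r) k r := fun r ↦ by
    simpa using (hasDerivAt_id r).const_mul k
  have hIcc : ∀ r ∈ Icc 0 R, k * r ∈ Icc 0 p := fun r hr ↦
    ⟨mul_nonneg hk0.le hr.1, by rw [← hkR]; exact mul_le_mul_of_nonneg_left hr.2 hk0.le⟩
  refine ⟨k ^ 2, fun r ↦ j (k * r), fun r ↦ k * j' (k * r), fun r ↦ k * poissonIntegral n (k * r),
    ⟨?_, ?_, ?_, ?_, ?_, ?_, ?_, ?_, by positivity⟩⟩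
  · intro r; simp only [hj]; ring
  · exact continuous_const.mul ((continuous_iff_continuousAt.2 fun r ↦
      (hasDerivAt_poissonIntegral n r).continuousAt).comp (continuous_const.mul continuous_id))
  · intro r hr
    refine mul_pos hk0 ?_
    rcases hr.1.eq_or_lt with h | h
    · rw [← h, mul_zero]; exact poissonIntegral_zero_pos n
    · have := hmono (left_mem_Icc.2 hp.le) (hIcc r hr) (mul_pos hk0 h)
      simp only [hj, zero_mul] at this
      exact pos_of_mul_pos_right this (mul_pos hk0 h).le
  · intro r
    exact ((hjd (k * r)).comp r (hlin r)).congr_deriv (by ring)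
  · exact continuous_const.mul (hj'c.comp (continuous_const.mul continuous_id))
  · intro r hr
    refine (((hj'd (k * r) (mul_pos hk0 hr)).comp r (hlin r)).const_mul k).congr_deriv ?_
    field_simp
  · intro r hr
    refine mul_nonneg hk0.le ?_
    rcases (hIcc r hr).2.eq_or_lt with h | h
    · rw [h, hp0]
    · exact (hpos _ ⟨(hIcc r hr).1, h⟩).le
  · simp only [hkR, hp0, mul_zero]

end Bessel

section OneDim

variable {n : ℕ} {R μ : ℝ} {g g' h : ℝ → ℝ}

lemma IsNeumannProfile.fun_pos (hg : IsNeumannProfile n R μ g g' h) {r : ℝ} (hr : r ∈ Ioc 0 R) :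
    0 < g r := by
  rw [hg.eq_mul]
  exact mul_pos hr.1 (hg.quot_pos r ⟨hr.1.le, hr.2⟩)

/-- A Picone-type estimate for the nonradial part of a function on the ball. -/
lemma IsNeumannProfile.integral_angular_nonneg (hg : IsNeumannProfile n R μ g g' h) (hn : 2 ≤ n)
    (hR : 0 < R) {X X' Y Z : ℝ → ℝ} (hX : ∀ r, HasDerivAt X (X' r) r) (hX0 : X 0 = 0)
    (hZ : Continuous Z) (hXY : ∀ r t, t * X' r ≤ Y r + t ^ 2 * X r)
    (hYZ : ∀ r, 0 < r → Y r + (n - 1) / r ^ 2 * X r ≤ Z r) :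
    0 ≤ ∫ r in 0..R, r ^ (n - 1) * (Z r - μ * X r) := by
  obtain ⟨k, rfl⟩ : ∃ k, n = k + 2 := ⟨n - 2, by omega⟩
  simp only [Nat.add_succ_sub_one, Nat.cast_add, Nat.cast_ofNat] at hYZ ⊢
  have hXc : Continuous X := continuous_iff_continuousAt.2 fun r ↦ (hX r).continuousAt
  set Ψ : ℝ → ℝ := fun r ↦ r ^ k * (g' r * X r) / h r with hΨ
  have hc : ContinuousOn Ψ (Icc 0 R) := by
    refine ContinuousOn.div ?_ hg.continuous_quot.continuousOn fun r hr ↦ (hg.quot_pos r hr).ne'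
    exact ((continuous_pow k).mul (hg.continuous_deriv.mul hXc)).continuousOn
  have key := intervalIntegral.sub_le_integral_of_hasDeriv_right_of_le hR.le hc
    (g' := fun r ↦ r ^ (k + 1) * (((k + 1) / r ^ 2 - μ) * X r + (g' r / g r) * X' r -
      (g' r / g r) ^ 2 * X r)) (φ := fun r ↦ r ^ (k + 1) * (Z r - μ * X r))
    (fun r hr ↦ ?_) ((by fun_prop : Continuous _).integrableOn_Icc) (fun r hr ↦ ?_)
  · have h0 : Ψ 0 = 0 := by simp [hΨ, hX0]
    have h1 : Ψ R = 0 := by simp [hΨ, hg.deriv_right]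
    linarith
  · have hr0 : 0 < r := hr.1
    have hgp := hg.fun_pos ⟨hr.1, hr.2.le⟩
    have h1 : HasDerivAt (fun r ↦ r ^ (k + 1) * (g' r * X r) / g r) (r ^ (k + 1) *
        (((k + 1) / r ^ 2 - μ) * X r + (g' r / g r) * X' r - (g' r / g r) ^ 2 * X r)) r := by
      have := ((hasDerivAt_pow (k + 1) r).mul ((hg.hasDerivAt_deriv r hr0).mul (hX r))).div
        (hg.hasDerivAt r) hgp.ne'
      refine this.congr_deriv ?_
      simp only [Nat.cast_add, Nat.cast_one, add_tsub_cancel_right]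
      simp only [Pi.mul_apply]
      field_simp
      ring
    refine (h1.congr_of_eventuallyEq ?_).hasDerivWithinAt
    filter_upwards [lt_mem_nhds hr0] with s hs
    simp only [hΨ, hg.eq_mul s]
    field_simp
    ring
  · have h1 := hXY r (g' r / g r)
    have h2 := hYZ r hr.1
    refine mul_le_mul_of_nonneg_left ?_ (pow_nonneg hr.1.le _)
    have e : ((k : ℝ) + 2 - 1) = k + 1 := by ring
    rw [e] at h2
    linarith

/-- The Neumann problem for radial functions on the ball. -/
lemma IsNeumannProfile.integral_radial_le (hg : IsNeumannProfile n R μ g g' h) (hn : 2 ≤ n)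
    (hR : 0 < R) {m m' : ℝ → ℝ} (hm : ∀ r, HasDerivAt m (m' r) r) (hm' : Continuous m')
    (h0 : ∫ r in 0..R, r ^ (n - 1) * m r = 0) :
    0 ≤ ∫ r in 0..R, r ^ (n - 1) * (m' r ^ 2 - μ * m r ^ 2) := by
  obtain ⟨k, rfl⟩ : ∃ k, n = k + 2 := ⟨n - 2, by omega⟩
  simp only [Nat.add_succ_sub_one] at h0 ⊢
  have hmc : Continuous m := continuous_iff_continuousAt.2 fun r ↦ (hm r).continuousAt
  set M : ℝ → ℝ := fun r ↦ ∫ s in 0..r, s ^ (k + 1) * m s with hM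
  set N : ℝ → ℝ := fun r ↦ ∫ t in 0..1, t ^ (k + 1) * m (r * t) with hN
  have hMd : ∀ r, HasDerivAt M (r ^ (k + 1) * m r) r := fun r ↦
    ((continuous_pow (k + 1)).mul hmc).integral_hasStrictDerivAt 0 r |>.hasDerivAt
  have hNc : Continuous N := by
    refine intervalIntegral.continuous_parametric_intervalIntegral_of_continuous' ?_ 0 1
    simp only [Function.uncurry_def]
    fun_prop
  have hMN : ∀ r, M r = r ^ (k + 2) * N r := by
    intro r
    have := intervalIntegral.mul_integral_comp_mul_left (a := 0) (b := 1)
      (f := fun s ↦ s ^ (k + 1) * m s) r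
    rw [mul_zero, mul_one] at this
    simp only [hM, hN]
    rw [← this, pow_succ', mul_assoc, ← intervalIntegral.integral_const_mul (r ^ (k + 1))]
    congr 2
    funext t
    ring
  set q : ℝ → ℝ := fun r ↦ g' r + (k + 1) * h r with hq
  have hqc : Continuous q := hg.continuous_deriv.add (continuous_const.mul hg.continuous_quot)
  set Ψ : ℝ → ℝ := fun r ↦ μ * (r ^ (k + 2) * (N r ^ 2 * q r) / h r) - 2 * μ * (m r * M r) with hΨ
  have hMc : Continuous M := continuous_iff_continuousAt.2 fun r ↦ (hMd r).continuousAt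
  have hc : ContinuousOn Ψ (Icc 0 R) := by
    refine ContinuousOn.sub (continuousOn_const.mul (ContinuousOn.div ?_
      hg.continuous_quot.continuousOn fun r hr ↦ (hg.quot_pos r hr).ne')) ?_
    · exact ((continuous_pow _).mul ((hNc.pow 2).mul hqc)).continuousOn
    · exact (continuous_const.mul (hmc.mul hMc)).continuousOn
  have key := intervalIntegral.sub_le_integral_of_hasDeriv_right_of_le hR.le hc
    (g' := fun r ↦ μ * (2 * m r * M r * q r / g r - μ * M r ^ 2 / r ^ (k + 1) -
      M r ^ 2 * q r ^ 2 / (r ^ (k + 1) * g r ^ 2)) - 2 * μ * (m' r * M r + r ^ (k + 1) * m r ^ 2))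
    (φ := fun r ↦ r ^ (k + 1) * (m' r ^ 2 - μ * m r ^ 2))
    (fun r hr ↦ ?_) ((by fun_prop : Continuous _).integrableOn_Icc) (fun r hr ↦ ?_)
  · have h2 : Ψ 0 = 0 := by simp [hΨ, hMN 0]
    have h1 : Ψ R = 0 := by
      have h3 : M R = 0 := h0
      have h4 : N R = 0 := by
        rw [hMN R] at h3
        exact (mul_eq_zero.1 h3).resolve_left (pow_ne_zero _ hR.ne')
      simp [hΨ, h3, h4]
    linarith
  · have hr0 : 0 < r := hr.1
    have hgp := hg.fun_pos ⟨hr.1, hr.2.le⟩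
    have hqd : HasDerivAt q (-μ * g r) r := by
      have h1 := (hg.hasDerivAt_deriv r hr0).add
        (((hg.hasDerivAt r).div (hasDerivAt_id r) hr0.ne').const_mul (k + 1 : ℝ))
      refine (h1.congr_deriv ?_).congr_of_eventuallyEq ?_
      · simp only [Nat.cast_add, Nat.cast_ofNat, id]
        field_simp
        ring
      · filter_upwards [lt_mem_nhds hr0] with s hs
        simp only [hq, Pi.add_apply, Pi.div_apply, hg.eq_mul s, id]
        field_simp
    have h1 : HasDerivAt (fun r ↦ μ * (M r ^ 2 * q r / (r ^ (k + 1) * g r)) - 2 * μ * (m r * M r))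
        (μ * (2 * m r * M r * q r / g r - μ * M r ^ 2 / r ^ (k + 1) -
      M r ^ 2 * q r ^ 2 / (r ^ (k + 1) * g r ^ 2)) -
        2 * μ * (m' r * M r + r ^ (k + 1) * m r ^ 2)) r := by
      have h2 := (((((hMd r).pow 2).mul hqd).div
        ((hasDerivAt_pow (k + 1) r).mul (hg.hasDerivAt r))
        (mul_pos (pow_pos hr0 _) hgp).ne').const_mul μ).sub
        (((hm r).mul (hMd r)).const_mul (2 * μ))
      refine h2.congr_deriv ?_
      have hg'q : g' r = q r - (k + 1) * (g r / r) := by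
        simp only [hq, hg.eq_mul r]; field_simp; ring
      simp only [Nat.cast_add, Nat.cast_one,
        add_tsub_cancel_right, Pi.mul_apply, Pi.pow_apply, hg'q]
      have hr0' := hr0.ne'
      have hgp' := hgp.ne'
      generalize g r = G at *
      generalize q r = Q at *
      generalize M r = MM at *
      field_simp
      ring
    refine (h1.congr_of_eventuallyEq ?_).hasDerivWithinAt
    filter_upwards [lt_mem_nhds hr0] with s hs
    simp only [hΨ, hg.eq_mul s, hMN s]
    field_simp
    ring
  · have hr0 : 0 < r := hr.1
    have hgp := hg.fun_pos ⟨hr.1, hr.2.le⟩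
    have hp : 0 < r ^ (k + 1) := pow_pos hr0 _
    have hμ := hg.pos
    generalize g r = G at *
    generalize q r = Q at *
    generalize M r = A at *
    generalize r ^ (k + 1) = P at *
    have : P * (m' r ^ 2 - μ * m r ^ 2) - (μ * (2 * m r * A * Q / G - μ * A ^ 2 / P -
      A ^ 2 * Q ^ 2 / (P * G ^ 2)) - 2 * μ * (m' r * A + P * m r ^ 2)) =
      (P * m' r + μ * A) ^ 2 / P + μ * (P * m r - A * Q / G) ^ 2 / P := by
      field_simp
      ring
    have h2 : 0 ≤ (P * m' r + μ * A) ^ 2 / P + μ * (P * m r - A * Q / G) ^ 2 / P := by positivity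
    linarith

end OneDim

section Polar

variable {n : ℕ}

lemma hasDerivAt_integral_orth {F F' : ℝ → OrthGroup n → ℝ}
    (hF : Continuous (Function.uncurry F)) (hF' : Continuous (Function.uncurry F'))
    (hd : ∀ r A, HasDerivAt (fun r ↦ F r A) (F' r A) r) (r : ℝ) :
    HasDerivAt (fun r ↦ ∫ A, F r A ∂orthHaar n) (∫ A, F' r A ∂orthHaar n) r := by
  obtain ⟨C, hC⟩ := ((isCompact_closedBall r (1 : ℝ)).prod
    (isCompact_univ (X := OrthGroup n))).exists_bound_of_continuousOn hF'.continuousOn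
  exact (hasDerivAt_integral_of_dominated_loc_of_deriv_le (bound := fun _ ↦ C)
    (Metric.closedBall_mem_nhds r one_pos)
    (Filter.Eventually.of_forall fun s ↦
      (integrable_orth (hF.comp (Continuous.prodMk_right s))).aestronglyMeasurable)
    (integrable_orth (hF.comp (Continuous.prodMk_right r)))
    (integrable_orth (hF'.comp (Continuous.prodMk_right r))).aestronglyMeasurable
    (Filter.Eventually.of_forall fun A s hs ↦ hC (s, A) ⟨hs, mem_univ _⟩)
    (integrable_const C)
    (Filter.Eventually.of_forall fun A s _ ↦ hd s A)).2

lemma continuous_integral_orth {F : ℝ → OrthGroup n → ℝ}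
    (hF : Continuous (Function.uncurry F)) : Continuous fun r ↦ ∫ A, F r A ∂orthHaar n := by
  simpa using continuous_parametric_integral_of_continuous (μ := orthHaar n) hF isCompact_univ

lemma continuous_uncurry_orth {X : Type*} [TopologicalSpace X]
    {f : EuclideanSpace ℝ (Fin n) → X} (hf : Continuous f) (e : EuclideanSpace ℝ (Fin n)) :
    Continuous (Function.uncurry fun (r : ℝ) (A : OrthGroup n) ↦ f (r • A.1 e)) :=
  hf.comp (continuous_fst.smul
    (continuous_orth_apply.comp (continuous_snd.prodMk continuous_const)))

/-- Integration in polar coordinates, where the spherical mean is an average over rotations. -/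
lemma setIntegral_ball_eq_orth {f : EuclideanSpace ℝ (Fin n) → ℝ} (hf : Continuous f)
    {e : EuclideanSpace ℝ (Fin n)} (he : ‖e‖ = 1) {R : ℝ} (hR : 0 ≤ R) :
    ∫ x in Metric.ball (0 : EuclideanSpace ℝ (Fin n)) R, f x =
      n * volume.real (Metric.ball (0 : EuclideanSpace ℝ (Fin n)) 1) *
        ∫ r in 0..R, r ^ (n - 1) * ∫ A, f (r • A.1 e) ∂orthHaar n := by
  have : Nontrivial (EuclideanSpace ℝ (Fin n)) := ⟨e, 0, fun h ↦ by simp [h] at he⟩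
  set S := Metric.ball (0 : EuclideanSpace ℝ (Fin n)) R with hS
  have hc : Continuous (Function.uncurry fun (x : EuclideanSpace ℝ (Fin n)) (A : OrthGroup n) ↦
      f (A.1 x)) := hf.comp (continuous_orth_apply.comp (continuous_snd.prodMk continuous_fst))
  have hi : Integrable (Function.uncurry fun (x : EuclideanSpace ℝ (Fin n)) (A : OrthGroup n) ↦
      f (A.1 x)) ((volume.restrict S).prod (orthHaar n)) := by
    rw [← Measure.restrict_univ (μ := orthHaar n), Measure.prod_restrict]
    exact (hc.continuousOn.integrableOn_compact
      ((isCompact_closedBall (0 : EuclideanSpace ℝ (Fin n)) R).prod isCompact_univ)).mono_set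
      (prod_mono Metric.ball_subset_closedBall subset_rfl)
  have h1 : ∀ A : OrthGroup n, ∫ x in S, f (A.1 x) = ∫ x in S, f x := by
    intro A
    have h2 := (Unitary.linearIsometryEquiv A).measurePreserving.setIntegral_preimage_emb
      (Unitary.linearIsometryEquiv A).toHomeomorph.measurableEmbedding f S
    have h3 : (Unitary.linearIsometryEquiv A) ⁻¹' S = S := by
      ext x
      simp [hS]
    rw [h3] at h2
    exact h2
  have h4 : ∫ x in S, f x = ∫ x in S, ∫ A, f (A.1 x) ∂orthHaar n := by
    rw [integral_integral_swap hi]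
    simp only [h1, integral_const, probReal_univ, one_smul]
  set φ : ℝ → ℝ := fun r ↦ ∫ A, f (r • A.1 e) ∂orthHaar n with hφ
  have h5 : ∀ x, ∫ A, f (A.1 x) ∂orthHaar n = φ ‖x‖ := by
    intro x
    rw [integral_orth_congr (y := ‖x‖ • e) (by rw [norm_smul, he, norm_norm, mul_one])]
    simp only [map_smul, hφ]
  have h6 : ∀ x, S.indicator (fun x ↦ φ ‖x‖) x = (Iio R).indicator φ ‖x‖ := by
    intro x
    simp only [indicator, hS, Metric.mem_ball, dist_zero_right, mem_Iio]
  rw [h4]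
  simp only [h5]
  rw [← integral_indicator Metric.isOpen_ball.measurableSet]
  rw [integral_congr_ae (Filter.Eventually.of_forall h6), integral_fun_norm_addHaar,
    finrank_euclideanSpace_fin, nsmul_eq_mul, smul_eq_mul, mul_assoc,
    intervalIntegral.integral_of_le hR, integral_Ioc_eq_integral_Ioo]
  congr 2
  have h7 : ∀ y, y ^ (n - 1) • (Iio R).indicator φ y =
      (Iio R).indicator (fun y ↦ y ^ (n - 1) * φ y) y := by
    intro y
    by_cases hy : y ∈ Iio R <;> simp [hy]
  simp only [h7]
  rw [setIntegral_indicator measurableSet_Iio]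
  rfl

/-- The Neumann problem on the ball, for functions of class `C¹`. -/
lemma IsNeumannProfile.mul_integral_sq_le_of_contDiff {R μ : ℝ} {g g' h : ℝ → ℝ}
    (hg : IsNeumannProfile n R μ g g' h) (hn : 2 ≤ n) (hR : 0 < R)
    {v : EuclideanSpace ℝ (Fin n) → ℝ} (hv : ContDiff ℝ 1 v)
    (h0 : ∫ x in Metric.ball 0 R, v x = 0) :
    μ * ∫ x in Metric.ball 0 R, v x ^ 2 ≤ ∫ x in Metric.ball 0 R, ‖fderiv ℝ v x‖ ^ 2 := by
  have hn0 : n ≠ 0 := by omega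
  let e : EuclideanSpace ℝ (Fin n) := EuclideanSpace.single ⟨0, by omega⟩ 1
  have he : ‖e‖ = 1 := by simp [e]
  have hvc : Continuous v := hv.continuous
  have hdc : Continuous (fderiv ℝ v) := hv.continuous_fderiv one_ne_zero
  have hcv := continuous_uncurry_orth hvc e
  have hcd : Continuous (Function.uncurry fun (r : ℝ) (A : OrthGroup n) ↦
      fderiv ℝ v (r • A.1 e) (A.1 e)) :=
    (continuous_uncurry_orth hdc e).clm_apply
      (continuous_orth_apply.comp (continuous_snd.prodMk continuous_const))
  have hcD := continuous_uncurry_orth (f := fun x ↦ ‖fderiv ℝ v x‖ ^ 2) (hdc.norm.pow 2) e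
  have hd : ∀ r (A : OrthGroup n), HasDerivAt (fun r : ℝ ↦ v (r • A.1 e))
      (fderiv ℝ v (r • A.1 e) (A.1 e)) r := fun r A ↦ by
    have h1 : HasDerivAt (fun r : ℝ ↦ r • A.1 e) (A.1 e) r := by
      simpa using (hasDerivAt_id r).smul_const (A.1 e)
    exact ((hv.differentiable one_ne_zero) _).hasFDerivAt.comp_hasDerivAt r h1
  set m : ℝ → ℝ := fun r ↦ ∫ A, v (r • A.1 e) ∂orthHaar n with hm
  set m' : ℝ → ℝ := fun r ↦ ∫ A, fderiv ℝ v (r • A.1 e) (A.1 e) ∂orthHaar n with hm'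
  set V : ℝ → ℝ := fun r ↦ ∫ A, v (r • A.1 e) ^ 2 ∂orthHaar n with hV
  set W : ℝ → ℝ := fun r ↦ ∫ A, v (r • A.1 e) * fderiv ℝ v (r • A.1 e) (A.1 e) ∂orthHaar n with hW
  set N : ℝ → ℝ := fun r ↦ ∫ A, (fderiv ℝ v (r • A.1 e) (A.1 e)) ^ 2 ∂orthHaar n with hN
  set D : ℝ → ℝ := fun r ↦ ∫ A, ‖fderiv ℝ v (r • A.1 e)‖ ^ 2 ∂orthHaar n with hD
  have hmd : ∀ r, HasDerivAt m (m' r) r := hasDerivAt_integral_orth hcv hcd hd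
  have hm'c : Continuous m' := continuous_integral_orth hcd
  have hDc : Continuous D := continuous_integral_orth hcD
  have hVd : ∀ r, HasDerivAt V (2 * W r) r := fun r ↦ by
    have := hasDerivAt_integral_orth (F := fun r A ↦ v (r • A.1 e) ^ 2)
      (continuous_uncurry_orth (f := fun x ↦ v x ^ 2) (hvc.pow 2) e)
      (F' := fun r A ↦ 2 * (v (r • A.1 e) * fderiv ℝ v (r • A.1 e) (A.1 e)))
      (continuous_const.mul (hcv.mul hcd))
      (fun r A ↦ ((hd r A).pow 2).congr_deriv (by simp; ring)) r
    rwa [integral_const_mul] at this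
  have hmc : Continuous m := continuous_iff_continuousAt.2 fun r ↦ (hmd r).continuousAt
  have hVc : Continuous V := continuous_iff_continuousAt.2 fun r ↦ (hVd r).continuousAt
  have hang := hg.integral_angular_nonneg hn hR (X := fun r ↦ V r - m r ^ 2)
    (X' := fun r ↦ 2 * W r - 2 * (m r * m' r)) (Y := fun r ↦ N r - m' r ^ 2)
    (Z := fun r ↦ D r - m' r ^ 2)
    (fun r ↦ ((hVd r).sub ((hmd r).pow 2)).congr_deriv (by simp; ring)) (by simp [hV, hm])
    (hDc.sub (hm'c.pow 2)) (fun r t ↦ ?_) (fun r hr ↦ ?_)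
  · have hrad := hg.integral_radial_le hn hR hmd hm'c (by
      rw [setIntegral_ball_eq_orth hvc he hR.le] at h0
      refine (mul_eq_zero.1 h0).resolve_left (mul_ne_zero (by exact_mod_cast hn0) ?_)
      exact (ENNReal.toReal_pos (Metric.measure_ball_pos _ _ one_pos).ne'
        measure_ball_lt_top.ne).ne')
    rw [setIntegral_ball_eq_orth (f := fun x ↦ v x ^ 2) (hvc.pow 2) he hR.le,
      setIntegral_ball_eq_orth (f := fun x ↦ ‖fderiv ℝ v x‖ ^ 2) (hdc.norm.pow 2) he hR.le, mul_left_comm]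
    refine mul_le_mul_of_nonneg_left ?_ (by positivity)
    rw [← sub_nonneg, ← intervalIntegral.integral_const_mul]
    change 0 ≤ (∫ r in 0..R, r ^ (n - 1) * D r) - ∫ r in 0..R, μ * (r ^ (n - 1) * V r)
    rw [← intervalIntegral.integral_sub ((by fun_prop : Continuous _).intervalIntegrable _ _)
      ((by fun_prop : Continuous _).intervalIntegrable _ _)]
    have := add_nonneg hang hrad
    rw [← intervalIntegral.integral_add ((by fun_prop : Continuous _).intervalIntegrable _ _)
      ((by fun_prop : Continuous _).intervalIntegrable _ _)] at this
    refine this.trans_eq ?_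
    congr 1
    funext r
    ring
  · have h1 : 0 ≤ ∫ A, ((fderiv ℝ v (r • A.1 e) (A.1 e) - m' r) - t * (v (r • A.1 e) - m r)) ^ 2
        ∂orthHaar n := integral_nonneg fun A ↦ sq_nonneg _
    have i1 : Integrable (fun A : OrthGroup n ↦ v (r • A.1 e)) (orthHaar n) :=
      integrable_orth (hcv.comp (Continuous.prodMk_right r))
    have i2 : Integrable (fun A : OrthGroup n ↦ v (r • A.1 e) ^ 2) (orthHaar n) :=
      integrable_orth ((hcv.pow 2).comp (Continuous.prodMk_right r))
    have i3 : Integrable (fun A : OrthGroup n ↦ fderiv ℝ v (r • A.1 e) (A.1 e)) (orthHaar n) :=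
      integrable_orth (hcd.comp (Continuous.prodMk_right r))
    have i4 : Integrable (fun A : OrthGroup n ↦ (fderiv ℝ v (r • A.1 e) (A.1 e)) ^ 2) (orthHaar n) :=
      integrable_orth ((hcd.pow 2).comp (Continuous.prodMk_right r))
    have i5 : Integrable (fun A : OrthGroup n ↦ v (r • A.1 e) * fderiv ℝ v (r • A.1 e) (A.1 e))
      (orthHaar n) := integrable_orth ((hcv.mul hcd).comp (Continuous.prodMk_right r))
    have h2 : ∫ A, ((fderiv ℝ v (r • A.1 e) (A.1 e) - m' r) - t * (v (r • A.1 e) - m r)) ^ 2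
        ∂orthHaar n = N r + t ^ 2 * V r + -2 * t * W r + (2 * t * m r - 2 * m' r) * m' r +
          (2 * t * m' r - 2 * t ^ 2 * m r) * m r + (m' r - t * m r) ^ 2 := by
      have i6 : Integrable (fun A : OrthGroup n ↦ (m' r - t * m r) ^ 2) (orthHaar n) :=
        integrable_const _
      have i7 := i4.add (i2.const_mul (t ^ 2))
      have i8 := i7.add (i5.const_mul (-2 * t))
      have i9 := i8.add (i3.const_mul (2 * t * m r - 2 * m' r))
      have i10 := i9.add (i1.const_mul (2 * t * m' r - 2 * t ^ 2 * m r))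
      have e1 := integral_add i10 i6
      have e2 := integral_add i9 (i1.const_mul (2 * t * m' r - 2 * t ^ 2 * m r))
      have e3 := integral_add i8 (i3.const_mul (2 * t * m r - 2 * m' r))
      have e4 := integral_add i7 (i5.const_mul (-2 * t))
      have e5 := integral_add i4 (i2.const_mul (t ^ 2))
      simp only [Pi.add_apply, integral_const_mul, integral_const, probReal_univ, one_smul]
        at e1 e2 e3 e4 e5
      rw [e2, e3, e4, e5] at e1
      refine Eq.trans ?_ e1
      congr 1
      funext A
      ring
    rw [h2] at h1
    nlinarith
  · have := poincare_sphere hn hv he r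
    have hr2 : 0 < r ^ 2 := by positivity
    have h3 : ((n : ℝ) - 1) / r ^ 2 * (V r - m r ^ 2) ≤ D r - N r := by
      rw [div_mul_eq_mul_div, div_le_iff₀' hr2]
      exact this
    linarith

end Polar

section Mollification

variable {E : Type*} [NormedAddCommGroup E] [InnerProductSpace ℝ E] [FiniteDimensional ℝ E]
  [MeasurableSpace E] [BorelSpace E]

lemma LipschitzWith.hasFDerivAt_integral_smul_comp_sub {u : E → ℝ} {K : NNReal}
    (hu : LipschitzWith K u) {ψ : E → ℝ} (hψc : Continuous ψ) (hψ : Integrable ψ) {x₀ : E}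
    (hi : Integrable fun t ↦ ψ t • u (x₀ - t)) :
    HasFDerivAt (fun x ↦ ∫ t, ψ t • u (x - t)) (∫ t, ψ t • fderiv ℝ u (x₀ - t)) x₀ := by
  refine (hasFDerivAt_integral_of_dominated_loc_of_lip (bound := fun t ↦ |ψ t| * K)
    Filter.univ_mem (Filter.Eventually.of_forall fun x ↦ ?_) hi ?_
    (Filter.Eventually.of_forall fun t ↦ ?_) (hψ.abs.mul_const _) ?_).2
  · exact (hψc.smul (hu.continuous.comp (continuous_const.sub continuous_id))).aestronglyMeasurable
  · exact hψc.aestronglyMeasurable.smul (((measurable_fderiv ℝ u).comp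
      (measurable_const.sub measurable_id)).aestronglyMeasurable)
  · refine (LipschitzWith.of_dist_le_mul fun x y ↦ ?_).lipschitzOnWith
    rw [dist_smul₀, Real.norm_eq_abs, Real.coe_nnabs, abs_mul, abs_abs, NNReal.abs_eq, mul_assoc]
    refine mul_le_mul_of_nonneg_left ?_ (abs_nonneg _)
    simpa using hu.dist_le_mul (x - t) (y - t)
  · have h1 := (quasiMeasurePreserving_sub_left (volume : Measure E) x₀).ae
      (hu.ae_differentiableAt (μ := volume))
    filter_upwards [h1] with t ht
    have h2 : HasFDerivAt (fun x ↦ u (x - t)) (fderiv ℝ u (x₀ - t)) x₀ :=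
      ht.hasFDerivAt.comp x₀ ((hasFDerivAt_id x₀).sub_const t)
    exact h2.const_smul (ψ t)

lemma LipschitzWith.exists_contDiff_approx {u : E → ℝ} {K : NNReal} (hu : LipschitzWith K u) :
    ∃ v : ℕ → E → ℝ, (∀ k, ContDiff ℝ 1 (v k)) ∧ (∀ k x, |v k x - u x| ≤ K) ∧
      (∀ x, Filter.Tendsto (fun k ↦ v k x) Filter.atTop (nhds (u x))) ∧
      (∀ k x, ‖fderiv ℝ (v k) x‖ ≤ K) ∧
      ∀ᵐ x, Filter.Tendsto (fun k ↦ fderiv ℝ (v k) x) Filter.atTop (nhds (fderiv ℝ u x)) := by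
  let φ : ℕ → ContDiffBump (0 : E) := fun k ↦
    ⟨1 / (k + 1) / 2, 1 / (k + 1), by positivity, half_lt_self (by positivity)⟩
  have hφ : Filter.Tendsto (fun k ↦ (φ k).rOut) Filter.atTop (nhds 0) :=
    tendsto_one_div_add_atTop_nhds_zero_nat
  have hφ1 : ∀ k, (φ k).rOut ≤ 1 := fun k ↦ by
    change 1 / ((k : ℝ) + 1) ≤ 1
    rw [div_le_one (by positivity)]
    linarith [k.cast_nonneg (α := ℝ)]
  set v : ℕ → E → ℝ := fun k ↦
    convolution ((φ k).normed volume) u (ContinuousLinearMap.lsmul ℝ ℝ) volume with hv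
  have hui : LocallyIntegrable u := hu.continuous.locallyIntegrable
  have hmeas : Measurable (fderiv ℝ u) := measurable_fderiv ℝ u
  have hnorm : ∀ x, ‖fderiv ℝ u x‖ ≤ K := fun x ↦ norm_fderiv_le_of_lipschitz ℝ hu
  have hd : ∀ k x, fderiv ℝ (v k) x = ∫ t, (φ k).normed volume t • fderiv ℝ u (x - t) := by
    intro k x
    refine (hu.hasFDerivAt_integral_smul_comp_sub (φ k).continuous_normed
      (φ k).integrable_normed ?_).fderiv
    refine Continuous.integrable_of_hasCompactSupport ?_ ?_
    · exact (φ k).continuous_normed.smul (hu.continuous.comp (continuous_const.sub continuous_id))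
    · exact (φ k).hasCompactSupport_normed.smul_right
  refine ⟨v, fun k ↦ ?_, fun k x ↦ ?_, fun x ↦ ?_, fun k x ↦ ?_, ?_⟩
  · exact_mod_cast (φ k).hasCompactSupport_normed.contDiff_convolution_left (n := 1) _
      (φ k).contDiff_normed hui
  · rw [← Real.dist_eq]
    refine ContDiffBump.dist_normed_convolution_le hu.continuous.aestronglyMeasurable
      fun y hy ↦ (hu.dist_le_mul y x).trans ?_
    refine mul_le_of_le_one_right K.2 ?_
    exact (Metric.mem_ball.1 hy).le.trans (hφ1 k)
  · exact ContDiffBump.convolution_tendsto_right_of_continuous hφ hu.continuous x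
  · rw [hd]
    refine (norm_integral_le_of_norm_le ((φ k).integrable_normed.mul_const (K : ℝ))
      (Filter.Eventually.of_forall fun t ↦ ?_)).trans_eq ?_
    · rw [norm_smul, Real.norm_of_nonneg ((φ k).nonneg_normed t)]
      exact mul_le_mul_of_nonneg_left (hnorm _) ((φ k).nonneg_normed t)
    · rw [integral_mul_const, (φ k).integral_normed, one_mul]
  · have hli : LocallyIntegrable (fderiv ℝ u) :=
      (locallyIntegrable_const (K : ℝ)).mono hmeas.aestronglyMeasurable
        (Filter.Eventually.of_forall fun x ↦ by simpa using hnorm x)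
    filter_upwards [ContDiffBump.ae_convolution_tendsto_right_of_locallyIntegrable (K := 2)
      (μ := volume) hφ (Filter.Eventually.of_forall fun k ↦
        (by change 1 / ((k : ℝ) + 1) ≤ 2 * (1 / (k + 1) / 2); linarith)) hli] with x hx
    simp only [hd]
    exact hx

/-- The Neumann problem on the ball, for Lipschitz functions. -/
lemma IsNeumannProfile.mul_integral_sq_le_of_lipschitz {n : ℕ} {R μ : ℝ} {g g' h : ℝ → ℝ}
    (hg : IsNeumannProfile n R μ g g' h) (hn : 2 ≤ n) (hR : 0 < R)
    {u : EuclideanSpace ℝ (Fin n) → ℝ} {K : NNReal} (hu : LipschitzWith K u)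
    (h0 : ∫ x in Metric.ball 0 R, u x = 0) :
    μ * ∫ x in Metric.ball 0 R, u x ^ 2 ≤ ∫ x in Metric.ball 0 R, ‖fderiv ℝ u x‖ ^ 2 := by
  obtain ⟨v, hvs, hvu, hvt, hvK, hvd⟩ := hu.exists_contDiff_approx
  set S := Metric.ball (0 : EuclideanSpace ℝ (Fin n)) R with hS
  have hSf : volume S ≠ ⊤ := measure_ball_lt_top.ne
  have : IsFiniteMeasure (volume.restrict S) := isFiniteMeasure_restrict.2 hSf
  have hS0 : 0 < volume.real S := ENNReal.toReal_pos (Metric.measure_ball_pos _ _ hR).ne' hSf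
  have hbd : ∃ C : ℝ, ∀ x ∈ S, ∀ k, |v k x| ≤ C := by
    refine ⟨|u 0| + K * R + K, fun x hx k ↦ ?_⟩
    have h1 : |u x - u 0| ≤ K * R := by
      rw [← Real.dist_eq]
      exact (hu.dist_le_mul x 0).trans (mul_le_mul_of_nonneg_left (Metric.mem_ball.1 hx).le K.2)
    have h2 := abs_add_three (v k x - u x) (u x - u 0) (u 0)
    rw [sub_add_sub_cancel, sub_add_cancel] at h2
    linarith [hvu k x]
  obtain ⟨C, hC⟩ := hbd
  have hIntegral : ∀ {f : EuclideanSpace ℝ (Fin n) → ℝ}, Continuous f → IntegrableOn f S := fun hf ↦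
    (hf.continuousOn.integrableOn_compact (isCompact_closedBall _ R)).mono_set
      Metric.ball_subset_closedBall
  have key : ∀ k, μ * ((∫ x in S, v k x ^ 2) - (∫ x in S, v k x) ^ 2 / volume.real S) ≤
      ∫ x in S, ‖fderiv ℝ (v k) x‖ ^ 2 := by
    intro k
    have hvc := (hvs k).continuous
    set a := (∫ x in S, v k x) / volume.real S with ha
    have haS : ∫ x in S, v k x = a * volume.real S := by rw [ha]; field_simp
    have h1 := hg.mul_integral_sq_le_of_contDiff hn hR (v := fun x ↦ v k x - a)
      ((hvs k).sub contDiff_const) (by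
        rw [integral_sub (hIntegral hvc) (integrable_const a), haS]
        simp [mul_comm, hS])
    simp only [fderiv_sub_const] at h1
    convert h1 using 2
    have h2 : ∀ x, (v k x - a) ^ 2 = v k x ^ 2 + (-2 * a) * v k x + a ^ 2 := fun x ↦ by ring
    simp only [h2]
    have i2 : IntegrableOn (fun x ↦ v k x ^ 2) S := hIntegral (hvc.pow 2)
    have i3 : IntegrableOn (fun x ↦ (-2 * a) * v k x) S := (hIntegral hvc).const_mul _
    have i4 : IntegrableOn (fun x ↦ v k x ^ 2 + (-2 * a) * v k x) S := i2.add i3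
    rw [integral_add i4 (integrable_const _), integral_add i2 i3, integral_const_mul, haS]
    simp only [integral_const, measureReal_restrict_apply_univ, smul_eq_mul, hS]
    rw [← hS]
    field_simp
    ring
  have t1 : Filter.Tendsto (fun k ↦ ∫ x in S, v k x ^ 2) Filter.atTop (nhds (∫ x in S, u x ^ 2)) := by
    refine tendsto_integral_of_dominated_convergence (fun _ ↦ C ^ 2)
      (fun k ↦ ((hvs k).continuous.pow 2).aestronglyMeasurable) (integrable_const _) (fun k ↦ ?_)
      (Filter.Eventually.of_forall fun x ↦ (hvt x).pow 2)
    filter_upwards [ae_restrict_mem Metric.isOpen_ball.measurableSet] with x hx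
    rw [norm_pow]
    exact pow_le_pow_left₀ (norm_nonneg _) (hC x hx k) 2
  have t2 : Filter.Tendsto (fun k ↦ ∫ x in S, v k x) Filter.atTop (nhds 0) := by
    rw [← h0]
    refine tendsto_integral_of_dominated_convergence (fun _ ↦ C)
      (fun k ↦ (hvs k).continuous.aestronglyMeasurable) (integrable_const _) (fun k ↦ ?_)
      (Filter.Eventually.of_forall fun x ↦ hvt x)
    filter_upwards [ae_restrict_mem Metric.isOpen_ball.measurableSet] with x hx
    exact hC x hx k
  have t3 : Filter.Tendsto (fun k ↦ ∫ x in S, ‖fderiv ℝ (v k) x‖ ^ 2) Filter.atTop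
      (nhds (∫ x in S, ‖fderiv ℝ u x‖ ^ 2)) := by
    refine tendsto_integral_of_dominated_convergence (fun _ ↦ (K : ℝ) ^ 2)
      (fun k ↦ (((hvs k).continuous_fderiv one_ne_zero).norm.pow 2).aestronglyMeasurable)
      (integrable_const _) (fun k ↦ Filter.Eventually.of_forall fun x ↦ ?_)
      (ae_restrict_of_ae (hvd.mono fun x hx ↦ hx.norm.pow 2))
    rw [norm_pow, norm_norm]
    exact pow_le_pow_left₀ (norm_nonneg _) (hvK k x) 2
  have t4 := ((t1.sub ((t2.pow 2).div_const (volume.real S))).const_mul μ)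
  simpa using le_of_tendsto_of_tendsto' t4 t3 key

end Mollification

section NeumannBall

variable {n : ℕ}

lemma Continuous.integrableOn_of_isBounded {D : Set (EuclideanSpace ℝ (Fin n))}
    (hb : Bornology.IsBounded D) {f : EuclideanSpace ℝ (Fin n) → ℝ} (hf : Continuous f) :
    IntegrableOn f D :=
  (hf.continuousOn.integrableOn_compact hb.isCompact_closure).mono_set subset_closure

lemma setIntegral_sq_pos {D : Set (EuclideanSpace ℝ (Fin n))} (hb : Bornology.IsBounded D)
    {u : EuclideanSpace ℝ (Fin n) → ℝ} (hu : Continuous u)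
    (h : ¬(u =ᵐ[volume.restrict D] 0)) : 0 < ∫ x in D, u x ^ 2 := by
  refine (integral_nonneg fun x ↦ sq_nonneg (u x)).lt_of_ne' fun h0 ↦ h ?_
  rw [integral_eq_zero_iff_of_nonneg (fun x ↦ sq_nonneg (u x))
    (Continuous.integrableOn_of_isBounded hb (hu.pow 2))] at h0
  filter_upwards [h0] with x hx
  simpa using hx

lemma lambda1N_nonneg (D : Set (EuclideanSpace ℝ (Fin n))) : 0 ≤ lambda1N n D := by
  refine Real.sInf_nonneg ?_
  rintro _ ⟨u, -, -, -, rfl⟩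
  positivity

lemma lambda1N_mul_le {D : Set (EuclideanSpace ℝ (Fin n))} (hb : Bornology.IsBounded D)
    {u : EuclideanSpace ℝ (Fin n) → ℝ} {K : NNReal} (hu : LipschitzWith K u)
    (h0 : ∫ x in D, u x = 0) :
    lambda1N n D * ∫ x in D, u x ^ 2 ≤ ∫ x in D, ‖fderiv ℝ u x‖ ^ 2 := by
  by_cases h : u =ᵐ[volume.restrict D] 0
  · have : ∫ x in D, u x ^ 2 = 0 := by
      rw [integral_eq_zero_of_ae]
      filter_upwards [h] with x hx
      simp [hx]
    rw [this, mul_zero]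
    positivity
  · rw [← le_div_iff₀ (setIntegral_sq_pos hb hu.continuous h)]
    refine csInf_le ⟨0, ?_⟩ ⟨u, ⟨K, hu⟩, h0, h, rfl⟩
    rintro _ ⟨u, -, -, -, rfl⟩
    positivity

lemma exists_lipschitz_integral_ball_eq_zero (hn : 2 ≤ n) (c : EuclideanSpace ℝ (Fin n)) {R : ℝ}
    (hR : 0 < R) : ∃ u : EuclideanSpace ℝ (Fin n) → ℝ, (∃ K, LipschitzWith K u) ∧
      (∫ x in Metric.ball c R, u x) = 0 ∧ ¬(u =ᵐ[volume.restrict (Metric.ball c R)] 0) := by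
  set S := Metric.ball c R with hSdef
  let i : Fin n := ⟨0, by omega⟩
  set a := (∫ x in S, x i) / volume.real S with ha
  have hS : volume.real S ≠ 0 :=
    (ENNReal.toReal_pos (Metric.measure_ball_pos _ _ hR).ne' measure_ball_lt_top.ne).ne'
  have hl : LipschitzWith 1 (fun x : EuclideanSpace ℝ (Fin n) ↦ x i - a) := by
    refine LipschitzWith.of_dist_le_mul fun x y ↦ ?_
    rw [dist_sub_right, NNReal.coe_one, one_mul, dist_eq_norm, dist_eq_norm]
    exact PiLp.norm_apply_le (x - y) i
  have hfin : IsFiniteMeasure (volume.restrict S) := ⟨by simpa using measure_ball_lt_top⟩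
  refine ⟨_, ⟨1, hl⟩, ?_, fun h ↦ ?_⟩
  · have hc : Continuous fun x : EuclideanSpace ℝ (Fin n) ↦ x i := by fun_prop
    have haS : ∫ x in S, x i = a * volume.real S := by rw [ha]; field_simp
    rw [integral_sub (Continuous.integrableOn_of_isBounded Metric.isBounded_ball hc)
      (integrable_const a), haS]
    simp [mul_comm, hSdef]
  · have h1 := Measure.eqOn_open_of_ae_eq h Metric.isOpen_ball hl.continuous.continuousOn
      continuousOn_const
    have h2 := h1 (Metric.mem_ball_self hR)
    have h3 := h1 (x := c + EuclideanSpace.single i (R / 2)) (by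
      rw [hSdef, Metric.mem_ball, dist_self_add_left]
      simpa [abs_of_pos hR] using half_lt_self hR)
    simp only [Pi.zero_apply, PiLp.add_apply, PiLp.single_apply, if_true] at h2 h3
    linarith

lemma IsNeumannProfile.le_lambda1N_ball {R μ : ℝ} {g g' h : ℝ → ℝ}
    (hg : IsNeumannProfile n R μ g g' h) (hn : 2 ≤ n) (hR : 0 < R)
    (c : EuclideanSpace ℝ (Fin n)) : μ ≤ lambda1N n (Metric.ball c R) := by
  refine le_csInf ?_ ?_
  · obtain ⟨u, hu, h0, h⟩ := exists_lipschitz_integral_ball_eq_zero hn c hR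
    exact ⟨_, u, hu, h0, h, rfl⟩
  · rintro _ ⟨u, ⟨K, hu⟩, h0, h, rfl⟩
    rw [le_div_iff₀ (setIntegral_sq_pos Metric.isBounded_ball hu.continuous h)]
    have htr : ∀ f : EuclideanSpace ℝ (Fin n) → ℝ,
        ∫ x in Metric.ball 0 R, f (x + c) = ∫ x in Metric.ball c R, f x := by
      intro f
      have := (measurePreserving_add_right volume c).setIntegral_preimage_emb
        (measurableEmbedding_addRight c) f (Metric.ball c R)
      rwa [Metric.preimage_add_right_ball, sub_self] at this
    have hu' : LipschitzWith K fun x ↦ u (x + c) := by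
      simpa [Function.comp_def] using hu.comp (isometry_add_right c).lipschitz
    have := hg.mul_integral_sq_le_of_lipschitz hn hR hu' (by rw [htr u, h0])
    simp only [fderiv_comp_add_right] at this
    rwa [htr fun x ↦ u x ^ 2, htr fun x ↦ ‖fderiv ℝ u x‖ ^ 2] at this

end NeumannBall

section RadialExtension

variable {n : ℕ} {R μ : ℝ} {g g' h H D : ℝ → ℝ}

/-- The profile `s ↦ s * H s` of Weinberger's trial vector field `y ↦ H ‖y‖ • y`, with derivative
`D`: a Neumann profile on `[0, R]`, continued by a constant. -/
structure IsTrialProfile (n : ℕ) (R μ : ℝ) (H D : ℝ → ℝ) : Prop where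
  continuous : Continuous H
  continuous_deriv : Continuous D
  nonneg : ∀ s, 0 ≤ s → 0 ≤ H s
  hasDerivAt : ∀ s, HasDerivAt (fun s ↦ s * H s) (D s) s
  antitone : AntitoneOn (fun s ↦ D s ^ 2 + (n - 1) * H s ^ 2) (Ici 0)
  monotone : MonotoneOn (fun s ↦ s * H s) (Ici 0)
  pos : 0 < R * H R
  integral_eq : ∫ r in 0..R, r ^ (n - 1) * (D r ^ 2 + (n - 1) * H r ^ 2 - μ * (r * H r) ^ 2) = 0

lemma IsNeumannProfile.hasDerivAt_quot (hg : IsNeumannProfile n R μ g g' h) {r : ℝ} (hr : 0 < r) :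
    HasDerivAt h ((g' r - h r) / r) r := by
  have h1 := (hg.hasDerivAt r).div (hasDerivAt_id r) hr.ne'
  refine (h1.congr_deriv ?_).congr_of_eventuallyEq ?_
  · simp only [hg.eq_mul r, id]
    field_simp
  · filter_upwards [lt_mem_nhds hr] with s hs
    simp only [Pi.div_apply, id, hg.eq_mul s]
    field_simp

lemma IsNeumannProfile.antitoneOn (hg : IsNeumannProfile n R μ g g' h) (hn : 2 ≤ n) :
    AntitoneOn (fun r ↦ g' r ^ 2 + (n - 1) * h r ^ 2) (Icc 0 R) := by
  have hn1 : (0 : ℝ) ≤ n - 1 := by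
    have : (2 : ℝ) ≤ n := by exact_mod_cast hn
    linarith
  refine antitoneOn_of_hasDerivWithinAt_nonpos (convex_Icc 0 R)
    (f' := fun r ↦ -(2 * (n - 1) / r * (g' r - h r) ^ 2 + 2 * μ * (g r * g' r))) ?_ ?_ ?_
  · exact ((hg.continuous_deriv.pow 2).add
      (continuous_const.mul (hg.continuous_quot.pow 2))).continuousOn
  · rw [interior_Icc]
    intro r hr
    have hr0 : r ≠ 0 := hr.1.ne'
    have h1 := ((hg.hasDerivAt_deriv r hr.1).pow 2).add
      (((hg.hasDerivAt_quot hr.1).pow 2).const_mul ((n : ℝ) - 1))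
    refine (h1.congr_deriv ?_).hasDerivWithinAt
    rw [hg.eq_mul r]
    field_simp
    ring
  · rw [interior_Icc]
    intro r hr
    have h1 := hg.fun_pos ⟨hr.1, hr.2.le⟩
    have h2 := hg.deriv_nonneg r ⟨hr.1.le, hr.2.le⟩
    have h3 := hg.pos
    have h4 := hr.1
    rw [neg_nonpos]
    positivity

lemma IsNeumannProfile.integral_eq_zero (hg : IsNeumannProfile n R μ g g' h) (hn : 2 ≤ n)
    (hR : 0 < R) :
    ∫ r in 0..R, r ^ (n - 1) * (g' r ^ 2 + (n - 1) * h r ^ 2 - μ * g r ^ 2) = 0 := by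
  obtain ⟨k, rfl⟩ : ∃ k, n = k + 2 := ⟨n - 2, by omega⟩
  simp only [Nat.add_succ_sub_one]
  have hgc : Continuous g := continuous_iff_continuousAt.2 fun r ↦ (hg.hasDerivAt r).continuousAt
  have hh := hg.continuous_quot
  have hd := hg.continuous_deriv
  rw [intervalIntegral.integral_eq_sub_of_hasDerivAt_of_le hR.le
    (f := fun r ↦ r ^ (k + 1) * (g r * g' r)) (by fun_prop) (fun r hr ↦ ?_)
    ((by fun_prop : Continuous _).intervalIntegrable _ _)]
  · simp [hg.deriv_right]
  · have hr0 : r ≠ 0 := hr.1.ne'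
    refine ((hasDerivAt_pow (k + 1) r).mul
      ((hg.hasDerivAt r).mul (hg.hasDerivAt_deriv r hr.1))).congr_deriv ?_
    simp only [Nat.cast_add, Nat.cast_one, Nat.cast_ofNat, add_tsub_cancel_right, Pi.mul_apply,
      hg.eq_mul r]
    field_simp
    ring

lemma IsNeumannProfile.exists_isTrialProfile (hg : IsNeumannProfile n R μ g g' h) (hn : 2 ≤ n)
    (hR : 0 < R) : ∃ H D, IsTrialProfile n R μ H D := by
  have hn1 : (0 : ℝ) ≤ n - 1 := by
    have : (2 : ℝ) ≤ n := by exact_mod_cast hn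
    linarith
  have hM : ∀ s, 0 < max s R := fun s ↦ hR.trans_le (le_max_right _ _)
  have hmul : ∀ s, s * (h (min s R) * (R / max s R)) = g (min s R) := by
    intro s
    have := (hM s).ne'
    rw [hg.eq_mul]
    rcases le_total s R with hs | hs
    · simp only [min_eq_left hs, max_eq_right hs] at *
      field_simp
    · simp only [min_eq_right hs, max_eq_left hs] at *
      field_simp
  have hmem : ∀ s, 0 ≤ s → min s R ∈ Icc 0 R := fun s hs ↦ ⟨le_min hs hR.le, min_le_right _ _⟩
  refine ⟨fun s ↦ h (min s R) * (R / max s R), fun s ↦ g' (min s R), ?_, ?_, ?_, ?_, ?_, ?_, ?_, ?_⟩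
  · exact (hg.continuous_quot.comp (by fun_prop)).mul
      (continuous_const.div (by fun_prop) fun s ↦ (hM s).ne')
  · exact hg.continuous_deriv.comp (by fun_prop)
  · intro s hs
    exact mul_nonneg (hg.quot_pos _ (hmem s hs)).le (div_nonneg hR.le (hM s).le)
  · intro s
    simp only [hmul]
    have hl : ∀ s ≤ R, HasDerivWithinAt (fun s ↦ g (min s R)) (g' (min s R)) (Iic R) s := by
      intro s hs
      rw [min_eq_left hs]
      refine (hg.hasDerivAt s).hasDerivWithinAt.congr (fun t ht ↦ ?_) ?_
      · rw [min_eq_left ht]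
      · rw [min_eq_left hs]
    have hr : ∀ s, R ≤ s → HasDerivWithinAt (fun s ↦ g (min s R)) (g' (min s R)) (Ici R) s := by
      intro s hs
      rw [min_eq_right hs, hg.deriv_right]
      refine (hasDerivWithinAt_const s _ (g R)).congr (fun t ht ↦ ?_) ?_
      · rw [min_eq_right ht]
      · rw [min_eq_right hs]
    rcases lt_trichotomy s R with hs | rfl | hs
    · exact (hl s hs.le).hasDerivAt (Iic_mem_nhds hs)
    · rw [← hasDerivWithinAt_univ, ← Iic_union_Ici (a := s)]
      exact (hl s le_rfl).union (hr s le_rfl)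
    · exact (hr s hs.le).hasDerivAt (Ici_mem_nhds hs)
  · intro a ha b hb hab
    simp only [mem_Ici] at ha hb
    have hρ : ∀ s, 0 ≤ R / max s R := fun s ↦ div_nonneg hR.le (hM s).le
    have hh := (hg.quot_pos _ (hmem b hb)).le
    beta_reduce
    rcases le_total a R with h1 | h1
    · have h2 := hg.antitoneOn hn (hmem a ha) (hmem b hb) (min_le_min_right R hab)
      have h3 : R / max a R = 1 := by rw [max_eq_right h1, div_self hR.ne']
      beta_reduce at h2
      have h4 : h (min b R) * (R / max b R) ≤ h (min b R) :=
        mul_le_of_le_one_right hh (div_le_one_of_le₀ (le_max_right _ _) (hM b).le)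
      rw [h3, mul_one]
      refine le_trans ?_ h2
      gcongr
    · have h2 : min b R = min a R := by rw [min_eq_right h1, min_eq_right (h1.trans hab)]
      have h5 := hM a
      rw [h2] at hh ⊢
      gcongr
  · have h1 : MonotoneOn g (Icc 0 R) := by
      refine monotoneOn_of_hasDerivWithinAt_nonneg (convex_Icc 0 R)
        (fun r _ ↦ (hg.hasDerivAt r).continuousAt.continuousWithinAt)
        (fun r _ ↦ (hg.hasDerivAt r).hasDerivWithinAt) fun r hr ↦ ?_
      exact hg.deriv_nonneg r (interior_subset hr)
    intro a ha b hb hab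
    simp only [hmul]
    exact h1 (hmem a ha) (hmem b hb) (min_le_min_right R hab)
  · rw [hmul, min_self]
    exact hg.fun_pos ⟨hR, le_rfl⟩
  · refine Eq.trans (intervalIntegral.integral_congr fun r hr ↦ ?_) (hg.integral_eq_zero hn hR)
    rw [uIcc_of_le hR.le] at hr
    simp only [min_eq_left hr.2, max_eq_right hr.2, div_self hR.ne', mul_one, hg.eq_mul r]

end RadialExtension

section TrialField

variable {n : ℕ} {R μ : ℝ} {H D : ℝ → ℝ}

lemma IsTrialProfile.exists_bound (h : IsTrialProfile n R μ H D) (hn : 2 ≤ n) :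
    ∃ L : NNReal, ∀ s, 0 ≤ s → |D s| ≤ L ∧ H s ≤ L := by
  have hn1 : (1 : ℝ) ≤ n - 1 := by
    have : (2 : ℝ) ≤ n := by exact_mod_cast hn
    linarith
  refine ⟨(√(D 0 ^ 2 + (n - 1) * H 0 ^ 2)).toNNReal, fun s hs ↦ ?_⟩
  have h1 := h.antitone (mem_Ici.2 le_rfl) (mem_Ici.2 hs) hs
  beta_reduce at h1
  rw [coe_toNNReal _ (sqrt_nonneg _)]
  constructor
  · refine abs_le_sqrt ?_
    nlinarith [sq_nonneg (H s)]
  · refine le_sqrt_of_sq_le ?_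
    nlinarith [sq_nonneg (H s), sq_nonneg (D s)]

lemma IsTrialProfile.exists_lipschitzWith (h : IsTrialProfile n R μ H D) (hn : 2 ≤ n)
    (E : Type*) [NormedAddCommGroup E] [InnerProductSpace ℝ E] :
    ∃ L, LipschitzWith L fun y : E ↦ H ‖y‖ • y := by
  obtain ⟨L, hL⟩ := h.exists_bound hn
  refine ⟨L, LipschitzWith.of_dist_le_mul fun x y ↦ ?_⟩
  have h1 : |‖x‖ * H ‖x‖ - ‖y‖ * H ‖y‖| ≤ L * |‖x‖ - ‖y‖| := by
    have := (convex_Ici (0 : ℝ)).norm_image_sub_le_of_norm_hasDerivWithin_le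
      (fun s _ ↦ (h.hasDerivAt s).hasDerivWithinAt) (fun s hs ↦ (hL s hs).1)
      (norm_nonneg y) (norm_nonneg x)
    simpa using this
  have h2 := h.nonneg _ (norm_nonneg x)
  have h3 := h.nonneg _ (norm_nonneg y)
  have h4 := (hL _ (norm_nonneg x)).2
  have h5 := (hL _ (norm_nonneg y)).2
  have h6 := real_inner_le_norm x y
  have h7 : H ‖x‖ * H ‖y‖ ≤ L * L := mul_le_mul h4 h5 h3 L.2
  rw [dist_eq_norm, dist_eq_norm]
  refine le_of_sq_le_sq ?_ (by positivity)
  have h8 := sq_le_sq' (by linarith [neg_abs_le (‖x‖ * H ‖x‖ - ‖y‖ * H ‖y‖)])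
    ((le_abs_self _).trans h1)
  rw [mul_pow, sq_abs] at h8
  rw [mul_pow, norm_sub_sq_real, norm_sub_sq_real, norm_smul, norm_smul, real_inner_smul_left,
    real_inner_smul_right, norm_of_nonneg h2, norm_of_nonneg h3]
  nlinarith [mul_le_mul_of_nonneg_right h7 (sub_nonneg.2 h6)]

lemma IsTrialProfile.hasFDerivAt_potential (h : IsTrialProfile n R μ H D)
    {E : Type*} [NormedAddCommGroup E] [InnerProductSpace ℝ E] (y : E) :
    HasFDerivAt (fun y : E ↦ ∫ t in 0..‖y‖ ^ 2, H √t) (innerSL ℝ ((2 * H ‖y‖) • y)) y := by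
  have hc : Continuous fun t ↦ H √t := h.continuous.comp continuous_sqrt
  have h1 := (hc.integral_hasStrictDerivAt 0 (‖y‖ ^ 2)).hasDerivAt.comp_hasFDerivAt y
    (hasStrictFDerivAt_norm_sq y).hasFDerivAt
  refine h1.congr_fderiv ?_
  rw [sqrt_sq (norm_nonneg y)]
  ext z
  simp
  ring

lemma IsTrialProfile.le_potential (h : IsTrialProfile n R μ H D) (hR : 0 < R)
    {s : ℝ} (hs : 0 ≤ s) : R * H R * (s - R) ≤ ∫ t in 0..s ^ 2, H √t := by
  have hc : Continuous fun t ↦ H √t := h.continuous.comp continuous_sqrt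
  have hpos : ∀ a, 0 ≤ a → 0 ≤ ∫ t in 0..a, H √t := fun a ha ↦
    intervalIntegral.integral_nonneg ha fun t _ ↦ h.nonneg _ (sqrt_nonneg t)
  have hm := h.pos
  rcases le_total s R with hsR | hsR
  · exact (mul_nonpos_of_nonneg_of_nonpos hm.le (sub_nonpos.2 hsR)).trans (hpos _ (sq_nonneg s))
  have hs0 : 0 < s := hR.trans_le hsR
  rw [← intervalIntegral.integral_add_adjacent_intervals (b := R ^ 2)
    (hc.intervalIntegrable _ _) (hc.intervalIntegrable _ _)]
  have h1 : ∫ t in R ^ 2..s ^ 2, R * H R / s ≤ ∫ t in R ^ 2..s ^ 2, H √t := by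
    refine intervalIntegral.integral_mono_on (pow_le_pow_left₀ hR.le hsR 2)
      intervalIntegrable_const (hc.intervalIntegrable _ _) fun t ht ↦ ?_
    have h2 : R ≤ √t := le_sqrt_of_sq_le ht.1
    have h3 : √t ≤ s := (sqrt_le_left hs).2 ht.2
    have h4 := h.monotone (mem_Ici.2 hR.le) (mem_Ici.2 (sqrt_nonneg t)) h2
    have h5 := h.nonneg _ (sqrt_nonneg t)
    rw [div_le_iff₀ hs0]
    beta_reduce at h4
    nlinarith
  rw [intervalIntegral.integral_const, smul_eq_mul] at h1
  have h6 : R * H R * (s - R) ≤ (s ^ 2 - R ^ 2) * (R * H R / s) := by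
    rw [mul_div_assoc', le_div_iff₀ hs0]
    nlinarith [mul_nonneg hm.le (mul_nonneg (sub_nonneg.2 hsR) hR.le)]
  linarith [hpos _ (sq_nonneg R)]

/-- Weinberger's centering argument, by minimizing a convex potential. -/
lemma IsTrialProfile.exists_center (h : IsTrialProfile n R μ H D) (hn : 2 ≤ n) (hR : 0 < R)
    {Ω : Set (EuclideanSpace ℝ (Fin n))} (hne : Ω.Nonempty) (ho : IsOpen Ω)
    (hb : Bornology.IsBounded Ω) :
    ∃ p, ∀ i, ∫ x in Ω, (H ‖x - p‖ • (x - p)) i = 0 := by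
  obtain ⟨L, hL⟩ := h.exists_lipschitzWith hn (EuclideanSpace ℝ (Fin n))
  have hUc := hL.continuous
  set U : EuclideanSpace ℝ (Fin n) → EuclideanSpace ℝ (Fin n) := fun y ↦ H ‖y‖ • y with hU
  set γ : EuclideanSpace ℝ (Fin n) → ℝ := fun y ↦ ∫ t in 0..‖y‖ ^ 2, H √t with hγ
  have hγd : ∀ y, HasFDerivAt γ (innerSL ℝ ((2 : ℝ) • U y)) y := fun y ↦ by
    simpa only [hU, smul_smul] using h.hasFDerivAt_potential y
  have hγc : Continuous γ := continuous_iff_continuousAt.2 fun y ↦ (hγd y).continuousAt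
  obtain ⟨ρ, hρ⟩ := hb.subset_closedBall 0
  have hfin : volume Ω ≠ ⊤ := hb.measure_lt_top.ne
  have hvol : 0 < volume.real Ω := ENNReal.toReal_pos (ho.measure_pos _ hne).ne' hfin
  have hfinm : IsFiniteMeasure (volume.restrict Ω) := isFiniteMeasure_restrict.2 hfin
  have hγi : ∀ p, IntegrableOn (fun x ↦ γ (x - p)) Ω := fun p ↦
    Continuous.integrableOn_of_isBounded hb (hγc.comp (continuous_sub_right p))
  set ψ : EuclideanSpace ℝ (Fin n) → ℝ := fun p ↦ ∫ x in Ω, γ (x - p) with hψ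
  have hU0 : ∀ y, ‖U y‖ ≤ L * ‖y‖ := fun y ↦ by
    have := hL.dist_le_mul y 0
    simpa [hU, dist_eq_norm] using this
  have hψd : ∀ p, HasFDerivAt ψ (∫ x in Ω, -innerSL ℝ ((2 : ℝ) • U (x - p)) :
      EuclideanSpace ℝ (Fin n) →L[ℝ] ℝ) p := by
    intro p
    refine hasFDerivAt_integral_of_dominated_of_fderiv_le (𝕜 := ℝ)
      (F' := fun p x ↦ -innerSL ℝ ((2 : ℝ) • U (x - p)))
      (Metric.ball_mem_nhds p one_pos)
      (bound := fun _ ↦ 2 * (L * (ρ + (‖p‖ + 1))))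
      (.of_forall fun q ↦ (hγi q).aestronglyMeasurable) (hγi p) ?_ ?_ (integrable_const _) ?_
    · refine Continuous.aestronglyMeasurable ?_
      exact ((innerSL ℝ).continuous.comp
        ((hUc.comp (continuous_sub_right p)).const_smul (2 : ℝ))).neg
    · filter_upwards [ae_restrict_mem ho.measurableSet] with x hx q hq
      rw [norm_neg, innerSL_apply_norm, norm_smul, norm_ofNat]
      gcongr
      refine (hU0 _).trans ?_
      gcongr
      refine (norm_sub_le _ _).trans (add_le_add (by simpa using hρ hx) ?_)
      have := norm_sub_norm_le q p
      rw [Metric.mem_ball, dist_eq_norm] at hq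
      linarith
    · refine .of_forall fun x q _ ↦ ?_
      have := (hγd (x - q)).comp q ((hasFDerivAt_id q).const_sub x)
      refine this.congr_fderiv ?_
      ext z
      simp
  have hψc : Continuous ψ := continuous_iff_continuousAt.2 fun y ↦ (hψd y).continuousAt
  have hlim : Filter.Tendsto ψ (Filter.cocompact _) Filter.atTop := by
    have hm := h.pos
    have h1 : Filter.Tendsto (fun p : EuclideanSpace ℝ (Fin n) ↦
        volume.real Ω * (R * H R) * (‖p‖ + -(ρ + R))) (Filter.cocompact _) Filter.atTop :=
      (Filter.tendsto_atTop_add_const_right _ _ (tendsto_norm_cocompact_atTop)).const_mul_atTop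
        (by positivity)
    refine Filter.tendsto_atTop_mono (fun p ↦ ?_) h1
    have h2 : ∫ x in Ω, R * H R * (‖p‖ + -(ρ + R)) ≤ ψ p := by
      refine setIntegral_mono_on (integrable_const _) (hγi p) ho.measurableSet fun x hx ↦ ?_
      refine le_trans ?_ (h.le_potential hR (norm_nonneg (x - p)))
      gcongr
      have h3 := norm_sub_norm_le p x
      have h4 : ‖x‖ ≤ ρ := by simpa using hρ hx
      rw [norm_sub_rev] at h3
      linarith
    simpa [mul_assoc] using h2
  obtain ⟨p, hp⟩ := hψc.exists_forall_le hlim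
  refine ⟨p, fun i ↦ ?_⟩
  have h0 := IsLocalMin.hasFDerivAt_eq_zero (Filter.Eventually.of_forall hp) (hψd p)
  have hi : IntegrableOn (fun x ↦ -innerSL ℝ ((2 : ℝ) • U (x - p))) Ω := by
    have : Continuous fun x ↦ -innerSL ℝ ((2 : ℝ) • U (x - p)) :=
      ((innerSL ℝ).continuous.comp ((hUc.comp (continuous_sub_right p)).const_smul (2 : ℝ))).neg
    exact (this.continuousOn.integrableOn_compact hb.isCompact_closure).mono_set subset_closure
  have h1 := congrArg (fun T ↦ T (EuclideanSpace.single i (1 : ℝ))) h0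
  rw [ContinuousLinearMap.integral_apply hi] at h1
  simp [integral_neg, integral_const_mul] at h1
  simpa [hU, EuclideanSpace.inner_single_right] using h1

end TrialField

section Weinberger

variable {n : ℕ} {R μ : ℝ} {H D : ℝ → ℝ}

lemma IsTrialProfile.hasFDerivAt_apply (h : IsTrialProfile n R μ H D)
    {y : EuclideanSpace ℝ (Fin n)} (hy : y ≠ 0) (i : Fin n) :
    HasFDerivAt (fun y : EuclideanSpace ℝ (Fin n) ↦ (H ‖y‖ • y) i)
      (innerSL ℝ (((D ‖y‖ - H ‖y‖) / ‖y‖ ^ 2 * y i) • y +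
        H ‖y‖ • EuclideanSpace.single i (1 : ℝ))) y := by
  have hy0 : 0 < ‖y‖ := norm_pos_iff.2 hy
  have hH : HasDerivAt H ((D ‖y‖ - H ‖y‖) / ‖y‖) ‖y‖ := by
    have h1 := (h.hasDerivAt ‖y‖).div (hasDerivAt_id ‖y‖) hy0.ne'
    refine (h1.congr_deriv ?_).congr_of_eventuallyEq ?_
    · simp only [id]
      field_simp
    · filter_upwards [lt_mem_nhds hy0] with s hs
      simp only [Pi.div_apply, id]
      field_simp
  have hnorm : HasFDerivAt (fun y : EuclideanSpace ℝ (Fin n) ↦ ‖y‖) (innerSL ℝ (‖y‖⁻¹ • y)) y := by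
    have h1 := ((hasStrictFDerivAt_norm_sq y).hasFDerivAt).sqrt (pow_ne_zero 2 hy0.ne')
    simp only [sqrt_sq (norm_nonneg _)] at h1
    refine h1.congr_fderiv ?_
    ext z
    simp
    ring
  have hi : HasFDerivAt (fun y : EuclideanSpace ℝ (Fin n) ↦ y i) (EuclideanSpace.proj (𝕜 := ℝ) i) y :=
    (EuclideanSpace.proj (𝕜 := ℝ) i).hasFDerivAt
  have h2 := (hH.comp_hasFDerivAt y hnorm).mul hi
  refine h2.congr_fderiv ?_
  ext z
  simp [EuclideanSpace.inner_single_left]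
  field_simp
  ring

lemma IsTrialProfile.sum_norm_fderiv_sq (h : IsTrialProfile n R μ H D)
    {y : EuclideanSpace ℝ (Fin n)} (hy : y ≠ 0) :
    ∑ i, ‖fderiv ℝ (fun y : EuclideanSpace ℝ (Fin n) ↦ (H ‖y‖ • y) i) y‖ ^ 2 =
      D ‖y‖ ^ 2 + (n - 1) * H ‖y‖ ^ 2 := by
  have hy0 : 0 < ‖y‖ := norm_pos_iff.2 hy
  have h1 : ∀ i, ‖fderiv ℝ (fun y : EuclideanSpace ℝ (Fin n) ↦ (H ‖y‖ • y) i) y‖ ^ 2 =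
      (((D ‖y‖ - H ‖y‖) / ‖y‖) ^ 2 + 2 * ((D ‖y‖ - H ‖y‖) / ‖y‖ ^ 2) * H ‖y‖) * y i ^ 2 +
        H ‖y‖ ^ 2 := by
    intro i
    rw [(h.hasFDerivAt_apply hy i).fderiv, innerSL_apply_norm, norm_add_sq_real, norm_smul,
      norm_smul, real_inner_smul_left, real_inner_smul_right, EuclideanSpace.inner_single_right,
      mul_pow, mul_pow, norm_eq_abs, norm_eq_abs, sq_abs, sq_abs]
    simp
    field_simp
  simp_rw [h1]
  rw [Finset.sum_add_distrib, ← Finset.mul_sum, ← EuclideanSpace.real_norm_sq_eq]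
  simp
  field_simp
  ring

lemma IsTrialProfile.lambda1N_mul_le (h : IsTrialProfile n R μ H D) (hn : 2 ≤ n)
    {Ω : Set (EuclideanSpace ℝ (Fin n))} (hb : Bornology.IsBounded Ω)
    {p : EuclideanSpace ℝ (Fin n)} (hp : ∀ i, ∫ x in Ω, (H ‖x - p‖ • (x - p)) i = 0) :
    lambda1N n Ω * ∫ x in Ω, (‖x - p‖ * H ‖x - p‖) ^ 2 ≤
      ∫ x in Ω, (D ‖x - p‖ ^ 2 + (n - 1) * H ‖x - p‖ ^ 2) := by
  obtain ⟨L, hL⟩ := h.exists_lipschitzWith hn (EuclideanSpace ℝ (Fin n))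
  have hfinm : IsFiniteMeasure (volume.restrict Ω) := isFiniteMeasure_restrict.2 hb.measure_lt_top.ne
  set u : Fin n → EuclideanSpace ℝ (Fin n) → ℝ := fun i x ↦ (H ‖x - p‖ • (x - p)) i with hu
  have hul : ∀ i, LipschitzWith L (u i) := by
    intro i
    refine LipschitzWith.of_dist_le_mul fun x y ↦ ?_
    have h1 := hL.dist_le_mul (x - p) (y - p)
    rw [dist_sub_right] at h1
    refine le_trans ?_ h1
    rw [dist_eq_norm, dist_eq_norm]
    exact PiLp.norm_apply_le (H ‖x - p‖ • (x - p) - H ‖y - p‖ • (y - p)) i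
  have hui : ∀ i, IntegrableOn (fun x ↦ u i x ^ 2) Ω := fun i ↦
    Continuous.integrableOn_of_isBounded hb ((hul i).continuous.pow 2)
  have hi : ∀ i, IntegrableOn (fun x ↦ ‖fderiv ℝ (u i) x‖ ^ 2) Ω := by
    intro i
    refine Integrable.of_bound (C := (L : ℝ) ^ 2)
      ((measurable_fderiv ℝ (u i)).norm.pow_const 2).aestronglyMeasurable
      (.of_forall fun x ↦ ?_)
    rw [norm_pow, norm_norm]
    exact pow_le_pow_left₀ (norm_nonneg _) (norm_fderiv_le_of_lipschitz ℝ (hul i)) 2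
  have h1 := Finset.sum_le_sum fun i (_ : i ∈ Finset.univ) ↦
    _root_.lambda1N_mul_le hb (hul i) (hp i)
  rw [← Finset.mul_sum, ← integral_finsetSum _ fun i _ ↦ hui i,
    ← integral_finsetSum _ fun i _ ↦ hi i] at h1
  have h2 : ∀ x, ∑ i, u i x ^ 2 = (‖x - p‖ * H ‖x - p‖) ^ 2 := by
    intro x
    simp only [hu]
    rw [← EuclideanSpace.real_norm_sq_eq, norm_smul, norm_eq_abs, mul_pow, sq_abs, mul_pow,
      mul_comm]
  have h3 : ∫ x in Ω, ∑ i, ‖fderiv ℝ (u i) x‖ ^ 2 =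
      ∫ x in Ω, (D ‖x - p‖ ^ 2 + (n - 1) * H ‖x - p‖ ^ 2) := by
    have : NeZero n := ⟨by omega⟩
    refine integral_congr_ae (ae_restrict_of_ae ?_)
    filter_upwards [compl_mem_ae_iff.2 (measure_singleton p)] with x hx
    rw [← h.sum_norm_fderiv_sq (sub_ne_zero.2 hx)]
    simp only [hu]
    refine Finset.sum_congr rfl fun i _ ↦ ?_
    rw [fderiv_comp_sub (f := fun y : EuclideanSpace ℝ (Fin n) ↦ (H ‖y‖ • y) i)]
  simp only [h2] at h1
  rwa [h3] at h1

lemma setIntegral_le_setIntegral_ball {Ω : Set (EuclideanSpace ℝ (Fin n))} (ho : IsOpen Ω)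
    (hb : Bornology.IsBounded Ω) {p : EuclideanSpace ℝ (Fin n)}
    (hvol : volume Ω = volume (Metric.ball p R)) (hR : 0 < R) {F : ℝ → ℝ} (hF : Continuous F)
    (hanti : AntitoneOn F (Ici 0)) :
    ∫ x in Ω, F ‖x - p‖ ≤ ∫ x in Metric.ball p R, F ‖x - p‖ := by
  set B := Metric.ball p R with hB
  have hc : Continuous fun x ↦ F ‖x - p‖ - F R :=
    (hF.comp (continuous_sub_right p).norm).sub continuous_const
  have hc' : Continuous fun x ↦ F ‖x - p‖ := hF.comp (continuous_sub_right p).norm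
  have hfin : IsFiniteMeasure (volume.restrict Ω) := isFiniteMeasure_restrict.2 hb.measure_lt_top.ne
  have hfin' : IsFiniteMeasure (volume.restrict B) :=
    isFiniteMeasure_restrict.2 measure_ball_lt_top.ne
  have hbB : Bornology.IsBounded B := Metric.isBounded_ball
  have h1 : ∫ x in Ω, (F ‖x - p‖ - F R) ≤ ∫ x in B, (F ‖x - p‖ - F R) := by
    rw [← integral_indicator ho.measurableSet,
      ← integral_indicator Metric.isOpen_ball.measurableSet]
    refine integral_mono ((Continuous.integrableOn_of_isBounded hb hc).integrable_indicator
        ho.measurableSet)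
      ((Continuous.integrableOn_of_isBounded hbB hc).integrable_indicator
        Metric.isOpen_ball.measurableSet) fun x ↦ ?_
    by_cases hx : x ∈ B
    · rw [indicator_of_mem hx]
      have h2 : F R ≤ F ‖x - p‖ := by
        rw [hB, Metric.mem_ball, dist_eq_norm] at hx
        exact hanti (norm_nonneg _) hR.le hx.le
      exact indicator_apply_le' (fun _ ↦ le_rfl) fun _ ↦ sub_nonneg.2 h2
    · rw [indicator_of_notMem hx]
      have h2 : F ‖x - p‖ ≤ F R := by
        rw [hB, Metric.mem_ball, dist_eq_norm, not_lt] at hx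
        exact hanti hR.le (norm_nonneg _) hx
      exact indicator_apply_le' (fun _ ↦ sub_nonpos.2 h2) fun _ ↦ le_rfl
  rw [integral_sub (Continuous.integrableOn_of_isBounded hb hc') (integrable_const _),
    integral_sub (Continuous.integrableOn_of_isBounded hbB hc') (integrable_const _)] at h1
  simpa [Measure.real, hvol] using h1

lemma IsTrialProfile.setIntegral_ball_eq (h : IsTrialProfile n R μ H D) (hn : 2 ≤ n)
    (hR : 0 < R) (p : EuclideanSpace ℝ (Fin n)) :
    ∫ x in Metric.ball p R, (D ‖x - p‖ ^ 2 + (n - 1) * H ‖x - p‖ ^ 2 -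
      μ * (‖x - p‖ * H ‖x - p‖) ^ 2) = 0 := by
  set F : ℝ → ℝ := fun s ↦ D s ^ 2 + (n - 1) * H s ^ 2 - μ * (s * H s) ^ 2 with hF
  have hH := h.continuous
  have hD := h.continuous_deriv
  have hFc : Continuous F := by fun_prop
  have htr := (measurePreserving_sub_right volume p).setIntegral_preimage_emb
    (MeasurableEquiv.subRight p).measurableEmbedding
    (fun x ↦ F ‖x‖) (Metric.ball 0 R)
  have hpre : (fun x ↦ x - p) ⁻¹' Metric.ball 0 R = Metric.ball p R := by
    ext x
    simp [dist_eq_norm]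
  rw [hpre] at htr
  change ∫ x in Metric.ball p R, F ‖x - p‖ = 0
  rw [htr]
  let i : Fin n := ⟨0, by omega⟩
  have he : ‖EuclideanSpace.single i (1 : ℝ)‖ = 1 := by simp
  rw [setIntegral_ball_eq_orth (f := fun x ↦ F ‖x‖) (hFc.comp continuous_norm) he hR.le]
  have h1 : ∫ r in 0..R, r ^ (n - 1) * ∫ A, F ‖r • A.1 (EuclideanSpace.single i (1 : ℝ))‖
      ∂orthHaar n = ∫ r in 0..R, r ^ (n - 1) * F r := by
    refine intervalIntegral.integral_congr fun r hr ↦ ?_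
    rw [uIcc_of_le hR.le] at hr
    have h2 : ∀ A : OrthGroup n, ‖r • A.1 (EuclideanSpace.single i (1 : ℝ))‖ = r := by
      intro A
      have h3 : ‖A.1 (EuclideanSpace.single i (1 : ℝ))‖ = 1 :=
        ((Unitary.linearIsometryEquiv A).norm_map _).trans he
      rw [norm_smul, h3, norm_of_nonneg hr.1, mul_one]
    simp only [h2]
    simp
  rw [h1, h.integral_eq, mul_zero]

lemma IsTrialProfile.lambda1N_le (h : IsTrialProfile n R μ H D) (hn : 2 ≤ n) (hR : 0 < R)
    {Ω : Set (EuclideanSpace ℝ (Fin n))} (hne : Ω.Nonempty) (ho : IsOpen Ω)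
    (hb : Bornology.IsBounded Ω) {c : EuclideanSpace ℝ (Fin n)}
    (hvol : volume Ω = volume (Metric.ball c R)) : lambda1N n Ω ≤ μ := by
  obtain ⟨p, hp⟩ := h.exists_center hn hR hne ho hb
  have hvolp : volume Ω = volume (Metric.ball p R) := by
    rw [hvol, Measure.addHaar_ball_center, ← Measure.addHaar_ball_center volume p]
  have hlam := h.lambda1N_mul_le hn hb hp
  have hH := h.continuous
  have hD := h.continuous_deriv
  set F : ℝ → ℝ := fun s ↦ D s ^ 2 + (n - 1) * H s ^ 2 with hF
  set Q : ℝ → ℝ := fun s ↦ (s * H s) ^ 2 with hQ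
  have hFc : Continuous F := by fun_prop
  have hQc : Continuous Q := by fun_prop
  have hcomp : ∀ {f : ℝ → ℝ}, Continuous f →
      Continuous fun x : EuclideanSpace ℝ (Fin n) ↦ f ‖x - p‖ := fun hf ↦
    hf.comp (continuous_sub_right p).norm
  have hl0 := lambda1N_nonneg Ω
  set l := lambda1N n Ω
  have hanti : AntitoneOn (fun s ↦ F s - l * Q s) (Ici 0) := by
    intro a ha b hb hab
    have h1 : F b ≤ F a := h.antitone ha hb hab
    have h2 : Q a ≤ Q b :=
      pow_le_pow_left₀ (mul_nonneg ha (h.nonneg a ha)) (h.monotone ha hb hab) 2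
    have h3 := mul_le_mul_of_nonneg_left h2 hl0
    beta_reduce
    linarith
  have h1 := setIntegral_le_setIntegral_ball ho hb hvolp hR (F := fun s ↦ F s - l * Q s)
    (hFc.sub (continuous_const.mul hQc)) hanti
  have hB : Bornology.IsBounded (Metric.ball p R) := Metric.isBounded_ball
  have h2 := h.setIntegral_ball_eq hn hR p
  change ∫ x in Metric.ball p R, (F ‖x - p‖ - μ * Q ‖x - p‖) = 0 at h2
  change l * ∫ x in Ω, Q ‖x - p‖ ≤ ∫ x in Ω, F ‖x - p‖ at hlam
  have hsub : ∀ {S : Set (EuclideanSpace ℝ (Fin n))} (a : ℝ), Bornology.IsBounded S →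
      ∫ x in S, (F ‖x - p‖ - a * Q ‖x - p‖) =
        (∫ x in S, F ‖x - p‖) - a * ∫ x in S, Q ‖x - p‖ := fun a hS ↦ by
    rw [integral_sub (Continuous.integrableOn_of_isBounded hS (hcomp hFc))
      ((Continuous.integrableOn_of_isBounded hS (hcomp hQc)).const_mul a), integral_const_mul]
  rw [hsub l hb, hsub l hB] at h1
  rw [hsub μ hB] at h2
  have hpos : 0 < ∫ x in Metric.ball p R, Q ‖x - p‖ := by
    refine setIntegral_sq_pos hB (hcomp (f := fun s ↦ s * H s) (by fun_prop)) fun h0 ↦ ?_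
    have h3 := Measure.eqOn_open_of_ae_eq h0 Metric.isOpen_ball
      (hcomp (f := fun s ↦ s * H s) (by fun_prop)).continuousOn continuousOn_const
    have h4 := h3.closure (hcomp (f := fun s ↦ s * H s) (by fun_prop)) continuous_const
    let i : Fin n := ⟨0, by omega⟩
    have h5 := h4 (x := p + EuclideanSpace.single i R) (by
      rw [closure_ball _ hR.ne', Metric.mem_closedBall, dist_self_add_left]
      simp [abs_of_pos hR])
    simp [abs_of_pos hR] at h5
    have h6 := h.pos
    rcases h5 with h5 | h5 <;> simp [h5] at h6
  refine le_of_mul_le_mul_right ?_ hpos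
  linarith

end Weinberger

/-- **The Szegő–Weinberger inequality:** among all bounded nonempty open sets of given
volume in `ℝⁿ` (`n ≥ 2`), the ball maximizes the first positive Neumann eigenvalue. -/
theorem szego_weinberger (n : ℕ) (hn : 2 ≤ n)
    (c : EuclideanSpace ℝ (Fin n)) (r : ℝ) (hr : 0 < r)
    (Ω : Set (EuclideanSpace ℝ (Fin n))) (hne : Ω.Nonempty) (ho : IsOpen Ω)
    (hb : Bornology.IsBounded Ω)
    (hvol : volume Ω = volume (Metric.ball c r)) :
    lambda1N n Ω ≤ lambda1N n (Metric.ball c r) := by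
  obtain ⟨μ, g, g', h, hg⟩ := exists_isNeumannProfile hn hr
  obtain ⟨H, D, hH⟩ := hg.exists_isTrialProfile hn hr
  exact (hH.lambda1N_le hn hr hne ho hb hvol).trans (hg.le_lambda1N_ball hn hr c)
end
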